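/- Let φ be an anisotropy on ℝ², I ⊆ ℝ an open interval, Λ ≥ 0, and u ∈ BV_loc(I). If the subgraph sg(u) is a Λ-local minimizer of the φ-perimeter P_φ in I×ℝ, then u is a Λ-local minimizer of 𝒜_φ in I. -/

import Mathlib

open MeasureTheory Set Filter Topology Bornology
open scoped ENNReal NNReal RealInnerProductSpace symmDiff

noncomputable section

abbrev E2 : Type := EuclideanSpace ℝ (Fin 2)

def vec2 (a b : ℝ) : E2 := (WithLp.equiv 2 (Fin 2 → ℝ)).symm ![a, b]

def e1 : E2 := vec2 1 0
def e2 : E2 := vec2 0 1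

/-- `φ` is an anisotropy (a norm) on `ℝ²`. -/
structure IsAnisotropy (φ : E2 → ℝ) : Prop where
  nonneg : ∀ x, 0 ≤ φ x
  eq_zero_iff : ∀ x, φ x = 0 ↔ x = 0
  smul_eq : ∀ (c : ℝ) (x : E2), φ (c • x) = |c| * φ x
  add_le : ∀ x y, φ (x + y) ≤ φ x + φ y
  bounds : ∃ c ∈ Set.Ioc (0:ℝ) 1, ∀ x : E2, ‖x‖ = 1 → c ≤ φ x ∧ φ x ≤ 1 / c

/-- The dual anisotropy `φ°(ξ) = max {⟪ξ,η⟫ : φ(η) = 1}`. -/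
def dualA (φ : E2 → ℝ) (ξ : E2) : ℝ := sSup {r : ℝ | ∃ η : E2, φ η = 1 ∧ r = ⟪ξ, η⟫}

/-- The Wulff shape `W^φ = {φ ≤ 1}`. -/
def wulff (φ : E2 → ℝ) : Set E2 := {x | φ x ≤ 1}

/-- The Wulff shape of radius `r` centered at `x`. -/
def wulffBall (φ : E2 → ℝ) (r : ℝ) (x : E2) : Set E2 := {y | φ (y - x) ≤ r}

/-- `φ` is partially monotone, i.e. even in each coordinate separately. -/
def PartiallyMonotone (φ : E2 → ℝ) : Prop := ∀ x : E2, φ x = φ (vec2 |x 0| |x 1|)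

/-- The Wulff shape of `φ` is symmetric with respect to both coordinate axes. -/
def AxisSymmetric (φ : E2 → ℝ) : Prop :=
  ∀ x : E2, φ (vec2 (-(x 0)) (x 1)) = φ x ∧ φ (vec2 (x 0) (-(x 1))) = φ x

/-- `W^φ` has no vertical facets: `±e₁` is an outer normal to `W^φ` only at `±e₁/φ(e₁)`. -/
def NoVerticalFacets (φ : E2 → ℝ) : Prop :=
  (∀ η ∈ wulff φ, (∀ y ∈ wulff φ, ⟪e1, y - η⟫ ≤ 0) → η = (φ e1)⁻¹ • e1) ∧
  (∀ η ∈ wulff φ, (∀ y ∈ wulff φ, ⟪-e1, y - η⟫ ≤ 0) → η = -((φ e1)⁻¹ • e1))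

/-- `φ` is elliptic: `φ - λ|·|` is again a norm for some `λ > 0`. -/
def IsElliptic (φ : E2 → ℝ) : Prop :=
  ∃ lam > (0:ℝ), IsAnisotropy (fun x => φ x - lam * ‖x‖)

/-- `φ` is a `C²`-anisotropy. -/
def IsC2Aniso (φ : E2 → ℝ) : Prop := ContDiffOn ℝ 2 φ {(0:E2)}ᶜ

/-- The anisotropic area `𝒜_φ(u,J)` (φ-total variation of `(-Du, L¹)`). -/
def aniArea (φ : E2 → ℝ) (u : ℝ → ℝ) (J : Set ℝ) : ℝ≥0∞ :=
  ⨆ (h₁ : ℝ → ℝ) (h₂ : ℝ → ℝ) (_ : ContDiff ℝ 1 h₁) (_ : ContDiff ℝ 1 h₂)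
    (_ : HasCompactSupport h₁) (_ : HasCompactSupport h₂)
    (_ : tsupport h₁ ⊆ J) (_ : tsupport h₂ ⊆ J)
    (_ : ∀ s ∈ J, φ (vec2 (h₁ s) (h₂ s)) ≤ 1),
    ENNReal.ofReal (∫ s in J, (u s * deriv h₁ s + h₂ s))

/-- The (Euclidean) total variation of `Du` on `J`. -/
def totalVar (u : ℝ → ℝ) (J : Set ℝ) : ℝ≥0∞ :=
  ⨆ (h : ℝ → ℝ) (_ : ContDiff ℝ 1 h) (_ : HasCompactSupport h) (_ : tsupport h ⊆ J)
    (_ : ∀ s ∈ J, |h s| ≤ 1), ENNReal.ofReal (∫ s in J, u s * deriv h s)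

/-- `u ∈ BV(I)`. -/
def BVOn (u : ℝ → ℝ) (I : Set ℝ) : Prop := IntegrableOn u I ∧ totalVar u I < ⊤

/-- `u ∈ BV_loc(I)`. -/
def BVLocOn (u : ℝ → ℝ) (I : Set ℝ) : Prop :=
  ∀ J : Set ℝ, IsOpen J → IsCompact (closure J) → closure J ⊆ I → BVOn u J

/-- The `L^∞`-norm of `u` on `I`. -/
def supNorm (u : ℝ → ℝ) (I : Set ℝ) : ℝ≥0∞ :=
  essSup (fun s => (‖u s‖₊ : ℝ≥0∞)) (volume.restrict I)

/-- The functional `G(u) = 𝒜_φ(u,I) + ∫_I |u-g|^p ds` (with value `+∞` when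
`u ∉ BV(I)` or `u - g ∉ L^p(I)`). -/
def Gfun (φ : E2 → ℝ) (p : ℝ) (g : ℝ → ℝ) (I : Set ℝ) (u : ℝ → ℝ) : ℝ≥0∞ :=
  aniArea φ u I + ∫⁻ s in I, ENNReal.ofReal (|u s - g s| ^ p)

/-- `u` minimizes `G` over `L¹(I)`. -/
def IsMinimizerG (φ : E2 → ℝ) (p : ℝ) (g : ℝ → ℝ) (I : Set ℝ) (u : ℝ → ℝ) : Prop :=
  IntegrableOn u I ∧ ∀ v : ℝ → ℝ, IntegrableOn v I → Gfun φ p g I u ≤ Gfun φ p g I v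

/-- `u` is a `Λ`-local minimizer of `𝒜_φ` in `I`. -/
def IsLambdaLocMin (φ : E2 → ℝ) (Λ : ℝ) (I : Set ℝ) (u : ℝ → ℝ) : Prop :=
  ∀ J : Set ℝ, IsOpen J → IsCompact (closure J) → closure J ⊆ I →
    ∀ ψ : ℝ → ℝ, ContDiff ℝ 1 ψ → HasCompactSupport ψ → tsupport ψ ⊆ J →
      aniArea φ u J ≤ aniArea φ (fun s => u s + ψ s) J + ENNReal.ofReal (Λ * ∫ s in J, |ψ s|)

/-- `ν` is the measure-theoretic outer unit normal of `E` at `x` (De Giorgi blow-up). -/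
def IsOuterNormalAt (E : Set E2) (x ν : E2) : Prop :=
  ‖ν‖ = 1 ∧ Tendsto
    (fun r : ℝ => volume (({y : E2 | x + r • y ∈ E} ∆ {y : E2 | ⟪y, ν⟫ ≤ 0}) ∩ Metric.ball (0:E2) 1))
    (𝓝[>] 0) (𝓝 0)

/-- The reduced boundary `∂*E`. -/
def redBoundary (E : Set E2) : Set E2 := {x | ∃ ν, IsOuterNormalAt E x ν}

open Classical in
/-- The generalized outer unit normal `ν_E`. -/
def genNormal (E : Set E2) (x : E2) : E2 :=
  if h : ∃ ν, IsOuterNormalAt E x ν then h.choose else 0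

/-- The anisotropic perimeter `P_φ(E,Ω) = ∫_{Ω ∩ ∂*E} φ°(ν_E) dH¹`. -/
def aniPer (φ : E2 → ℝ) (E : Set E2) (Ω : Set E2) : ℝ≥0∞ :=
  ∫⁻ x in Ω ∩ redBoundary E, ENNReal.ofReal (dualA φ (genNormal E x)) ∂μH[1]

/-- The divergence of a vector field on `ℝ²`. -/
def div2 (T : E2 → E2) (x : E2) : ℝ :=
  ∑ i : Fin 2, fderiv ℝ T x (EuclideanSpace.single i 1) i

/-- Distributional perimeter of `F` in an open set `Ω`. -/
def perVar (F : Set E2) (Ω : Set E2) : ℝ≥0∞ :=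
  ⨆ (T : E2 → E2) (_ : ContDiff ℝ 1 T) (_ : HasCompactSupport T) (_ : tsupport T ⊆ Ω)
    (_ : ∀ x, ‖T x‖ ≤ 1), ENNReal.ofReal (∫ x in F, div2 T x)

/-- `F` has locally finite perimeter in `Ω`. -/
def LocFinPer (F : Set E2) (Ω : Set E2) : Prop :=
  MeasurableSet F ∧ ∀ Ω' : Set E2, IsOpen Ω' → IsCompact (closure Ω') → closure Ω' ⊆ Ω →
    perVar F Ω' < ⊤

/-- `E` is a `Λ`-local minimizer of `P_φ` in `Ω`. -/
def IsLambdaLocMinPer (φ : E2 → ℝ) (Λ : ℝ) (Ω : Set E2) (E : Set E2) : Prop :=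
  LocFinPer E Ω ∧ ∀ Ω' : Set E2, IsOpen Ω' → IsCompact (closure Ω') → closure Ω' ⊆ Ω →
    ∀ F : Set E2, LocFinPer F Ω → IsCompact (closure (E ∆ F)) → closure (E ∆ F) ⊆ Ω' →
      aniPer φ E Ω' ≤ aniPer φ F Ω' + ENNReal.ofReal Λ * volume (E ∆ F)

/-- The (strict) subgraph of `u` over `I`. -/
def subg (I : Set ℝ) (u : ℝ → ℝ) : Set E2 := {q : E2 | q 0 ∈ I ∧ q 1 < u (q 0)}

/-- The (strict) epigraph of `u` over `I`. -/
def epig (I : Set ℝ) (u : ℝ → ℝ) : Set E2 := {q : E2 | q 0 ∈ I ∧ u (q 0) < q 1}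

/-- The vertical strip `I × ℝ`. -/
def strip (I : Set ℝ) : Set E2 := {q : E2 | q 0 ∈ I}

/-- The vertical box `I × A`. -/
def box (I A : Set ℝ) : Set E2 := {q : E2 | q 0 ∈ I ∧ q 1 ∈ A}

/-- `u` is a `(γ,Λ)`-local minimizer of `𝒜_φ` in `I`. -/
def IsGammaLambdaLocMin (φ : E2 → ℝ) (γ Λ : ℝ) (I : Set ℝ) (u : ℝ → ℝ) : Prop :=
  ∀ Ω : Set E2, IsOpen Ω → IsCompact (closure Ω) → closure Ω ⊆ box I (Set.Ioo (-γ) γ) →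
    ∀ F : Set E2, LocFinPer F (strip I) →
      IsCompact (closure (subg I u ∆ F)) → closure (subg I u ∆ F) ⊆ Ω →
        aniPer φ (subg I u) Ω ≤ aniPer φ F Ω + ENNReal.ofReal Λ * volume (subg I u ∆ F)

/-- The constant `α₀(φ)`. -/
def alpha0 (φ : E2 → ℝ) : ℝ :=
  (aniPer φ (wulff φ) univ).toReal /
    ((2 * (aniPer φ (wulff φ) univ).toReal + 1) * Real.sqrt (volume (wulff φ)).toReal)

/-- `u` admits a Lipschitz representative on `I`. -/
def HasLipschitzRep (u : ℝ → ℝ) (I : Set ℝ) : Prop :=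
  ∃ v : ℝ → ℝ, (∀ᵐ s ∂(volume.restrict I), u s = v s) ∧ ∃ K : ℝ≥0, LipschitzOnWith K v I

/-- `u` admits a `C^{1,1}` representative on `I`. -/
def HasC11Rep (u : ℝ → ℝ) (I : Set ℝ) : Prop :=
  ∃ v v' : ℝ → ℝ, (∀ᵐ s ∂(volume.restrict I), u s = v s) ∧
    (∀ s ∈ I, HasDerivAt v (v' s) s) ∧ ∃ K : ℝ≥0, LipschitzOnWith K v' I

@[simp] lemma vec2_apply_zero (a b : ℝ) : vec2 a b 0 = a := rfl

@[simp] lemma vec2_apply_one (a b : ℝ) : vec2 a b 1 = b := rfl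

lemma E2.ext_coord {p q : E2} (h0 : p 0 = q 0) (h1 : p 1 = q 1) : p = q := by
  ext i
  fin_cases i
  · exact h0
  · exact h1

lemma vec2_eta (q : E2) : vec2 (q 0) (q 1) = q := E2.ext_coord rfl rfl

lemma inner_coord (p q : E2) : ⟪p, q⟫ = p 0 * q 0 + p 1 * q 1 := by
  simp [PiLp.inner_apply, Fin.sum_univ_two, mul_comm]

lemma norm_sq_coord (q : E2) : ‖q‖ ^ 2 = q 0 ^ 2 + q 1 ^ 2 := by
  rw [← real_inner_self_eq_norm_sq, inner_coord]
  ring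

lemma norm_vec2 (a b : ℝ) : ‖vec2 a b‖ = √(a ^ 2 + b ^ 2) := by
  rw [← Real.sqrt_sq (norm_nonneg (vec2 a b)), norm_sq_coord]
  rfl

lemma abs_coord_le_norm (q : E2) (i : Fin 2) : |q i| ≤ ‖q‖ := by
  simpa using PiLp.norm_apply_le q i

lemma norm_le_abs_add_abs (q : E2) : ‖q‖ ≤ |q 0| + |q 1| := by
  refine abs_le_of_sq_le_sq' ?_ (by positivity) |>.2
  rw [norm_sq_coord, add_sq, sq_abs, sq_abs]
  nlinarith [mul_nonneg (abs_nonneg (q 0)) (abs_nonneg (q 1))]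

section Anisotropy

variable {φ : E2 → ℝ}

lemma IsAnisotropy.equiv_norm (hφ : IsAnisotropy φ) :
    ∃ c : ℝ, 0 < c ∧ ∀ x, c * ‖x‖ ≤ φ x ∧ c * φ x ≤ ‖x‖ := by
  obtain ⟨c, ⟨hc0, hc1⟩, hc⟩ := hφ.bounds
  refine ⟨c, hc0, fun x => ?_⟩
  rcases eq_or_ne x 0 with rfl | hx
  · simp [(hφ.eq_zero_iff 0).2 rfl]
  have hn : 0 < ‖x‖ := norm_pos_iff.2 hx
  obtain ⟨h1, h2⟩ := hc (‖x‖⁻¹ • x) (by rw [norm_smul, norm_inv, norm_norm, inv_mul_cancel₀ hn.ne'])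
  rw [hφ.smul_eq, abs_of_pos (inv_pos.2 hn), inv_mul_eq_div] at h1 h2
  rw [le_div_iff₀ hn] at h1
  rw [div_le_div_iff₀ hn hc0] at h2
  exact ⟨h1, by linarith⟩

lemma IsAnisotropy.bddAbove_dual (hφ : IsAnisotropy φ) (ξ : E2) :
    BddAbove {r : ℝ | ∃ η : E2, φ η = 1 ∧ r = ⟪ξ, η⟫} := by
  obtain ⟨c, hc, h⟩ := hφ.equiv_norm
  refine ⟨‖ξ‖ * c⁻¹, ?_⟩
  rintro r ⟨η, h1, rfl⟩
  refine (real_inner_le_norm _ _).trans (mul_le_mul_of_nonneg_left ?_ (norm_nonneg _))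
  have := (h η).1
  rw [h1] at this
  rw [inv_eq_one_div, le_div_iff₀ hc]
  linarith

lemma IsAnisotropy.inner_le (hφ : IsAnisotropy φ) (ξ η : E2) : ⟪ξ, η⟫ ≤ φ η * dualA φ ξ := by
  rcases eq_or_ne η 0 with rfl | hx
  · simp [(hφ.eq_zero_iff 0).2 rfl]
  have hn : 0 < φ η := lt_of_le_of_ne (hφ.nonneg η) (fun h => hx ((hφ.eq_zero_iff η).1 h.symm))
  have : ⟪ξ, (φ η)⁻¹ • η⟫ ≤ dualA φ ξ := by
    refine le_csSup (hφ.bddAbove_dual ξ) ⟨_, ?_, rfl⟩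
    rw [hφ.smul_eq, abs_of_pos (inv_pos.2 hn), inv_mul_cancel₀ hn.ne']
  rw [real_inner_smul_right, inv_mul_le_iff₀ hn] at this
  exact this

lemma IsAnisotropy.exists_eq_one (hφ : IsAnisotropy φ) : ∃ η, φ η = 1 := by
  have hx : e1 ≠ 0 := fun h => by simpa [e1] using congrArg (fun q : E2 => q 0) h
  have hn : 0 < φ e1 := lt_of_le_of_ne (hφ.nonneg _) (fun h => hx ((hφ.eq_zero_iff _).1 h.symm))
  exact ⟨(φ e1)⁻¹ • e1, by rw [hφ.smul_eq, abs_of_pos (inv_pos.2 hn), inv_mul_cancel₀ hn.ne']⟩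

lemma IsAnisotropy.map_neg (hφ : IsAnisotropy φ) (η : E2) : φ (-η) = φ η := by
  simpa using hφ.smul_eq (-1) η

lemma IsAnisotropy.dual_le (hφ : IsAnisotropy φ) {ξ : E2} {b : ℝ}
    (h : ∀ η, φ η = 1 → ⟪ξ, η⟫ ≤ b) : dualA φ ξ ≤ b := by
  obtain ⟨η, hη⟩ := hφ.exists_eq_one
  refine csSup_le ⟨_, η, hη, rfl⟩ ?_
  rintro r ⟨η, h1, rfl⟩
  exact h η h1

lemma IsAnisotropy.dual_nonneg (hφ : IsAnisotropy φ) (ξ : E2) : 0 ≤ dualA φ ξ := by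
  obtain ⟨η, hη⟩ := hφ.exists_eq_one
  have h1 := hφ.inner_le ξ η
  have h2 := hφ.inner_le ξ (-η)
  rw [hφ.map_neg, inner_neg_right] at h2
  rw [hη] at h1 h2
  linarith

lemma IsAnisotropy.dual_add_le (hφ : IsAnisotropy φ) (ξ ζ : E2) :
    dualA φ (ξ + ζ) ≤ dualA φ ξ + dualA φ ζ := by
  refine hφ.dual_le fun η hη => ?_
  have h1 := hφ.inner_le ξ η
  have h2 := hφ.inner_le ζ η
  rw [hη] at h1 h2
  rw [inner_add_left]
  linarith

lemma IsAnisotropy.dual_smul_le (hφ : IsAnisotropy φ) {t : ℝ} (ht : 0 ≤ t) (ξ : E2) :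
    dualA φ (t • ξ) ≤ t * dualA φ ξ := by
  refine hφ.dual_le fun η hη => ?_
  have h1 := hφ.inner_le ξ η
  rw [hη] at h1
  rw [real_inner_smul_left]
  nlinarith

lemma IsAnisotropy.dual_smul (hφ : IsAnisotropy φ) {t : ℝ} (ht : 0 < t) (ξ : E2) :
    dualA φ (t • ξ) = t * dualA φ ξ := by
  refine le_antisymm (hφ.dual_smul_le ht.le ξ) ?_
  have := hφ.dual_smul_le (inv_pos.2 ht).le (t • ξ)
  rw [smul_smul, inv_mul_cancel₀ ht.ne', one_smul, inv_mul_eq_div, le_div_iff₀ ht] at this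
  linarith

lemma IsAnisotropy.dual_neg (hφ : IsAnisotropy φ) (ξ : E2) : dualA φ (-ξ) = dualA φ ξ := by
  have key : ∀ ζ, dualA φ (-ζ) ≤ dualA φ ζ := fun ζ => hφ.dual_le fun η hη => by
    have h1 := hφ.inner_le ζ (-η)
    rw [hφ.map_neg, hη] at h1
    rw [inner_neg_left, ← inner_neg_right]
    linarith
  exact le_antisymm (key ξ) (by simpa using key (-ξ))

lemma IsAnisotropy.dual_equiv_norm (hφ : IsAnisotropy φ) :
    ∃ c : ℝ, 0 < c ∧ ∀ ξ, c * ‖ξ‖ ≤ dualA φ ξ ∧ c * dualA φ ξ ≤ ‖ξ‖ := by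
  obtain ⟨c, hc, h⟩ := hφ.equiv_norm
  refine ⟨c, hc, fun ξ => ⟨?_, ?_⟩⟩
  · rcases eq_or_ne ξ 0 with rfl | hx
    · simpa using hφ.dual_nonneg 0
    have hn : 0 < ‖ξ‖ := norm_pos_iff.2 hx
    have h1 := hφ.inner_le ξ ξ
    rw [real_inner_self_eq_norm_sq] at h1
    have h2 := mul_le_mul_of_nonneg_right (h ξ).2 (hφ.dual_nonneg ξ)
    have h3 := mul_le_mul_of_nonneg_left h1 hc.le
    refine le_of_mul_le_mul_left ?_ hn
    nlinarith
  · rw [mul_comm, ← le_div_iff₀ hc]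
    refine hφ.dual_le fun η hη => ?_
    have h1 := (h η).1
    rw [hη] at h1
    rw [le_div_iff₀ hc]
    have h2 := real_inner_le_norm ξ η
    nlinarith [norm_nonneg ξ]

lemma IsAnisotropy.dual_lipschitz (hφ : IsAnisotropy φ) :
    ∃ C : ℝ, 0 ≤ C ∧ ∀ ξ ζ, |dualA φ ξ - dualA φ ζ| ≤ C * ‖ξ - ζ‖ := by
  obtain ⟨c, hc, h⟩ := hφ.dual_equiv_norm
  have key : ∀ ξ ζ, dualA φ ξ - dualA φ ζ ≤ c⁻¹ * ‖ξ - ζ‖ := fun ξ ζ => by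
    have h1 := hφ.dual_add_le (ξ - ζ) ζ
    rw [sub_add_cancel] at h1
    have h2 := (h (ξ - ζ)).2
    rw [← div_eq_inv_mul, le_div_iff₀ hc]
    nlinarith
  refine ⟨c⁻¹, (inv_pos.2 hc).le, fun ξ ζ => abs_sub_le_iff.2 ⟨key ξ ζ, ?_⟩⟩
  rw [norm_sub_rev]
  exact key ζ ξ

lemma IsAnisotropy.continuous_dual (hφ : IsAnisotropy φ) : Continuous (dualA φ) := by
  obtain ⟨C, hC, h⟩ := hφ.dual_lipschitz
  refine LipschitzWith.continuous (K := ⟨C, hC⟩) (LipschitzWith.of_dist_le_mul fun ξ ζ => ?_)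
  rw [Real.dist_eq, dist_eq_norm]
  exact h ξ ζ

lemma IsAnisotropy.exists_dual_sub_le (hφ : IsAnisotropy φ) (ξ : E2) {ε : ℝ} (hε : 0 < ε) :
    ∃ η, φ η = 1 ∧ dualA φ ξ - ε ≤ ⟪ξ, η⟫ := by
  obtain ⟨η, hη⟩ := hφ.exists_eq_one
  obtain ⟨r, ⟨η, h1, rfl⟩, h2⟩ := exists_lt_of_lt_csSup (s := {r : ℝ | ∃ η : E2, φ η = 1 ∧ r = ⟪ξ, η⟫})
    ⟨_, η, hη, rfl⟩ (show dualA φ ξ - ε < _ from by rw [dualA]; linarith)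
  exact ⟨η, h1, h2.le⟩

end Anisotropy

@[fun_prop]
lemma continuous_vec2 : Continuous (fun p : ℝ × ℝ => vec2 p.1 p.2) := by
  unfold vec2
  refine (PiLp.continuous_toLp 2 (fun _ : Fin 2 => ℝ)).comp ?_
  refine continuous_pi fun i => ?_
  fin_cases i
  · exact continuous_fst
  · exact continuous_snd

lemma continuous_coord (i : Fin 2) : Continuous (fun q : E2 => q i) := by fun_prop

/-- A sequence of bump functions on the line with supports shrinking to the origin. -/
def bump (k : ℕ) : ContDiffBump (0 : ℝ) :=
  ⟨1 / (2 * ((k : ℝ) + 1)), 1 / ((k : ℝ) + 1), by positivity, by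
    apply one_div_lt_one_div_of_lt <;> [positivity; nlinarith [(Nat.cast_nonneg k : (0:ℝ) ≤ k)]]⟩

lemma tendsto_bump_rOut : Tendsto (fun k => (bump k).rOut) atTop (𝓝 0) :=
  tendsto_one_div_add_atTop_nhds_zero_nat

/-- The mollifier `ρ_k`. -/
def moll (k : ℕ) : ℝ → ℝ := (bump k).normed volume

lemma moll_nonneg (k : ℕ) (x : ℝ) : 0 ≤ moll k x := (bump k).nonneg_normed x

lemma continuous_moll (k : ℕ) : Continuous (moll k) := (bump k).continuous_normed

lemma moll_eq_zero {k : ℕ} {x : ℝ} (h : (bump k).rOut ≤ |x|) : moll k x = 0 := by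
  by_contra hx
  have : x ∈ Function.support (moll k) := hx
  rw [moll, (bump k).support_normed_eq] at this
  rw [Metric.mem_ball, dist_zero_right, Real.norm_eq_abs] at this
  linarith

lemma hasCompactSupport_moll (k : ℕ) : HasCompactSupport (moll k) :=
  (bump k).hasCompactSupport_normed

lemma integrable_moll (k : ℕ) : Integrable (moll k) :=
  (continuous_moll k).integrable_of_hasCompactSupport (hasCompactSupport_moll k)

/-- The mollifications of `g` converge to `g` at `x`. -/
def IsMollPt (g : ℝ → ℝ) (x : ℝ) : Prop :=
  Tendsto (fun k => ∫ s, moll k (s - x) * g s) atTop (𝓝 (g x))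

lemma integral_moll_eq_convolution (k : ℕ) (g : ℝ → ℝ) (x : ℝ) :
    ∫ s, moll k (s - x) * g s =
      MeasureTheory.convolution ((bump k).normed volume) g (ContinuousLinearMap.lsmul ℝ ℝ) volume x := by
  rw [convolution_eq_swap]
  refine integral_congr_ae (Eventually.of_forall fun s => ?_)
  simp only [ContinuousLinearMap.lsmul_apply, smul_eq_mul, moll]
  rw [← (bump k).normed_neg, neg_sub]

lemma ae_isMollPt {g : ℝ → ℝ} (hg : LocallyIntegrable g) : ∀ᵐ x, IsMollPt g x := by
  have := ContDiffBump.ae_convolution_tendsto_right_of_locallyIntegrable (μ := (volume : Measure ℝ))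
    (φ := bump) (K := 2) tendsto_bump_rOut (Eventually.of_forall fun k => by
      simp only [bump]
      field_simp
      rfl) hg
  filter_upwards [this] with x hx
  unfold IsMollPt
  simp_rw [integral_moll_eq_convolution]
  exact hx

lemma isMollPt_of_continuous {g : ℝ → ℝ} (hg : Continuous g) (x : ℝ) : IsMollPt g x := by
  have := ContDiffBump.convolution_tendsto_right_of_continuous (μ := (volume : Measure ℝ))
    (φ := bump) tendsto_bump_rOut hg x
  unfold IsMollPt
  simp_rw [integral_moll_eq_convolution]
  exact this

lemma integrable_moll_mul {g : ℝ → ℝ} (hg : LocallyIntegrable g) (k : ℕ) (x : ℝ) :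
    Integrable (fun s => moll k (s - x) * g s) := by
  have hc : Continuous (fun s => moll k (s - x)) := (continuous_moll k).comp (by fun_prop)
  refine hg.integrable_smul_left_of_hasCompactSupport hc ?_
  exact (hasCompactSupport_moll k).comp_homeomorph (Homeomorph.subRight x)

/-- A smoothed indicator function of `[a, b]`. -/
def cut (k : ℕ) (a b x : ℝ) : ℝ := (∫ y in (0:ℝ)..(x - a), moll k y) - ∫ y in (0:ℝ)..(x - b), moll k y

lemma cut_eq (k : ℕ) (a b x : ℝ) : cut k a b x = ∫ y in (x - b)..(x - a), moll k y :=
  intervalIntegral.integral_interval_sub_left ((integrable_moll k).intervalIntegrable)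
    ((integrable_moll k).intervalIntegrable)

lemma hasDerivAt_cut (k : ℕ) (a b x : ℝ) :
    HasDerivAt (cut k a b) (moll k (x - a) - moll k (x - b)) x := by
  have key : ∀ c, HasDerivAt (fun x => ∫ y in (0:ℝ)..(x - c), moll k y) (moll k (x - c)) x := fun c => by
    have := intervalIntegral.integral_hasDerivAt_right (a := 0) (b := x - c)
      ((integrable_moll k).intervalIntegrable)
      ((continuous_moll k).stronglyMeasurableAtFilter _ _) (continuous_moll k).continuousAt
    simpa [Function.comp_def] using this.comp x ((hasDerivAt_id x).sub_const c)
  exact (key a).sub (key b)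

lemma deriv_cut (k : ℕ) (a b : ℝ) :
    deriv (cut k a b) = fun x => moll k (x - a) - moll k (x - b) :=
  funext fun x => (hasDerivAt_cut k a b x).deriv

lemma contDiff_cut (k : ℕ) (a b : ℝ) : ContDiff ℝ 1 (cut k a b) := by
  rw [contDiff_one_iff_deriv, deriv_cut]
  refine ⟨fun x => (hasDerivAt_cut k a b x).differentiableAt, ?_⟩
  exact ((continuous_moll k).comp (by fun_prop)).sub ((continuous_moll k).comp (by fun_prop))

lemma cut_nonneg {k : ℕ} {a b : ℝ} (hab : a ≤ b) (x : ℝ) : 0 ≤ cut k a b x := by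
  rw [cut_eq]
  exact intervalIntegral.integral_nonneg (by linarith) fun y _ => moll_nonneg k y

lemma cut_le_one (k : ℕ) {a b : ℝ} (hab : a ≤ b) (x : ℝ) : cut k a b x ≤ 1 := by
  rw [cut_eq, intervalIntegral.integral_of_le (by linarith)]
  refine (setIntegral_le_integral (integrable_moll k)
    (Eventually.of_forall fun y => moll_nonneg k y)).trans (le_of_eq ?_)
  exact (bump k).integral_normed

lemma cut_eq_zero {k : ℕ} {a b x : ℝ} (hab : a ≤ b)
    (hx : x ∉ Icc (a - (bump k).rOut) (b + (bump k).rOut)) : cut k a b x = 0 := by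
  have hr := (bump k).rOut_pos
  rw [cut_eq]
  refine intervalIntegral.integral_zero_ae (Eventually.of_forall fun y hy => moll_eq_zero ?_)
  rw [uIoc_of_le (by linarith)] at hy
  rw [mem_Icc, not_and_or, not_le, not_le] at hx
  rcases hx with hx | hx
  · rw [abs_of_neg (by linarith [hy.2])]
    linarith [hy.2]
  · rw [abs_of_pos (by linarith [hy.1])]
    linarith [hy.1]

lemma tsupport_cut {k : ℕ} {a b : ℝ} (hab : a ≤ b) :
    tsupport (cut k a b) ⊆ Icc (a - (bump k).rOut) (b + (bump k).rOut) :=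
  closure_minimal (fun _ hx => by_contra fun h => hx (cut_eq_zero hab h)) isClosed_Icc

lemma sum_cut_le_one (k : ℕ) {s : ℕ → ℝ} (hs : Monotone s) (N : Finset ℕ) (x : ℝ) :
    ∑ i ∈ N, cut k (s i) (s (i + 1)) x ≤ 1 := by
  obtain ⟨n, hn⟩ := N.exists_nat_subset_range
  calc ∑ i ∈ N, cut k (s i) (s (i + 1)) x ≤ ∑ i ∈ Finset.range n, cut k (s i) (s (i + 1)) x :=
        Finset.sum_le_sum_of_subset_of_nonneg hn fun i _ _ => cut_nonneg (hs (Nat.le_succ i)) x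
    _ = cut k (s 0) (s n) x := Finset.sum_range_sub' (fun i => ∫ y in (0:ℝ)..(x - s i), moll k y) n
    _ ≤ 1 := cut_le_one k (hs (Nat.zero_le n)) x

lemma eventually_Icc_bump_subset {J : Set ℝ} (hJ : IsOpen J) {a b : ℝ} (hab : a ≤ b)
    (h : Icc a b ⊆ J) :
    ∀ᶠ k in atTop, Icc (a - (bump k).rOut) (b + (bump k).rOut) ⊆ J := by
  obtain ⟨δ, hδ, h1⟩ := Metric.isOpen_iff.1 hJ a (h (left_mem_Icc.2 hab))
  obtain ⟨ε, hε, h2⟩ := Metric.isOpen_iff.1 hJ b (h (right_mem_Icc.2 hab))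
  filter_upwards [tendsto_bump_rOut.eventually (gt_mem_nhds hδ),
    tendsto_bump_rOut.eventually (gt_mem_nhds hε)] with k hk1 hk2 x hx
  rcases lt_or_ge x a with h3 | h3
  · exact h1 (by rw [Metric.mem_ball, Real.dist_eq, abs_of_neg (by linarith)]; linarith [hx.1])
  rcases lt_or_ge b x with h4 | h4
  · exact h2 (by rw [Metric.mem_ball, Real.dist_eq, abs_of_pos (by linarith)]; linarith [hx.2])
  exact h ⟨h3, h4⟩

lemma tendsto_integral_mul_deriv_cut {g : ℝ → ℝ} (hg : LocallyIntegrable g) {a b : ℝ}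
    (ha : IsMollPt g a) (hb : IsMollPt g b) :
    Tendsto (fun k => ∫ s, g s * deriv (cut k a b) s) atTop (𝓝 (g a - g b)) := by
  refine (Tendsto.sub ha hb).congr fun k => ?_
  rw [← integral_sub (integrable_moll_mul hg k a) (integrable_moll_mul hg k b), deriv_cut]
  refine integral_congr_ae (Eventually.of_forall fun s => ?_)
  dsimp only
  ring

lemma hasCompactSupport_cut (k : ℕ) {a b : ℝ} (hab : a ≤ b) : HasCompactSupport (cut k a b) :=
  isCompact_Icc.of_isClosed_subset (isClosed_tsupport _) (tsupport_cut hab)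

lemma integrable_mul_deriv_cut {g : ℝ → ℝ} (hg : LocallyIntegrable g) (k : ℕ) (a b : ℝ) :
    Integrable (fun s => g s * deriv (cut k a b) s) := by
  refine ((integrable_moll_mul hg k a).sub (integrable_moll_mul hg k b)).congr
    (Eventually.of_forall fun s => ?_)
  rw [deriv_cut]
  simp only [Pi.sub_apply]
  ring

lemma tendsto_integral_cut {a b : ℝ} (hab : a ≤ b) :
    Tendsto (fun k => ∫ s, cut k a b s) atTop (𝓝 (b - a)) := by
  have h := (tendsto_integral_mul_deriv_cut (g := fun s => s) continuous_id.locallyIntegrable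
    (isMollPt_of_continuous continuous_id a) (isMollPt_of_continuous continuous_id b)).neg
  rw [neg_sub] at h
  refine h.congr fun k => ?_
  have hc := (contDiff_cut k a b).continuous
  have := integral_mul_deriv_eq_deriv_mul_of_integrable (u := fun s : ℝ => s) (u' := fun _ => 1)
    (v := cut k a b) (v' := deriv (cut k a b)) (fun x _ => hasDerivAt_id x)
    (fun x _ => ((contDiff_cut k a b).differentiable one_ne_zero x).hasDerivAt)
    (integrable_mul_deriv_cut continuous_id.locallyIntegrable k a b)
    (by
      refine (hc.integrable_of_hasCompactSupport (hasCompactSupport_cut k hab)).congr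
        (Eventually.of_forall fun s => ?_)
      simp)
    ((continuous_id.mul hc).integrable_of_hasCompactSupport
      (hasCompactSupport_cut k hab).mul_left)
  rw [this]
  simp

lemma IsAnisotropy.map_sum_le {φ : E2 → ℝ} (hφ : IsAnisotropy φ) {ι : Type*} (N : Finset ι) (f : ι → E2) :
    φ (∑ i ∈ N, f i) ≤ ∑ i ∈ N, φ (f i) :=
  Finset.le_sum_of_subadditive φ ((hφ.eq_zero_iff 0).2 rfl).le hφ.add_le N f

lemma le_aniArea {φ : E2 → ℝ} {w : ℝ → ℝ} {J : Set ℝ} {h₁ h₂ : ℝ → ℝ}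
    (c1 : ContDiff ℝ 1 h₁) (c2 : ContDiff ℝ 1 h₂)
    (k1 : HasCompactSupport h₁) (k2 : HasCompactSupport h₂)
    (s1 : tsupport h₁ ⊆ J) (s2 : tsupport h₂ ⊆ J) (hle : ∀ s ∈ J, φ (vec2 (h₁ s) (h₂ s)) ≤ 1) :
    ENNReal.ofReal (∫ s in J, (w s * deriv h₁ s + h₂ s)) ≤ aniArea φ w J :=
  le_iSup_of_le h₁ <| le_iSup_of_le h₂ <| le_iSup_of_le c1 <| le_iSup_of_le c2 <|
    le_iSup_of_le k1 <| le_iSup_of_le k2 <| le_iSup_of_le s1 <| le_iSup_of_le s2 <|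
    le_iSup_of_le hle le_rfl

lemma setIntegral_area_eq {w g : ℝ → ℝ} {J : Set ℝ} {h₁ h₂ : ℝ → ℝ} (hJ : IsOpen J)
    (hwg : EqOn w g J) (s1 : tsupport h₁ ⊆ J) (s2 : tsupport h₂ ⊆ J) :
    ∫ s in J, (w s * deriv h₁ s + h₂ s) = ∫ s, (g s * deriv h₁ s + h₂ s) := by
  rw [setIntegral_congr_fun (g := fun s => g s * deriv h₁ s + h₂ s) hJ.measurableSet
    (fun s hs => by simp only [hwg hs])]
  refine setIntegral_eq_integral_of_forall_compl_eq_zero fun s hs => ?_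
  have d1 : deriv h₁ s = 0 := by
    by_contra h
    exact hs (s1 (support_deriv_subset h))
  have d2 : h₂ s = 0 := image_eq_zero_of_notMem_tsupport fun h => hs (s2 h)
  rw [d1, d2, mul_zero, add_zero]

lemma tsupport_sum_mul_subset {ι : Type*} {J : Set ℝ} (N : Finset ι) (c : ι → ℝ) (f : ι → ℝ → ℝ)
    (hf : ∀ i ∈ N, HasCompactSupport (f i)) (hs : ∀ i ∈ N, tsupport (f i) ⊆ J) :
    HasCompactSupport (fun x => ∑ i ∈ N, c i * f i x) ∧
      tsupport (fun x => ∑ i ∈ N, c i * f i x) ⊆ J := by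
  have hK : IsCompact (⋃ i ∈ N, tsupport (f i)) := N.isCompact_biUnion hf
  have hsub : tsupport (fun x => ∑ i ∈ N, c i * f i x) ⊆ ⋃ i ∈ N, tsupport (f i) := by
    refine closure_minimal (fun x hx => ?_) hK.isClosed
    obtain ⟨i, hi, hne⟩ := Finset.exists_ne_zero_of_sum_ne_zero hx
    exact mem_biUnion hi (subset_tsupport _ (right_ne_zero_of_mul hne))
  exact ⟨hK.of_isClosed_subset (isClosed_tsupport _) hsub, hsub.trans (iUnion₂_subset hs)⟩

lemma sum_inner_le_aniArea {φ : E2 → ℝ} (hφ : IsAnisotropy φ) {J : Set ℝ} (hJ : IsOpen J) {w g : ℝ → ℝ}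
    (hg : LocallyIntegrable g) (hwg : EqOn w g J) {s : ℕ → ℝ} (hs : Monotone s) (N : Finset ℕ)
    (hN : ∀ i ∈ N, IsMollPt g (s i) ∧ IsMollPt g (s (i + 1)) ∧ Icc (s i) (s (i + 1)) ⊆ J)
    (η : ℕ → E2) (hη : ∀ i, φ (η i) ≤ 1) :
    ENNReal.ofReal (∑ i ∈ N, ⟪vec2 (-(g (s (i + 1)) - g (s i))) (s (i + 1) - s i), η i⟫) ≤
      aniArea φ w J := by
  have hle : ∀ i, s i ≤ s (i + 1) := fun i => hs (Nat.le_succ i)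
  let h (j : Fin 2) (k : ℕ) (x : ℝ) : ℝ := ∑ i ∈ N, η i j * cut k (s i) (s (i + 1)) x
  have hderiv : ∀ k x, deriv (h 0 k) x = ∑ i ∈ N, η i 0 * deriv (cut k (s i) (s (i + 1))) x := by
    intro k x
    have hd : ∀ i, DifferentiableAt ℝ (cut k (s i) (s (i + 1))) x :=
      fun i => (hasDerivAt_cut k _ _ x).differentiableAt
    refine (HasDerivAt.fun_sum fun i _ => (hd i).hasDerivAt.const_mul (η i 0)).deriv
  have hlim : Tendsto (fun k => ∫ x, (g x * deriv (h 0 k) x + h 1 k x)) atTop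
      (𝓝 (∑ i ∈ N, ⟪vec2 (-(g (s (i + 1)) - g (s i))) (s (i + 1) - s i), η i⟫)) := by
    have h1 : Tendsto (fun k => ∑ i ∈ N, (η i 0 * (∫ x, g x * deriv (cut k (s i) (s (i + 1))) x) +
        η i 1 * ∫ x, cut k (s i) (s (i + 1)) x)) atTop
        (𝓝 (∑ i ∈ N, (η i 0 * (g (s i) - g (s (i + 1))) + η i 1 * (s (i + 1) - s i)))) :=
      tendsto_finsetSum N fun i hi =>
        ((tendsto_integral_mul_deriv_cut hg (hN i hi).1 (hN i hi).2.1).const_mul _).add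
          ((tendsto_integral_cut (hle i)).const_mul _)
    have h2 : ∑ i ∈ N, (η i 0 * (g (s i) - g (s (i + 1))) + η i 1 * (s (i + 1) - s i)) =
        ∑ i ∈ N, ⟪vec2 (-(g (s (i + 1)) - g (s i))) (s (i + 1) - s i), η i⟫ :=
      Finset.sum_congr rfl fun i _ => by
        rw [inner_coord, vec2_apply_zero, vec2_apply_one]
        ring
    rw [← h2]
    refine h1.congr fun k => ?_
    have i1 : ∀ i ∈ N, Integrable (fun x => η i 0 * (g x * deriv (cut k (s i) (s (i + 1))) x)) :=
      fun i _ => (integrable_mul_deriv_cut hg k _ _).const_mul _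
    have i2 : ∀ i ∈ N, Integrable (fun x => η i 1 * cut k (s i) (s (i + 1)) x) :=
      fun i _ => (((contDiff_cut k _ _).continuous).integrable_of_hasCompactSupport
        (hasCompactSupport_cut k (hle i))).const_mul _
    simp_rw [← integral_const_mul]
    rw [Finset.sum_add_distrib, ← integral_finsetSum _ i1, ← integral_finsetSum _ i2,
      ← integral_add (integrable_finsetSum _ i1) (integrable_finsetSum _ i2)]
    refine integral_congr_ae (Eventually.of_forall fun x => ?_)
    simp only [hderiv, h, Finset.mul_sum]
    congr 1
    exact Finset.sum_congr rfl fun i _ => by ring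
  refine le_of_tendsto (ENNReal.tendsto_ofReal hlim) ?_
  have hev : ∀ᶠ k in atTop, ∀ i ∈ N,
      Icc (s i - (bump k).rOut) (s (i + 1) + (bump k).rOut) ⊆ J :=
    (Filter.eventually_all_finset N).2 fun i hi => eventually_Icc_bump_subset hJ (hle i) (hN i hi).2.2
  filter_upwards [hev] with k hk
  have hc : ∀ j, ContDiff ℝ 1 (h j k) := fun j =>
    ContDiff.sum fun i _ => contDiff_const.mul (contDiff_cut k _ _)
  have hsup : ∀ j, HasCompactSupport (h j k) ∧ tsupport (h j k) ⊆ J := fun j =>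
    tsupport_sum_mul_subset N (fun i => η i j) _ (fun i _ => hasCompactSupport_cut k (hle i))
      fun i hi => (tsupport_cut (hle i)).trans (hk i hi)
  rw [← setIntegral_area_eq hJ hwg (hsup 0).2 (hsup 1).2]
  refine le_aniArea (hc 0) (hc 1) (hsup 0).1 (hsup 1).1 (hsup 0).2 (hsup 1).2 fun x _ => ?_
  have hv : vec2 (h 0 k x) (h 1 k x) = ∑ i ∈ N, cut k (s i) (s (i + 1)) x • η i := by
    refine E2.ext_coord ?_ ?_ <;>
    simp [h, mul_comm]
  rw [hv]
  refine (hφ.map_sum_le _ _).trans (le_trans (Finset.sum_le_sum fun i _ => ?_) (sum_cut_le_one k hs N x))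
  rw [hφ.smul_eq, abs_of_nonneg (cut_nonneg (hle i) x)]
  exact mul_le_of_le_one_right (cut_nonneg (hle i) x) (hη i)

/-- The anisotropic length of polygons inscribed in the graph is bounded by the anisotropic area. -/
lemma sum_dual_le_aniArea {φ : E2 → ℝ} (hφ : IsAnisotropy φ) {J : Set ℝ} (hJ : IsOpen J) {w g : ℝ → ℝ}
    (hg : LocallyIntegrable g) (hwg : EqOn w g J) {s : ℕ → ℝ} (hs : Monotone s) (N : Finset ℕ)
    (hN : ∀ i ∈ N, IsMollPt g (s i) ∧ IsMollPt g (s (i + 1)) ∧ Icc (s i) (s (i + 1)) ⊆ J) :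
    ∑ i ∈ N, ENNReal.ofReal (dualA φ (vec2 (-(g (s (i + 1)) - g (s i))) (s (i + 1) - s i))) ≤
      aniArea φ w J := by
  rw [← ENNReal.ofReal_sum_of_nonneg fun i _ => hφ.dual_nonneg _]
  set ξ : ℕ → E2 := fun i => vec2 (-(g (s (i + 1)) - g (s i))) (s (i + 1) - s i) with hξ
  have key : ∀ n : ℕ, ENNReal.ofReal (∑ i ∈ N, (dualA φ (ξ i) - 1 / ((n : ℝ) + 1))) ≤ aniArea φ w J := by
    intro n
    choose η h1 h2 using fun i => hφ.exists_dual_sub_le (ξ i) (ε := 1 / ((n : ℝ) + 1)) (by positivity)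
    refine le_trans (ENNReal.ofReal_le_ofReal (Finset.sum_le_sum fun i _ => h2 i)) ?_
    exact sum_inner_le_aniArea hφ hJ hg hwg hs N hN η fun i => (h1 i).le
  have hlim : Tendsto (fun n : ℕ => ENNReal.ofReal (∑ i ∈ N, (dualA φ (ξ i) - 1 / ((n : ℝ) + 1)))) atTop
      (𝓝 (ENNReal.ofReal (∑ i ∈ N, (dualA φ (ξ i) - 0)))) :=
    ENNReal.tendsto_ofReal (tendsto_finsetSum N fun i _ =>
      tendsto_const_nhds.sub tendsto_one_div_add_atTop_nhds_zero_nat)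
  simp only [sub_zero] at hlim
  exact le_of_tendsto' hlim key

/-- The integrand `p ↦ φ°(-p, 1)` of the anisotropic area. -/
def areaInt (φ : E2 → ℝ) (p : ℝ) : ℝ := dualA φ (vec2 (-p) 1)

section AreaUpper

variable {φ : E2 → ℝ}

lemma IsAnisotropy.areaInt_nonneg (hφ : IsAnisotropy φ) (p : ℝ) : 0 ≤ areaInt φ p := hφ.dual_nonneg _

lemma IsAnisotropy.areaInt_lipschitz (hφ : IsAnisotropy φ) :
    ∃ C : ℝ, 0 ≤ C ∧ ∀ p q, |areaInt φ p - areaInt φ q| ≤ C * |p - q| := by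
  obtain ⟨C, hC, h⟩ := hφ.dual_lipschitz
  refine ⟨C, hC, fun p q => (h _ _).trans (mul_le_mul_of_nonneg_left ?_ hC)⟩
  refine (norm_le_abs_add_abs _).trans ?_
  simp only [PiLp.sub_apply, vec2_apply_zero, vec2_apply_one, sub_self, abs_zero, add_zero]
  rw [← abs_neg]
  ring_nf
  exact le_rfl

lemma IsAnisotropy.continuous_areaInt (hφ : IsAnisotropy φ) : Continuous (areaInt φ) :=
  hφ.continuous_dual.comp (by
    have := continuous_vec2
    exact this.comp (continuous_neg.prodMk continuous_const))

lemma IsAnisotropy.dual_vec2 (hφ : IsAnisotropy φ) (a : ℝ) {δ : ℝ} (hδ : 0 < δ) :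
    dualA φ (vec2 (-a) δ) = δ * areaInt φ (a / δ) := by
  rw [areaInt, ← hφ.dual_smul hδ]
  congr 1
  refine E2.ext_coord ?_ ?_ <;> simp
  field_simp

lemma IsAnisotropy.test_le_areaInt (hφ : IsAnisotropy φ) {x y : ℝ} (h : φ (vec2 x y) ≤ 1) (p : ℝ) :
    -x * p + y ≤ areaInt φ p := by
  have h1 := hφ.inner_le (vec2 (-p) 1) (vec2 x y)
  rw [inner_coord] at h1
  simp only [vec2_apply_zero, vec2_apply_one] at h1
  have h2 := mul_le_mul_of_nonneg_right h (hφ.areaInt_nonneg p)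
  rw [areaInt] at *
  nlinarith

lemma lintegral_Ioc_eq_sum (F : ℝ → ℝ≥0∞) (a : ℝ) {δ : ℝ} (hδ : 0 < δ) (n : ℕ) :
    ∫⁻ s in Ioc a (a + n * δ), F s = ∑ i ∈ Finset.range n, ∫⁻ z in Ioc 0 δ, F (a + z + i * δ) := by
  induction n with
  | zero => simp
  | succ n ih =>
    have h1 : Ioc a (a + (n + 1 : ℕ) * δ) =
        Ioc a (a + n * δ) ∪ Ioc (a + n * δ) (a + (n + 1 : ℕ) * δ) := by
      rw [Ioc_union_Ioc_eq_Ioc]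
      · have : (0:ℝ) ≤ n * δ := by positivity
        linarith
      · push_cast
        nlinarith
    rw [h1, lintegral_union measurableSet_Ioc, ih, Finset.sum_range_succ]
    · congr 1
      have h2 := (measurePreserving_add_left (volume : Measure ℝ) (a + n * δ)).setLIntegral_comp_preimage_emb
        (MeasurableEquiv.addLeft (a + n * δ)).measurableEmbedding F (Ioc (a + n * δ) (a + (n + 1 : ℕ) * δ))
      rw [← h2]
      have h3 : (fun x => a + n * δ + x) ⁻¹' Ioc (a + n * δ) (a + (n + 1 : ℕ) * δ) = Ioc 0 δ := by
        ext x
        simp only [mem_preimage, mem_Ioc]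
        push_cast
        constructor <;> rintro ⟨h, h'⟩ <;> constructor <;> linarith
      rw [h3]
      refine lintegral_congr fun z => ?_
      congr 1
      ring
    · rw [Ioc_disjoint_Ioc]
      simp

lemma lintegral_areaInt_le_aniArea (hφ : IsAnisotropy φ) {J : Set ℝ} (hJ : IsOpen J) {w g : ℝ → ℝ}
    (hg : LocallyIntegrable g) (hgm : Measurable g) (hwg : EqOn w g J) {a b : ℝ} (hJb : J ⊆ Ioc a b)
    {δ : ℝ} (hδ : 0 < δ) {B : Set ℝ} (hBm : MeasurableSet B) (hB : ∀ s ∈ B, Icc s (s + δ) ⊆ J) :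
    ∫⁻ s in B, ENNReal.ofReal (areaInt φ ((g (s + δ) - g s) / δ)) ≤ aniArea φ w J := by
  obtain ⟨n, hn⟩ := exists_nat_ge ((b - a) / δ)
  have hBJ : B ⊆ Ioc a (a + n * δ) := fun s hs => by
    have h1 := hJb (hB s hs (left_mem_Icc.2 (by linarith)))
    rw [div_le_iff₀ hδ] at hn
    exact ⟨h1.1, h1.2.trans (by linarith)⟩
  set F : ℝ → ℝ≥0∞ := fun s => ENNReal.ofReal (areaInt φ ((g (s + δ) - g s) / δ)) with hF
  have hFm : Measurable F := by
    refine ENNReal.measurable_ofReal.comp (hφ.continuous_areaInt.measurable.comp ?_)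
    exact ((hgm.comp (measurable_id.add_const δ)).sub hgm).div_const δ
  have hFBm : Measurable (B.indicator F) := hFm.indicator hBm
  have e1 : ∫⁻ s in B, F s = ∫⁻ s in Ioc a (a + n * δ), B.indicator F s := by
    rw [lintegral_indicator hBm, Measure.restrict_restrict hBm, inter_eq_left.2 hBJ]
  rw [e1, lintegral_Ioc_eq_sum _ _ hδ,
    ← lintegral_finsetSum (f := fun (i : ℕ) z => B.indicator F (a + z + i * δ)) _
      (fun i _ => hFBm.comp (by fun_prop))]
  have hae : ∀ᵐ z : ℝ, ∀ i : ℕ, IsMollPt g (a + z + i * δ) := by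
    rw [ae_all_iff]
    intro i
    have := (measurePreserving_add_left (volume : Measure ℝ) (a + i * δ)).quasiMeasurePreserving.ae
      (ae_isMollPt hg)
    filter_upwards [this] with z hz
    convert hz using 1
    ring
  have hbd : ∀ᵐ z ∂(volume.restrict (Ioc 0 δ)),
      ∑ i ∈ Finset.range n, B.indicator F (a + z + i * δ) ≤ (ENNReal.ofReal δ)⁻¹ * aniArea φ w J := by
    filter_upwards [ae_restrict_of_ae hae] with z hz
    rw [← ENNReal.div_eq_inv_mul, ENNReal.le_div_iff_mul_le (by simp [hδ]) (by simp), Finset.sum_mul]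
    classical
    set s : ℕ → ℝ := fun i => a + z + i * δ with hs
    have hs1 : ∀ i, s (i + 1) = s i + δ := fun i => by simp only [hs]; push_cast; ring
    have hmono : Monotone s := monotone_nat_of_le_succ fun i => by rw [hs1]; linarith
    refine le_trans (le_of_eq ?_) (sum_dual_le_aniArea hφ hJ hg hwg hmono
      ((Finset.range n).filter fun i => s i ∈ B) fun i hi => ⟨hz i, hz (i + 1), ?_⟩)
    · rw [Finset.sum_filter]
      refine Finset.sum_congr rfl fun i _ => ?_
      by_cases hi : s i ∈ B
      · rw [if_pos hi, indicator_of_mem hi, hF, hs1, add_sub_cancel_left, hφ.dual_vec2 _ hδ, mul_comm,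
          ENNReal.ofReal_mul hδ.le]
      · rw [if_neg hi, indicator_of_notMem hi, zero_mul]
    · rw [hs1]
      exact hB _ (Finset.mem_filter.1 hi).2
  calc ∫⁻ z in Ioc 0 δ, ∑ i ∈ Finset.range n, B.indicator F (a + z + i * δ)
      ≤ ∫⁻ z in Ioc 0 δ, (ENNReal.ofReal δ)⁻¹ * aniArea φ w J := lintegral_mono_ae hbd
    _ = aniArea φ w J := by
      rw [setLIntegral_const, Real.volume_Ioc, sub_zero, mul_right_comm,
        ENNReal.inv_mul_cancel (by simp [hδ]) (by simp), one_mul]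
end AreaUpper

section AreaUpper

variable {φ : E2 → ℝ}

lemma le_totalVar {u : ℝ → ℝ} {J : Set ℝ} {h : ℝ → ℝ} (c1 : ContDiff ℝ 1 h) (k1 : HasCompactSupport h)
    (s1 : tsupport h ⊆ J) (hle : ∀ s ∈ J, |h s| ≤ 1) :
    ENNReal.ofReal (∫ s in J, u s * deriv h s) ≤ totalVar u J :=
  le_iSup_of_le h <| le_iSup_of_le c1 <| le_iSup_of_le k1 <| le_iSup_of_le s1 <|
    le_iSup_of_le hle le_rfl

lemma aniArea_lt_top (hφ : IsAnisotropy φ) {u : ℝ → ℝ} {J : Set ℝ}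
    (hu : IntegrableOn u J) (hv : totalVar u J < ⊤) (hJv : volume J < ⊤) : aniArea φ u J < ⊤ := by
  obtain ⟨c, hc, hcn⟩ := hφ.equiv_norm
  refine lt_of_le_of_lt (b := ENNReal.ofReal (c⁻¹ * (totalVar u J).toReal + c⁻¹ * (volume J).toReal)) ?_
    ENNReal.ofReal_lt_top
  simp only [aniArea, iSup_le_iff]
  intro h₁ h₂ c1 c2 k1 k2 s1 s2 hle
  refine ENNReal.ofReal_le_ofReal ?_
  have hb : ∀ s ∈ J, |h₁ s| ≤ c⁻¹ ∧ |h₂ s| ≤ c⁻¹ := by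
    intro s hs
    have h1 : ‖vec2 (h₁ s) (h₂ s)‖ ≤ c⁻¹ := by
      rw [← one_div, le_div_iff₀' hc]
      exact (hcn _).1.trans (hle s hs)
    have h2 := abs_coord_le_norm (vec2 (h₁ s) (h₂ s)) 0
    have h3 := abs_coord_le_norm (vec2 (h₁ s) (h₂ s)) 1
    simp only [vec2_apply_zero, vec2_apply_one] at h2 h3
    exact ⟨h2.trans h1, h3.trans h1⟩
  have i1 : IntegrableOn (fun s => u s * deriv h₁ s) J := by
    obtain ⟨C, hC⟩ := k1.deriv.exists_bound_of_continuous (c1.continuous_deriv le_rfl)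
    exact Integrable.mul_bdd hu (c1.continuous_deriv le_rfl).aestronglyMeasurable (Eventually.of_forall hC)
  have i2 : IntegrableOn h₂ J := (c2.continuous.integrable_of_hasCompactSupport k2).integrableOn
  rw [integral_add i1 i2]
  refine add_le_add ?_ ?_
  · have hk : HasCompactSupport (fun s => c * h₁ s) := k1.mul_left
    have h1 := le_totalVar (u := u) (J := J) (h := fun s => c * h₁ s) (contDiff_const.mul c1) hk
      ((tsupport_mul_subset_right (f := fun _ => c)).trans s1) (fun s hs => by
        rw [abs_mul, abs_of_pos hc]
        have := (hb s hs).1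
        rwa [← one_div, le_div_iff₀' hc] at this)
    rw [← ENNReal.ofReal_toReal hv.ne, ENNReal.ofReal_le_ofReal_iff ENNReal.toReal_nonneg] at h1
    have h2 : ∫ s in J, u s * deriv (fun s => c * h₁ s) s = c * ∫ s in J, u s * deriv h₁ s := by
      rw [← integral_const_mul]
      refine integral_congr_ae (Eventually.of_forall fun s => ?_)
      dsimp only
      rw [deriv_const_mul _ (c1.differentiable one_ne_zero s)]
      ring
    rw [h2] at h1
    rw [← div_eq_inv_mul, le_div_iff₀' hc]
    exact h1
  · calc ∫ s in J, h₂ s ≤ ‖∫ s in J, h₂ s‖ := le_abs_self _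
      _ ≤ c⁻¹ * volume.real J := norm_setIntegral_le_of_norm_le_const hJv fun s hs => (hb s hs).2
      _ = _ := rfl

lemma eVariationOn_lt_top (hφ : IsAnisotropy φ) {J : Set ℝ} (hJ : IsOpen J) (hJc : J.OrdConnected)
    {w g : ℝ → ℝ} (hg : LocallyIntegrable g) (hwg : EqOn w g J) {G : Set ℝ} (hGJ : G ⊆ J)
    (hG : ∀ s ∈ G, IsMollPt g s) (hfin : aniArea φ w J < ⊤) : eVariationOn g G < ⊤ := by
  obtain ⟨c, hc, hcn⟩ := hφ.dual_equiv_norm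
  refine lt_of_le_of_lt (b := ENNReal.ofReal c⁻¹ * aniArea φ w J) ?_
    (ENNReal.mul_lt_top ENNReal.ofReal_lt_top hfin)
  refine iSup_le fun ⟨n, s, hs, hsG⟩ => ?_
  refine le_trans ?_ (mul_le_mul_right (sum_dual_le_aniArea hφ hJ hg hwg hs (Finset.range n) fun i _ =>
    ⟨hG _ (hsG i), hG _ (hsG _), hJc.out (hGJ (hsG i)) (hGJ (hsG _))⟩) _)
  rw [Finset.mul_sum]
  refine Finset.sum_le_sum fun i _ => ?_
  rw [edist_dist, ← ENNReal.ofReal_mul (inv_pos.2 hc).le, Real.dist_eq]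
  refine ENNReal.ofReal_le_ofReal ?_
  rw [← div_eq_inv_mul, le_div_iff₀' hc]
  refine le_trans (mul_le_mul_of_nonneg_left ?_ hc.le) (hcn _).1
  refine le_trans ?_ (abs_coord_le_norm _ 0)
  rw [vec2_apply_zero, abs_neg]

end AreaUpper

section AreaVariation

variable {φ : E2 → ℝ}

lemma ae_tendsto_diffQuot {g p : ℝ → ℝ} {J G : Set ℝ} (hJ : IsOpen J)
    (hG : ∀ᵐ s, s ∈ J → s ∈ G) (hp : ∀ᵐ s, s ∈ J → HasDerivWithinAt g (p s) G s)
    {δ : ℕ → ℝ} (hδ : ∀ n, 0 < δ n) (hδ0 : Tendsto δ atTop (𝓝 0)) :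
    ∀ᵐ s, s ∈ J → Tendsto (fun n => (g (s + δ n) - g s) / δ n) atTop (𝓝 (p s)) := by
  have hG' : ∀ᵐ s : ℝ, ∀ n, s + δ n ∈ J → s + δ n ∈ G := by
    rw [ae_all_iff]
    exact fun n => (measurePreserving_add_right (volume : Measure ℝ) (δ n)).quasiMeasurePreserving.ae hG
  filter_upwards [hG', hp] with s hs hps hsJ
  have h1 := hasDerivWithinAt_iff_tendsto_slope.1 (hps hsJ)
  have h2 : Tendsto (fun n => s + δ n) atTop (𝓝 s) := by
    simpa using hδ0.const_add s
  have h3 : Tendsto (fun n => s + δ n) atTop (𝓝[G \ {s}] s) := by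
    refine tendsto_nhdsWithin_iff.2 ⟨h2, ?_⟩
    filter_upwards [h2.eventually (hJ.mem_nhds hsJ)] with n hn
    exact ⟨hs n hn, by simpa using (hδ n).ne'⟩
  refine (h1.comp h3).congr fun n => ?_
  simp [slope_def_field]

lemma exists_lipschitz {h : ℝ → ℝ} (c1 : ContDiff ℝ 1 h) (k1 : HasCompactSupport h) :
    ∃ L : ℝ, 0 ≤ L ∧ ∀ x y, |h x - h y| ≤ L * |x - y| := by
  obtain ⟨L, hL⟩ := c1.lipschitzWith_of_hasCompactSupport k1 one_ne_zero
  exact ⟨L, L.2, fun x y => by simpa [Real.dist_eq] using hL.dist_le_mul x y⟩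

lemma tendsto_diffQuot {h : ℝ → ℝ} (c1 : ContDiff ℝ 1 h) (s : ℝ)
    {δ : ℕ → ℝ} (hδ : ∀ n, δ n ≠ 0) (hδ0 : Tendsto δ atTop (𝓝 0)) :
    Tendsto (fun n => (h (s + δ n) - h s) / δ n) atTop (𝓝 (deriv h s)) := by
  have h1 := hasDerivAt_iff_tendsto_slope.1 (c1.differentiable one_ne_zero s).hasDerivAt
  have h3 : Tendsto (fun n => s + δ n) atTop (𝓝[≠] s) := by
    refine tendsto_nhdsWithin_iff.2 ⟨by simpa using hδ0.const_add s, Eventually.of_forall fun n => ?_⟩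
    simpa using hδ n
  refine (h1.comp h3).congr fun n => ?_
  simp [slope_def_field]

lemma tendsto_integral_test {g h₁ h₂ : ℝ → ℝ} (hg : Integrable g) (c1 : ContDiff ℝ 1 h₁)
    (k1 : HasCompactSupport h₁) (i2 : Integrable h₂)
    {δ : ℕ → ℝ} (hδ : ∀ n, 0 < δ n) (hδ0 : Tendsto δ atTop (𝓝 0)) :
    Tendsto (fun n => ∫ s, (-h₁ s * ((g (s + δ n) - g s) / δ n) + h₂ s)) atTop
      (𝓝 (∫ s, (g s * deriv h₁ s + h₂ s))) := by
  obtain ⟨L, hL, hLip⟩ := exists_lipschitz c1 k1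
  obtain ⟨M, hM⟩ := k1.exists_bound_of_continuous c1.continuous
  have hc := c1.continuous
  have hshift : ∀ a, Integrable fun s => g (s + a) := fun a => hg.comp_add_right a
  have e : ∀ n, ∫ s, (-h₁ s * ((g (s + δ n) - g s) / δ n) + h₂ s) =
      ∫ s, (g s * ((h₁ (s + -δ n) - h₁ s) / (-δ n)) + h₂ s) := by
    intro n
    have i3 : Integrable fun s => h₁ s * g (s + δ n) :=
      (hshift _).bdd_mul hc.aestronglyMeasurable (Eventually.of_forall hM)
    have i4 : Integrable fun s => h₁ s * g s :=
      hg.bdd_mul hc.aestronglyMeasurable (Eventually.of_forall hM)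
    have i5 : Integrable fun s => h₁ (s + -δ n) * g s :=
      hg.bdd_mul (hc.comp (by fun_prop)).aestronglyMeasurable (Eventually.of_forall fun s => hM _)
    have e3 : ∫ s, h₁ s * g (s + δ n) = ∫ s, h₁ (s + -δ n) * g s := by
      rw [← integral_add_right_eq_self (fun s => h₁ (s + -δ n) * g s) (δ n)]
      simp
    have e4 : (fun s => -h₁ s * ((g (s + δ n) - g s) / δ n) + h₂ s) =
        fun s => (-(δ n)⁻¹) * (h₁ s * g (s + δ n)) + (δ n)⁻¹ * (h₁ s * g s) + h₂ s := by
      ext s; field_simp [(hδ n).ne']; ring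
    have e5 : (fun s => g s * ((h₁ (s + -δ n) - h₁ s) / (-δ n)) + h₂ s) =
        fun s => (-(δ n)⁻¹) * (h₁ (s + -δ n) * g s) + (δ n)⁻¹ * (h₁ s * g s) + h₂ s := by
      ext s; field_simp [(hδ n).ne']; ring
    have e6 : ∀ F : ℝ → ℝ, Integrable F → ∫ s, (-(δ n)⁻¹ * F s + (δ n)⁻¹ * (h₁ s * g s) + h₂ s) =
        -(δ n)⁻¹ * (∫ s, F s) + (δ n)⁻¹ * (∫ s, h₁ s * g s) + ∫ s, h₂ s := fun F hF => by
      have i6 : Integrable fun s => -(δ n)⁻¹ * F s + (δ n)⁻¹ * (h₁ s * g s) :=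
        (hF.const_mul _).add (i4.const_mul _)
      rw [integral_add i6 i2, integral_add (hF.const_mul _) (i4.const_mul _), integral_const_mul,
        integral_const_mul]
    rw [e4, e5, e6 _ i3, e6 _ i5, e3]
  simp_rw [e]
  refine tendsto_integral_of_dominated_convergence (fun s => L * |g s| + |h₂ s|) (fun n => ?_)
    ((hg.abs.const_mul L).add i2.abs) (fun n => Eventually.of_forall fun s => ?_)
    (Eventually.of_forall fun s => ?_)
  · have hq : Continuous fun s => (h₁ (s + -δ n) - h₁ s) / (-δ n) := by fun_prop
    exact (hg.1.mul hq.aestronglyMeasurable).add i2.1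
  · rw [Real.norm_eq_abs]
    refine (abs_add_le _ _).trans (add_le_add_left ?_ _)
    rw [abs_mul, mul_comm]
    refine mul_le_mul_of_nonneg_right ?_ (abs_nonneg _)
    rw [abs_div, div_le_iff₀ (by simp [(hδ n).ne'])]
    refine (hLip _ _).trans (le_of_eq ?_)
    simp
  · refine (Tendsto.const_mul _ ?_).add_const _
    refine tendsto_diffQuot c1 s (fun n => by simp [(hδ n).ne']) ?_
    simpa using hδ0.neg

lemma aniArea_le_add (hφ : IsAnisotropy φ) {J G : Set ℝ} (hJ : IsOpen J) {a b : ℝ} (hJb : J ⊆ Ioc a b)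
    {u g ψ p : ℝ → ℝ} (hg : Integrable g) (hgm : Measurable g) (hug : EqOn u g J)
    (cψ : ContDiff ℝ 1 ψ) (kψ : HasCompactSupport ψ) (sψ : tsupport ψ ⊆ J)
    (hG : ∀ᵐ s, s ∈ J → s ∈ G) (hp : ∀ᵐ s, s ∈ J → HasDerivWithinAt g (p s) G s) :
    aniArea φ u J ≤ aniArea φ (fun s => u s + ψ s) J +
      ENNReal.ofReal (∫ s in J, (areaInt φ (p s) - areaInt φ (p s + deriv ψ s))) := by
  set w : ℝ → ℝ := fun s => u s + ψ s with hw
  rcases eq_or_ne (aniArea φ w J) ⊤ with htop | htop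
  · rw [htop, top_add]; exact le_top
  obtain ⟨C, hC, hCl⟩ := hφ.areaInt_lipschitz
  obtain ⟨L, hL, hLip⟩ := exists_lipschitz cψ kψ
  rw [aniArea]
  simp only [iSup_le_iff]
  intro h₁ h₂ c1 c2 k1 k2 s1 s2 hle
  rw [setIntegral_area_eq hJ hug s1 s2]
  set K := tsupport h₁ ∪ tsupport h₂ ∪ tsupport ψ with hK
  have hKc : IsCompact K := (k1.isCompact.union k2.isCompact).union kψ.isCompact
  have hKJ : K ⊆ J := union_subset (union_subset s1 s2) sψ
  have hKm : MeasurableSet K := hKc.measurableSet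
  obtain ⟨ε, hε, hεJ⟩ := hKc.exists_cthickening_subset_open hJ hKJ
  have htv : ∫ s in J, (areaInt φ (p s) - areaInt φ (p s + deriv ψ s)) =
      ∫ s in K, (areaInt φ (p s) - areaInt φ (p s + deriv ψ s)) := by
    have hz : ∀ s ∉ K, areaInt φ (p s) - areaInt φ (p s + deriv ψ s) = 0 := fun s hs => by
      have : deriv ψ s = 0 := by
        by_contra h
        exact hs (Or.inr (support_deriv_subset h))
      rw [this, add_zero, sub_self]
    rw [setIntegral_eq_integral_of_forall_compl_eq_zero fun s hs => hz s fun h => hs (hKJ h),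
      setIntegral_eq_integral_of_forall_compl_eq_zero hz]
  rw [htv]
  let δ : ℕ → ℝ := fun n => 1 / ((n : ℝ) + 1)
  have hδ : ∀ n, 0 < δ n := fun n => by positivity
  have hδ0 : Tendsto δ atTop (𝓝 0) := tendsto_one_div_add_atTop_nhds_zero_nat
  set Q : ℕ → ℝ → ℝ := fun n s => (g (s + δ n) - g s) / δ n with hQ
  set R : ℕ → ℝ → ℝ := fun n s => (ψ (s + δ n) - ψ s) / δ n with hR
  have hQm : ∀ n, Measurable (Q n) := fun n =>
    ((hgm.comp (measurable_id.add_const (δ n))).sub hgm).div_const _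
  have hRm : ∀ n, Measurable (R n) := fun n =>
    ((cψ.continuous.measurable.comp (measurable_id.add_const (δ n))).sub cψ.continuous.measurable).div_const _
  have hRb : ∀ n s, |R n s| ≤ L := fun n s => by
    rw [hR, abs_div, div_le_iff₀ (by simp [(hδ n).ne'])]
    refine (hLip _ _).trans (le_of_eq ?_)
    simp
  have hQi : ∀ n, Integrable (Q n) := fun n => ((hg.comp_add_right _).sub hg).div_const _
  have hKfin : volume K ≠ ⊤ := hKc.measure_lt_top.ne
  have hfi : ∀ (q : ℝ → ℝ), Measurable q → IntegrableOn q K → IntegrableOn (fun s => areaInt φ (q s)) K := by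
    intro q hqm hq
    refine Integrable.mono' (g := fun s => C * |q s| + areaInt φ 0)
      ((hq.abs.const_mul C).add (integrableOn_const hKfin))
      (hφ.continuous_areaInt.measurable.comp hqm).aestronglyMeasurable (Eventually.of_forall fun s => ?_)
    rw [Real.norm_eq_abs, abs_of_nonneg (hφ.areaInt_nonneg _)]
    have := (le_abs_self _).trans (hCl (q s) 0)
    rw [sub_zero] at this
    linarith
  have hQR : ∀ n, IntegrableOn (fun s => Q n s + R n s) K := fun n => by
    refine (hQi n).integrableOn.add ?_
    refine Integrable.mono' (g := fun _ => L) (integrableOn_const hKfin) (hRm n).aestronglyMeasurable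
      (Eventually.of_forall (hRb n))
  have lim1 := tendsto_integral_test hg c1 k1 (c2.continuous.integrable_of_hasCompactSupport k2) hδ hδ0
  have lim2 : Tendsto (fun n => ∫ s in K, (areaInt φ (Q n s) - areaInt φ (Q n s + R n s))) atTop
      (𝓝 (∫ s in K, (areaInt φ (p s) - areaInt φ (p s + deriv ψ s)))) := by
    refine tendsto_integral_of_dominated_convergence (fun _ => C * L)
      (fun n => ((hfi _ (hQm n) (hQi n).integrableOn).sub (hfi _ ((hQm n).add (hRm n)) (hQR n))).1)
      (integrableOn_const hKfin) (fun n => Eventually.of_forall fun s => ?_) ?_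
    · refine (hCl _ _).trans (mul_le_mul_of_nonneg_left ?_ hC)
      rw [sub_add_cancel_left, abs_neg]
      exact hRb n s
    · refine (ae_restrict_iff' hKm).2 ?_
      filter_upwards [ae_tendsto_diffQuot hJ hG hp hδ hδ0] with s hs hsK
      have t1 := hs (hKJ hsK)
      have t2 := tendsto_diffQuot cψ s (fun n => (hδ n).ne') hδ0
      exact ((hφ.continuous_areaInt.tendsto _).comp t1).sub
        ((hφ.continuous_areaInt.tendsto _).comp (t1.add t2))
  have hw' : EqOn w (fun s => g s + ψ s) J := fun s hs => by simp only [hw, hug hs]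
  have hψi : Integrable ψ := cψ.continuous.integrable_of_hasCompactSupport kψ
  have hfinal : ∀ᶠ n in atTop, ∫ s, (-h₁ s * Q n s + h₂ s) ≤ (aniArea φ w J).toReal +
      ∫ s in K, (areaInt φ (Q n s) - areaInt φ (Q n s + R n s)) := by
    filter_upwards [hδ0.eventually (gt_mem_nhds hε)] with n hn
    have hB : ∀ s ∈ K, Icc s (s + δ n) ⊆ J := fun s hs x hx => hεJ <| by
      refine Metric.mem_cthickening_of_dist_le x s ε K hs ?_
      rw [Real.dist_eq, abs_of_nonneg (by linarith [hx.1])]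
      linarith [hx.2]
    have t1 := lintegral_areaInt_le_aniArea hφ hJ (hg.add hψi).locallyIntegrable
      (hgm.add cψ.continuous.measurable) hw' hJb (hδ n) hKm hB
    have e1 : ∀ s, ((g + ψ) (s + δ n) - (g + ψ) s) / δ n = Q n s + R n s := fun s => by
      simp only [hQ, hR, Pi.add_apply]; ring
    simp_rw [e1] at t1
    have i7 : IntegrableOn (fun s => areaInt φ (Q n s + R n s)) K := hfi _ ((hQm n).add (hRm n)) (hQR n)
    rw [← ofReal_integral_eq_lintegral_ofReal i7
      (Eventually.of_forall fun s => hφ.areaInt_nonneg _),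
      ← ENNReal.ofReal_toReal htop, ENNReal.ofReal_le_ofReal_iff ENNReal.toReal_nonneg] at t1
    rw [integral_sub (hfi _ (hQm n) (hQi n).integrableOn) i7]
    have t2 : ∫ s, (-h₁ s * Q n s + h₂ s) ≤ ∫ s in K, areaInt φ (Q n s) := by
      have hz : ∀ s ∉ K, -h₁ s * Q n s + h₂ s = 0 := fun s hs => by
        rw [image_eq_zero_of_notMem_tsupport fun h => hs (Or.inl (Or.inl h)),
          image_eq_zero_of_notMem_tsupport fun h => hs (Or.inl (Or.inr h))]
        simp
      rw [← setIntegral_eq_integral_of_forall_compl_eq_zero hz]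
      obtain ⟨M, hM⟩ := k1.exists_bound_of_continuous c1.continuous
      refine setIntegral_mono_on ?_ (hfi _ (hQm n) (hQi n).integrableOn) hKm fun s hs =>
        hφ.test_le_areaInt (hle s (hKJ hs)) _
      refine Integrable.integrableOn (Integrable.add ?_ (c2.continuous.integrable_of_hasCompactSupport k2))
      exact (hQi n).bdd_mul c1.continuous.neg.aestronglyMeasurable
        (Eventually.of_forall fun s => by rw [norm_neg]; exact hM s)
    linarith
  have := le_of_tendsto_of_tendsto lim1 (lim2.const_add _) hfinal
  refine (ENNReal.ofReal_le_ofReal this).trans ?_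
  refine ENNReal.ofReal_add_le.trans ?_
  rw [ENNReal.ofReal_toReal htop]
end AreaVariation

section AreaVariation

variable {φ : E2 → ℝ}

lemma lintegral_areaInt_deriv_le (hφ : IsAnisotropy φ) {J J₁ G : Set ℝ} (hJ : IsOpen J)
    (hJ₁ : IsOpen J₁) (hJc : IsCompact (closure J)) (hJJ : closure J ⊆ J₁) {a b : ℝ} (hJb : J₁ ⊆ Ioc a b)
    {u g p : ℝ → ℝ} (hg : LocallyIntegrable g) (hgm : Measurable g) (hug : EqOn u g J₁)
    (hG : ∀ᵐ s, s ∈ J → s ∈ G) (hp : ∀ᵐ s, s ∈ J → HasDerivWithinAt g (p s) G s) :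
    ∫⁻ s in J, ENNReal.ofReal (areaInt φ (p s)) ≤ aniArea φ u J₁ := by
  obtain ⟨ε, hε, hεJ⟩ := hJc.exists_cthickening_subset_open hJ₁ hJJ
  let δ : ℕ → ℝ := fun n => ε / ((n : ℝ) + 1)
  have hδ : ∀ n, 0 < δ n := fun n => by positivity
  have hδ0 : Tendsto δ atTop (𝓝 0) := by
    have := (tendsto_one_div_add_atTop_nhds_zero_nat (𝕜 := ℝ)).const_mul ε
    simpa [δ, div_eq_mul_inv] using this
  have hδε : ∀ n, δ n ≤ ε := fun n => div_le_self hε.le (by simp)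
  have key : ∀ n, ∫⁻ s in J, ENNReal.ofReal (areaInt φ ((g (s + δ n) - g s) / δ n)) ≤ aniArea φ u J₁ := by
    intro n
    refine lintegral_areaInt_le_aniArea hφ hJ₁ hg hgm hug hJb (hδ n) hJ.measurableSet fun s hs x hx => ?_
    refine hεJ (Metric.mem_cthickening_of_dist_le x s ε _ (subset_closure hs) ?_)
    rw [Real.dist_eq, abs_of_nonneg (by linarith [hx.1])]
    linarith [hx.2, hδε n]
  calc ∫⁻ s in J, ENNReal.ofReal (areaInt φ (p s))
      ≤ ∫⁻ s in J, liminf (fun n => ENNReal.ofReal (areaInt φ ((g (s + δ n) - g s) / δ n))) atTop := by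
        refine lintegral_mono_ae ((ae_restrict_iff' hJ.measurableSet).2 ?_)
        filter_upwards [ae_tendsto_diffQuot hJ hG hp hδ hδ0] with s hs hsJ
        refine le_of_eq (Tendsto.liminf_eq ?_).symm
        exact ENNReal.tendsto_ofReal ((hφ.continuous_areaInt.tendsto _).comp (hs hsJ))
    _ ≤ liminf (fun n => ∫⁻ s in J, ENNReal.ofReal (areaInt φ ((g (s + δ n) - g s) / δ n))) atTop := by
        refine lintegral_liminf_le fun n => ENNReal.measurable_ofReal.comp
          (hφ.continuous_areaInt.measurable.comp ?_)
        exact ((hgm.comp (measurable_id.add_const (δ n))).sub hgm).div_const _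
    _ ≤ aniArea φ u J₁ := by
        refine (liminf_le_liminf (Eventually.of_forall key)).trans ?_
        rw [liminf_const]

lemma exists_Ioo_of_closure_subset {I J : Set ℝ} (hIo : IsOpen I) (hIc : I.OrdConnected) (hne : J.Nonempty)
    (hJc : IsCompact (closure J)) (hJI : closure J ⊆ I) :
    ∃ a b : ℝ, a < b ∧ closure J ⊆ Ioo a b ∧ Icc a b ⊆ I := by
  obtain ⟨m, hm, hml⟩ := hJc.exists_isLeast hne.closure
  obtain ⟨M, hM, hMg⟩ := hJc.exists_isGreatest hne.closure
  obtain ⟨ε, hε, h1⟩ := Metric.isOpen_iff.1 hIo m (hJI hm)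
  obtain ⟨δ, hδ, h2⟩ := Metric.isOpen_iff.1 hIo M (hJI hM)
  have hmM : m ≤ M := hml hM
  refine ⟨m - ε / 2, M + δ / 2, by linarith, fun x hx => ⟨?_, ?_⟩, hIc.out (h1 ?_) (h2 ?_)⟩
  · linarith [hml hx]
  · linarith [hMg hx]
  · rw [Metric.mem_ball, Real.dist_eq, abs_lt]; constructor <;> linarith
  · rw [Metric.mem_ball, Real.dist_eq, abs_lt]; constructor <;> linarith

/-- A representative of a `BV` function near an interval, which is bounded and differentiable
along a set of full measure. -/
structure GoodRep (φ : E2 → ℝ) (I J : Set ℝ) (u g p : ℝ → ℝ) (a b M : ℝ) (G D : Set ℝ) : Prop where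
  subset_Ioo : closure J ⊆ Ioo a b
  Icc_subset : Icc a b ⊆ I
  integrable : Integrable g
  measurable : Measurable g
  eqOn : EqOn u g (Ioo a b)
  measurableSet_G : MeasurableSet G
  G_subset : G ⊆ Ioo a b
  ae_G : ∀ᵐ s, s ∈ Ioo a b → s ∈ G
  bound : ∀ s ∈ G, |g s| ≤ M
  boundedVariationOn : BoundedVariationOn g G
  measurable_deriv : Measurable p
  measurableSet_D : MeasurableSet D
  D_subset_G : D ⊆ G
  D_subset_J : D ⊆ J
  ae_D : ∀ᵐ s, s ∈ J → s ∈ D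
  hasDeriv : ∀ s ∈ D, HasDerivWithinAt g (p s) G s
  lintegral_lt_top : ∫⁻ s in J, ENNReal.ofReal (areaInt φ (p s)) < ⊤

lemma exists_goodRep (hφ : IsAnisotropy φ) {I J : Set ℝ} (hIo : IsOpen I) (hIc : I.OrdConnected)
    {u : ℝ → ℝ} (huBV : BVLocOn u I) (hum : Measurable (I.indicator u)) (hne : J.Nonempty)
    (hJ : IsOpen J) (hJc : IsCompact (closure J)) (hJI : closure J ⊆ I) :
    ∃ g p a b M G D, GoodRep φ I J u g p a b M G D := by
  obtain ⟨a, b, hab, hJab, habI⟩ := exists_Ioo_of_closure_subset hIo hIc hne hJc hJI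
  have hcl : closure (Ioo a b) = Icc a b := closure_Ioo hab.ne
  obtain ⟨hui, huv⟩ := huBV (Ioo a b) isOpen_Ioo (hcl ▸ isCompact_Icc) (hcl ▸ habI)
  have hfin := aniArea_lt_top hφ hui huv (by simp)
  set g : ℝ → ℝ := (Ioo a b).indicator u with hgdef
  have hgm : Measurable g := by
    have : g = (Ioo a b).indicator (I.indicator u) := by
      rw [indicator_indicator, inter_eq_left.2 (Ioo_subset_Icc_self.trans habI)]
    rw [this]
    exact hum.indicator measurableSet_Ioo
  have hgi : Integrable g := (integrable_indicator_iff measurableSet_Ioo).2 hui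
  have hug : EqOn u g (Ioo a b) := fun s hs => (indicator_of_mem hs u).symm
  obtain ⟨G₀, hG₀, hG₀m, hG₀P⟩ := (ae_isMollPt hgi.locallyIntegrable).exists_measurable_mem
  set G := G₀ ∩ Ioo a b with hG
  have hGm : MeasurableSet G := hG₀m.inter measurableSet_Ioo
  have hGab : G ⊆ Ioo a b := inter_subset_right
  have haeG : ∀ᵐ s, s ∈ Ioo a b → s ∈ G := by
    filter_upwards [hG₀] with s hs hs' using ⟨hs, hs'⟩
  have hvar : eVariationOn g G < ⊤ := eVariationOn_lt_top hφ isOpen_Ioo ordConnected_Ioo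
    hgi.locallyIntegrable hug hGab (fun s hs => hG₀P s hs.1) hfin
  have hbv : BoundedVariationOn g G := hvar.ne
  have hbound : ∃ M, ∀ s ∈ G, |g s| ≤ M := by
    rcases G.eq_empty_or_nonempty with h | ⟨s₀, hs₀⟩
    · exact ⟨0, by simp [h]⟩
    · refine ⟨|g s₀| + (eVariationOn g G).toReal, fun s hs => ?_⟩
      have h1 := hbv.dist_le hs hs₀
      rw [Real.dist_eq] at h1
      have := abs_sub_abs_le_abs_sub (g s) (g s₀)
      linarith
  obtain ⟨M, hM⟩ := hbound
  obtain ⟨D₀, hD₀, hD₀m, hD₀P⟩ :=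
    hbv.locallyBoundedVariationOn.ae_differentiableWithinAt_of_mem_real.exists_measurable_mem
  set D₁ := D₀ ∩ G ∩ J with hD₁
  have hD₁m : MeasurableSet D₁ := (hD₀m.inter hGm).inter hJ.measurableSet
  have hder : ∀ s ∈ D₁, HasFDerivWithinAt g (fderivWithin ℝ g G s) G s :=
    fun s hs => (hD₀P s hs.1.1 hs.1.2).hasFDerivWithinAt
  have hmeas := aemeasurable_fderivWithin volume hD₁m fun s hs =>
    (hder s hs).mono (t := G) (inter_subset_left.trans inter_subset_right)
  have hmeas1 : AEMeasurable (fun s => fderivWithin ℝ g G s 1) (volume.restrict D₁) :=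
    (ContinuousLinearMap.measurable_apply (1 : ℝ)).comp_aemeasurable hmeas
  obtain ⟨D₂, hD₂, hD₂m, hD₂P⟩ :=
    ((ae_restrict_iff' hD₁m).1 hmeas1.ae_eq_mk).exists_measurable_mem
  have haeD : ∀ᵐ s, s ∈ J → s ∈ D₁ ∩ D₂ := by
    filter_upwards [hD₀, hD₂, haeG] with s h0 h2 hG hs
    exact ⟨⟨⟨h0, hG (hJab (subset_closure hs))⟩, hs⟩, h2⟩
  have hD : ∀ s ∈ D₁ ∩ D₂, HasDerivWithinAt g (hmeas1.mk _ s) G s := fun s hs => by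
    rw [← hD₂P s hs.2 hs.1]
    exact (hder s hs.1).hasDerivWithinAt
  refine ⟨g, hmeas1.mk _, a, b, M, G, D₁ ∩ D₂, hJab, habI, hgi, hgm, hug, hGm, hGab, haeG, hM, hbv,
    hmeas1.measurable_mk, hD₁m.inter hD₂m, fun s hs => hs.1.1.2, fun s hs => hs.1.2, haeD, hD, ?_⟩
  refine lt_of_le_of_lt (lintegral_areaInt_deriv_le hφ hJ isOpen_Ioo hJc hJab Ioo_subset_Ioc_self
    hgi.locallyIntegrable hgm hug (G := G) ?_ ?_) hfin
  · filter_upwards [haeD] with s hs h using (hs h).1.1.2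
  · filter_upwards [haeD] with s hs h using hD s (hs h)

end AreaVariation

section PlaneMeasure

/-- The coordinates on the plane, as a measurable equivalence. -/
def coordEquiv : E2 ≃ᵐ ℝ × ℝ :=
  (MeasurableEquiv.toLp 2 (Fin 2 → ℝ)).symm.trans MeasurableEquiv.finTwoArrow

lemma coordEquiv_symm_apply (p : ℝ × ℝ) : coordEquiv.symm p = vec2 p.1 p.2 := by
  rw [MeasurableEquiv.symm_apply_eq]
  rfl

lemma measurePreserving_coordEquiv : MeasurePreserving coordEquiv :=
  (EuclideanSpace.volume_preserving_symm_measurableEquiv_toLp (Fin 2)).trans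
    (volume_preserving_finTwoArrow ℝ)

lemma measurable_vec2 : Measurable (fun p : ℝ × ℝ => vec2 p.1 p.2) := continuous_vec2.measurable

lemma volume_eq_lintegral_section {A : Set E2} (hA : MeasurableSet A) :
    volume A = ∫⁻ s, volume {t | vec2 s t ∈ A} := by
  have h1 := measurePreserving_coordEquiv.symm.measure_preimage hA.nullMeasurableSet
  rw [← h1, Measure.volume_eq_prod, Measure.prod_apply (coordEquiv.symm.measurable hA)]
  refine lintegral_congr fun s => ?_
  congr 1

lemma quasiMeasurePreserving_coord_zero :
    Measure.QuasiMeasurePreserving (fun q : E2 => q 0) volume volume :=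
  Measure.quasiMeasurePreserving_fst.comp measurePreserving_coordEquiv.quasiMeasurePreserving

lemma ae_coord_zero {P : ℝ → Prop} (h : ∀ᵐ s, P s) : ∀ᵐ q : E2, P (q 0) :=
  quasiMeasurePreserving_coord_zero.ae h

lemma integral_eq_integral_section {f : E2 → ℝ} (hf : Integrable f) :
    ∫ q, f q = ∫ s, ∫ t, f (vec2 s t) := by
  rw [← measurePreserving_coordEquiv.symm.integral_comp coordEquiv.symm.measurableEmbedding,
    Measure.volume_eq_prod, integral_prod]
  · simp only [coordEquiv_symm_apply]
  · exact (measurePreserving_coordEquiv.symm.integrable_comp_emb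
      coordEquiv.symm.measurableEmbedding).2 hf

/-- The shear `(s, t) ↦ (s, t + ψ s)`. -/
def shear (ψ : ℝ → ℝ) (q : E2) : E2 := vec2 (q 0) (q 1 + ψ (q 0))

@[simp] lemma shear_apply_zero (ψ : ℝ → ℝ) (q : E2) : shear ψ q 0 = q 0 := rfl

@[simp] lemma shear_apply_one (ψ : ℝ → ℝ) (q : E2) : shear ψ q 1 = q 1 + ψ (q 0) := rfl

lemma shear_neg_shear (ψ : ℝ → ℝ) (q : E2) : shear (-ψ) (shear ψ q) = q :=
  E2.ext_coord rfl (by simp)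

lemma shear_shear_neg (ψ : ℝ → ℝ) (q : E2) : shear ψ (shear (-ψ) q) = q :=
  E2.ext_coord rfl (by simp)

lemma measurable_shear {ψ : ℝ → ℝ} (hψ : Measurable ψ) : Measurable (shear ψ) := by
  have h0 : Measurable fun q : E2 => q 0 := (continuous_coord 0).measurable
  have h1 : Measurable fun q : E2 => q 1 := (continuous_coord 1).measurable
  exact measurable_vec2.comp (h0.prodMk (h1.add (hψ.comp h0)))

lemma measurePreserving_shear {ψ : ℝ → ℝ} (hψ : Measurable ψ) : MeasurePreserving (shear ψ) := by
  refine ⟨measurable_shear hψ, Measure.ext fun A hA => ?_⟩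
  rw [Measure.map_apply (measurable_shear hψ) hA, volume_eq_lintegral_section hA,
    volume_eq_lintegral_section (measurable_shear hψ hA)]
  refine lintegral_congr fun s => ?_
  exact measure_preimage_add_right volume (ψ s) {t | vec2 s t ∈ A}

lemma finrank_E2 : Module.finrank ℝ E2 = 2 := by simp

lemma volume_blowup (x : E2) {r : ℝ} (hr : 0 < r) (A : Set E2) :
    volume {y : E2 | x + r • y ∈ A} = ENNReal.ofReal ((r ^ 2)⁻¹) * volume A := by
  have h1 : {y : E2 | x + r • y ∈ A} = (fun y => r • y) ⁻¹' ((fun y => x + y) ⁻¹' A) := rfl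
  rw [h1, Measure.addHaar_preimage_smul volume hr.ne', finrank_E2, measure_preimage_add,
    abs_of_pos (by positivity)]

lemma blowup_ball (x : E2) {r : ℝ} (hr : 0 < r) (ρ : ℝ) :
    {y : E2 | x + r • y ∈ Metric.ball x (r * ρ)} = Metric.ball 0 ρ := by
  ext y
  simp only [mem_ofPred_eq, Metric.mem_ball, dist_zero_right, dist_self_add_left, norm_smul,
    Real.norm_eq_abs, abs_of_pos hr]
  exact mul_lt_mul_iff_right₀ hr

end PlaneMeasure

section Normals

/-- The blow-up of `E` at `x`. -/
abbrev blow (E : Set E2) (x : E2) (r : ℝ) : Set E2 := {y : E2 | x + r • y ∈ E}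

/-- The half-plane with outer normal `ν`. -/
abbrev halfPlane (ν : E2) : Set E2 := {y : E2 | ⟪y, ν⟫ ≤ 0}

lemma measurable_blowMap (x : E2) (r : ℝ) : Measurable (fun y : E2 => x + r • y) := by fun_prop

lemma measurableSet_blow {E : Set E2} (hE : MeasurableSet E) (x : E2) (r : ℝ) :
    MeasurableSet (blow E x r) := measurable_blowMap x r hE

lemma measurableSet_halfPlane (ν : E2) : MeasurableSet (halfPlane ν) :=
  measurableSet_le (by fun_prop) measurable_const

lemma measure_symmDiff_inter_le {A B C U : Set E2} :
    volume ((A ∆ C) ∩ U) ≤ volume ((A ∆ B) ∩ U) + volume ((B ∆ C) ∩ U) := by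
  refine le_trans (measure_mono ?_) (measure_union_le _ _)
  rw [← union_inter_distrib_right]
  exact inter_subset_inter_left _ (symmDiff_triangle A B C)

lemma IsOuterNormalAt.unique {E : Set E2} {x ν ν' : E2} (h : IsOuterNormalAt E x ν)
    (h' : IsOuterNormalAt E x ν') : ν = ν' := by
  by_contra hne
  have h0 : volume ((halfPlane ν ∆ halfPlane ν') ∩ Metric.ball (0 : E2) 1) = 0 := by
    refine le_antisymm ?_ zero_le
    have hlim := h.2.add h'.2
    rw [add_zero] at hlim
    refine ge_of_tendsto hlim (Eventually.of_forall fun r => ?_)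
    refine (measure_symmDiff_inter_le (B := blow E x r)).trans ?_
    rw [symmDiff_comm (halfPlane ν)]
  set U : Set E2 := {y | ⟪y, ν⟫ < 0} ∩ {y | 0 < ⟪y, ν'⟫} ∩ Metric.ball 0 1 with hU
  have hUo : IsOpen U := by
    refine IsOpen.inter (IsOpen.inter ?_ ?_) Metric.isOpen_ball
    · exact isOpen_lt (by fun_prop) continuous_const
    · exact isOpen_lt continuous_const (by fun_prop)
  have hUsub : U ⊆ (halfPlane ν ∆ halfPlane ν') ∩ Metric.ball (0 : E2) 1 := by
    rintro y ⟨⟨h1, h2⟩, h3⟩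
    refine ⟨Or.inl ⟨?_, ?_⟩, h3⟩
    · exact le_of_lt (show ⟪y, ν⟫ < 0 from h1)
    · exact not_le.2 (show 0 < ⟪y, ν'⟫ from h2)
  have hUne : U.Nonempty := by
    have hi : ⟪ν, ν'⟫ < 1 := by
      refine lt_of_le_of_ne ?_ fun h1 => hne ((inner_eq_one_iff_of_norm_eq_one h.1 h'.1).1 h1)
      have := real_inner_le_norm ν ν'
      rwa [h.1, h'.1, one_mul] at this
    have hd : ‖ν' - ν‖ ≤ 2 := (norm_sub_le _ _).trans (by rw [h.1, h'.1]; norm_num)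
    refine ⟨(1 / 4 : ℝ) • (ν' - ν), ⟨?_, ?_⟩, ?_⟩
    · change ⟪(1 / 4 : ℝ) • (ν' - ν), ν⟫ < 0
      rw [real_inner_smul_left, inner_sub_left, real_inner_self_eq_norm_sq, h.1, real_inner_comm]
      nlinarith
    · change 0 < ⟪(1 / 4 : ℝ) • (ν' - ν), ν'⟫
      rw [real_inner_smul_left, inner_sub_left, real_inner_self_eq_norm_sq, h'.1]
      nlinarith
    · rw [mem_ball_zero_iff, norm_smul]
      norm_num
      linarith
  exact (hUo.measure_pos volume hUne).ne' (measure_mono_null hUsub h0)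

lemma IsOuterNormalAt.genNormal_eq {E : Set E2} {x ν : E2} (h : IsOuterNormalAt E x ν) :
    genNormal E x = ν := by
  have hex : ∃ ν, IsOuterNormalAt E x ν := ⟨ν, h⟩
  rw [genNormal, dif_pos hex]
  exact hex.choose_spec.unique h

lemma isOuterNormalAt_genNormal {E : Set E2} {x : E2} (h : x ∈ redBoundary E) :
    IsOuterNormalAt E x (genNormal E x) := by
  have hex : ∃ ν, IsOuterNormalAt E x ν := h
  rw [genNormal, dif_pos hex]
  exact hex.choose_spec

lemma volume_halfPlane_inter_ball_pos {ν : E2} (hν : ‖ν‖ = 1) :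
    0 < volume (halfPlane ν ∩ Metric.ball (0 : E2) 1) ∧
      0 < volume ((halfPlane ν)ᶜ ∩ Metric.ball (0 : E2) 1) := by
  have hb : ∀ c : ℝ, |c| < 1 → c • ν ∈ Metric.ball (0 : E2) 1 := fun c hc => by
    rwa [mem_ball_zero_iff, norm_smul, hν, mul_one]
  have hin : ∀ c : ℝ, ⟪c • ν, ν⟫ = c := fun c => by
    rw [real_inner_smul_left, real_inner_self_eq_norm_sq, hν]; ring
  constructor
  · have ho : IsOpen ({y : E2 | ⟪y, ν⟫ < 0} ∩ Metric.ball (0 : E2) 1) :=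
      (isOpen_lt (by fun_prop) continuous_const).inter Metric.isOpen_ball
    refine (ho.measure_pos volume ⟨(-1 / 2 : ℝ) • ν, ?_, hb _ (by norm_num [abs_lt])⟩).trans_le
      (measure_mono (inter_subset_inter_left _ fun y (hy : ⟪y, ν⟫ < 0) => hy.le))
    change ⟪(-1 / 2 : ℝ) • ν, ν⟫ < 0
    rw [hin]; norm_num
  · have ho : IsOpen ({y : E2 | 0 < ⟪y, ν⟫} ∩ Metric.ball (0 : E2) 1) :=
      (isOpen_lt continuous_const (by fun_prop)).inter Metric.isOpen_ball
    refine (ho.measure_pos volume ⟨(1 / 2 : ℝ) • ν, ?_, hb _ (by norm_num [abs_lt])⟩).trans_le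
      (measure_mono (inter_subset_inter_left _ fun y (hy : 0 < ⟪y, ν⟫) => not_le.2 hy))
    change 0 < ⟪(1 / 2 : ℝ) • ν, ν⟫
    rw [hin]; norm_num

lemma volume_blow_inter_ball_eq_zero {A : Set E2} {x : E2} {ρ r : ℝ} (hr : 0 < r) (hrρ : r ≤ ρ)
    (h : volume (A ∩ Metric.ball x ρ) = 0) : volume (blow A x r ∩ Metric.ball (0 : E2) 1) = 0 := by
  refine measure_mono_null (t := {y : E2 | x + r • y ∈ A ∩ Metric.ball x ρ}) ?_ ?_
  · rintro y ⟨h1, h2⟩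
    refine ⟨h1, Metric.ball_subset_ball hrρ ?_⟩
    rw [← blowup_ball x hr 1, mul_one] at h2
    exact h2
  · rw [volume_blowup x hr, h, mul_zero]

lemma notMem_redBoundary_of_null {E : Set E2} {x : E2} {ρ : ℝ} (hρ : 0 < ρ)
    (h : volume (E ∩ Metric.ball x ρ) = 0 ∨ volume (Eᶜ ∩ Metric.ball x ρ) = 0) :
    x ∉ redBoundary E := by
  rintro ⟨ν, hν, hlim⟩
  obtain ⟨p1, p2⟩ := volume_halfPlane_inter_ball_pos hν
  have hev : ∀ᶠ r in 𝓝[>] (0 : ℝ), 0 < r ∧ r ≤ ρ := Ioc_mem_nhdsGT hρ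
  rcases h with h | h
  · refine p1.not_ge (ge_of_tendsto hlim ?_)
    filter_upwards [hev] with r hr
    have h0 := volume_blow_inter_ball_eq_zero hr.1 hr.2 h
    have : volume (halfPlane ν ∩ Metric.ball (0 : E2) 1) ≤
        volume ((blow E x r ∆ halfPlane ν) ∩ Metric.ball (0 : E2) 1) +
        volume (blow E x r ∩ Metric.ball (0 : E2) 1) := by
      refine le_trans (measure_mono ?_) (measure_union_le _ _)
      rintro y ⟨h1, h2⟩
      by_cases h3 : y ∈ blow E x r
      · exact Or.inr ⟨h3, h2⟩
      · exact Or.inl ⟨Or.inr ⟨h1, h3⟩, h2⟩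
    rwa [h0, add_zero] at this
  · refine p2.not_ge (ge_of_tendsto hlim ?_)
    filter_upwards [hev] with r hr
    have h0 := volume_blow_inter_ball_eq_zero hr.1 hr.2 h
    have : volume ((halfPlane ν)ᶜ ∩ Metric.ball (0 : E2) 1) ≤
        volume ((blow E x r ∆ halfPlane ν) ∩ Metric.ball (0 : E2) 1) +
        volume (blow Eᶜ x r ∩ Metric.ball (0 : E2) 1) := by
      refine le_trans (measure_mono ?_) (measure_union_le _ _)
      rintro y ⟨h1, h2⟩
      by_cases h3 : y ∈ blow E x r
      · exact Or.inl ⟨Or.inl ⟨h3, h1⟩, h2⟩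
      · exact Or.inr ⟨h3, h2⟩
    rwa [h0, add_zero] at this

lemma IsOuterNormalAt.congr {E F : Set E2} {x ν : E2} (h : IsOuterNormalAt E x ν)
    (hEF : volume (E ∆ F) = 0) : IsOuterNormalAt F x ν := by
  refine ⟨h.1, h.2.congr' ?_⟩
  filter_upwards [self_mem_nhdsWithin] with r (hr : 0 < r)
  have h0 : volume (blow E x r ∆ blow F x r) = 0 := by
    change volume {y : E2 | x + r • y ∈ E ∆ F} = 0
    rw [volume_blowup x hr, hEF, mul_zero]
  have h1 : volume ((blow E x r ∆ blow F x r) ∩ Metric.ball (0 : E2) 1) = 0 :=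
    measure_mono_null inter_subset_left h0
  refine le_antisymm ?_ ?_
  · refine (measure_symmDiff_inter_le (B := blow F x r)).trans ?_
    rw [h1, zero_add]
  · refine (measure_symmDiff_inter_le (B := blow E x r)).trans ?_
    rw [symmDiff_comm (blow F x r), h1, zero_add]

lemma redBoundary_congr {E F : Set E2} (hEF : volume (E ∆ F) = 0) :
    redBoundary E = redBoundary F := by
  ext x
  exact ⟨fun ⟨ν, h⟩ => ⟨ν, h.congr hEF⟩, fun ⟨ν, h⟩ => ⟨ν, h.congr (by rwa [symmDiff_comm])⟩⟩

end Normals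

section LocalLipschitz

variable {X Y Z : Type*} [MetricSpace X] [MeasurableSpace X] [BorelSpace X]
  [MetricSpace Y] [MeasurableSpace Y] [BorelSpace Y]

lemma hausdorffMeasure_image_le_image {f : Z → X} {g : Z → Y} {P : Set Z} {K : ℝ≥0}
    (h : ∀ z ∈ P, ∀ z' ∈ P, dist (g z) (g z') ≤ K * dist (f z) (f z')) :
    μH[1] (g '' P) ≤ K * μH[1] (f '' P) := by
  rcases P.eq_empty_or_nonempty with rfl | ⟨z0, hz0⟩
  · simp
  have : Nonempty Z := ⟨z0⟩
  have hinv : ∀ z ∈ P, Function.invFunOn f P (f z) ∈ P ∧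
      f (Function.invFunOn f P (f z)) = f z := fun z hz =>
    ⟨Function.invFunOn_mem ⟨z, hz, rfl⟩, Function.invFunOn_eq ⟨z, hz, rfl⟩⟩
  have hL : LipschitzOnWith K (g ∘ Function.invFunOn f P) (f '' P) := by
    refine LipschitzOnWith.of_dist_le_mul ?_
    rintro _ ⟨z, hz, rfl⟩ _ ⟨z', hz', rfl⟩
    have := h _ (hinv z hz).1 _ (hinv z' hz').1
    rwa [(hinv z hz).2, (hinv z' hz').2] at this
  have him : g '' P ⊆ (g ∘ Function.invFunOn f P) '' (f '' P) := by
    rintro _ ⟨z, hz, rfl⟩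
    refine ⟨f z, ⟨z, hz, rfl⟩, ?_⟩
    have := h _ (hinv z hz).1 _ hz
    rw [(hinv z hz).2, dist_self, mul_zero] at this
    exact dist_le_zero.1 this
  refine (measure_mono him).trans ?_
  simpa using hL.hausdorffMeasure_image_le (d := 1) zero_le_one

variable [MetricSpace Z] [MeasurableSpace Z] [BorelSpace Z]

lemma exists_small_partition [SecondCountableTopology Z] [Nonempty Z] {δ : ℝ} (hδ : 0 < δ) :
    ∃ B : ℕ → Set Z, (∀ j, MeasurableSet (B j)) ∧ Pairwise (Function.onFun Disjoint B) ∧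
      (⋃ j, B j) = univ ∧ ∀ j, ∀ z ∈ B j, ∀ z' ∈ B j, dist z z' < δ := by
  refine ⟨disjointed fun j => Metric.ball (TopologicalSpace.denseSeq Z j) (δ / 2), ?_, ?_, ?_, ?_⟩
  · exact fun j => MeasurableSet.disjointed (fun i => Metric.isOpen_ball.measurableSet) j
  · exact disjoint_disjointed _
  · rw [iUnion_disjointed]
    refine eq_univ_of_forall fun z => mem_iUnion.2 ?_
    obtain ⟨j, hj⟩ := (TopologicalSpace.denseRange_denseSeq Z).exists_dist_lt z (half_pos hδ)
    exact ⟨j, hj⟩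
  · intro j z hz z' hz'
    have h1 := Metric.mem_ball.1 (disjointed_subset _ j hz)
    have h2 := Metric.mem_ball'.1 (disjointed_subset _ j hz')
    linarith [dist_triangle z (TopologicalSpace.denseSeq Z j) z']

lemma hausdorffMeasure_image_le_of_local [SecondCountableTopology Z] {g : Z → Y} {A : Set Z}
    {K : ℝ≥0} {ρ : Z → ℝ} (hρ : ∀ z ∈ A, 0 < ρ z)
    (h : ∀ z ∈ A, ∀ z' ∈ A, dist z z' < ρ z → dist z z' < ρ z' →
      dist (g z) (g z') ≤ K * dist z z') :
    μH[1] (g '' A) ≤ K * μH[1] A := by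
  rcases A.eq_empty_or_nonempty with rfl | ⟨z0, hz0⟩
  · simp
  have : Nonempty Z := ⟨z0⟩
  set An : ℕ → Set Z := fun n => {z ∈ A | 1 / ((n : ℝ) + 1) < ρ z} with hAn
  have hAnA : ∀ n, An n ⊆ A := fun n z hz => hz.1
  have hU : (⋃ n, An n) = A := by
    refine Subset.antisymm (iUnion_subset hAnA) fun z hz => mem_iUnion.2 ?_
    obtain ⟨n, hn⟩ := exists_nat_one_div_lt (hρ z hz)
    exact ⟨n, hz, hn⟩
  have hmono : Monotone An := fun n m hnm z hz =>
    ⟨hz.1, (one_div_le_one_div_of_le (by positivity) (by simpa using hnm)).trans_lt hz.2⟩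
  have hstep : ∀ n, μH[1] (g '' An n) ≤ K * μH[1] A := by
    intro n
    obtain ⟨B, hBm, hBd, hBU, hBs⟩ := exists_small_partition (Z := Z)
      (δ := 1 / ((n : ℝ) + 1)) (by positivity)
    have h1 : g '' An n ⊆ ⋃ j, g '' (An n ∩ B j) := by
      rintro _ ⟨z, hz, rfl⟩
      obtain ⟨j, hj⟩ := mem_iUnion.1 (hBU.symm ▸ mem_univ z : z ∈ ⋃ j, B j)
      exact mem_iUnion.2 ⟨j, z, ⟨hz, hj⟩, rfl⟩
    calc μH[1] (g '' An n) ≤ ∑' j, μH[1] (g '' (An n ∩ B j)) :=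
          (measure_mono h1).trans (measure_iUnion_le _)
      _ ≤ ∑' j, K * μH[1] (A ∩ B j) := by
          refine ENNReal.tsum_le_tsum fun j => ?_
          have := hausdorffMeasure_image_le_image (f := id) (g := g) (P := An n ∩ B j) (K := K)
            (fun z hz z' hz' => by
              have hd := hBs j z hz.2 z' hz'.2
              exact h z hz.1.1 z' hz'.1.1 (hd.trans hz.1.2) (hd.trans hz'.1.2))
          rw [image_id] at this
          exact this.trans (by gcongr; exact hAnA n)
      _ = K * ∑' j, (μH[1]).restrict A (B j) := by
          rw [ENNReal.tsum_mul_left]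
          simp_rw [Measure.restrict_apply (hBm _), inter_comm A]
      _ = K * μH[1] A := by
          rw [← measure_iUnion hBd hBm, hBU, Measure.restrict_apply_univ]
  rw [← hU, image_iUnion, Monotone.measure_iUnion (fun n m hnm => image_mono (hmono hnm))]
  rw [hU]
  exact iSup_le hstep

lemma hausdorffMeasure_image_eq_zero_of_local [SecondCountableTopology Z] {f : Z → X} {g : Z → Y}
    {A : Set Z} {K : ℝ≥0} {ρ : Z → ℝ} (hρ : ∀ z ∈ A, 0 < ρ z) (hf : μH[1] (f '' A) = 0)
    (h : ∀ z ∈ A, ∀ z' ∈ A, dist z z' < ρ z → dist z z' < ρ z' →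
      dist (g z) (g z') ≤ K * dist (f z) (f z')) :
    μH[1] (g '' A) = 0 := by
  rcases A.eq_empty_or_nonempty with rfl | ⟨z0, hz0⟩
  · simp
  have : Nonempty Z := ⟨z0⟩
  have key : ∀ n : ℕ, ∃ B : ℕ → Set Z, (⋃ j, B j) = univ ∧
      ∀ j, ∀ z ∈ B j, ∀ z' ∈ B j, dist z z' < 1 / ((n : ℝ) + 1) := fun n => by
    obtain ⟨B, -, -, hBU, hBs⟩ := exists_small_partition (Z := Z)
      (δ := 1 / ((n : ℝ) + 1)) (by positivity)
    exact ⟨B, hBU, hBs⟩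
  choose B hBU hBs using key
  have hsub : g '' A ⊆ ⋃ n : ℕ, ⋃ j, g '' ({z ∈ A | 1 / ((n : ℝ) + 1) < ρ z} ∩ B n j) := by
    rintro _ ⟨z, hz, rfl⟩
    obtain ⟨n, hn⟩ := exists_nat_one_div_lt (hρ z hz)
    obtain ⟨j, hj⟩ := mem_iUnion.1 ((hBU n).symm ▸ mem_univ z : z ∈ ⋃ j, B n j)
    exact mem_iUnion.2 ⟨n, mem_iUnion.2 ⟨j, z, ⟨⟨hz, hn⟩, hj⟩, rfl⟩⟩
  refine measure_mono_null hsub (measure_iUnion_null fun n => measure_iUnion_null fun j => ?_)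
  have := hausdorffMeasure_image_le_image (f := f) (g := g) (K := K)
    (P := {z ∈ A | 1 / ((n : ℝ) + 1) < ρ z} ∩ B n j)
    (fun z hz z' hz' => by
      have hd := hBs n j z hz.2 z' hz'.2
      exact h z hz.1.1 z' hz'.1.1 (hd.trans hz.1.2) (hd.trans hz'.1.2))
  refine le_antisymm (this.trans ?_) zero_le
  rw [measure_mono_null (image_mono fun z hz => hz.1.1) hf, mul_zero]

end LocalLipschitz

section Cone

lemma volume_half_ball_le {ν : E2} (hν : ‖ν‖ = 1) :
    volume (Metric.ball (0 : E2) (1 / 2)) ≤ volume (halfPlane ν ∩ Metric.ball (0 : E2) 1) ∧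
    volume (Metric.ball (0 : E2) (1 / 2)) ≤ volume ((halfPlane ν)ᶜ ∩ Metric.ball (0 : E2) 1) := by
  have key : ∀ σ : ℝ, |σ| = 1 → ∀ y ∈ Metric.ball ((σ / 2) • ν) (1 / 2),
      0 < σ * ⟪y, ν⟫ ∧ y ∈ Metric.ball (0 : E2) 1 := by
    intro σ hσ y hy
    rw [mem_ball_iff_norm] at hy
    have hs : σ * σ = 1 := by rw [← abs_mul_abs_self, hσ, one_mul]
    have hin : ⟪y, ν⟫ = σ / 2 + ⟪y - (σ / 2) • ν, ν⟫ := by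
      rw [inner_sub_left, real_inner_smul_left, real_inner_self_eq_norm_sq, hν]; ring
    have h1 := (abs_real_inner_le_norm (y - (σ / 2) • ν) ν).trans_lt (by rwa [hν, mul_one])
    constructor
    · rw [hin, mul_add, ← mul_div_assoc, hs]
      have h2 : |σ * ⟪y - (σ / 2) • ν, ν⟫| < 1 / 2 := by rwa [abs_mul, hσ, one_mul]
      linarith [(abs_lt.1 h2).1]
    · rw [mem_ball_zero_iff]
      have h3 : ‖(σ / 2) • ν‖ = 1 / 2 := by
        rw [norm_smul, hν, Real.norm_eq_abs, abs_div, hσ]; norm_num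
      linarith [norm_le_norm_sub_add y ((σ / 2) • ν)]
  have hvol : ∀ x : E2, volume (Metric.ball (0 : E2) (1 / 2)) = volume (Metric.ball x (1 / 2)) :=
    fun x => (Measure.addHaar_ball_center volume x _).symm
  constructor
  · rw [hvol ((-1 / 2 : ℝ) • ν)]
    refine measure_mono fun y hy => ?_
    have := key (-1) (by norm_num) y hy
    exact ⟨show ⟪y, ν⟫ ≤ 0 by linarith [this.1], this.2⟩
  · rw [hvol ((1 / 2 : ℝ) • ν)]
    refine measure_mono fun y hy => ?_
    have := key 1 (by norm_num) y hy
    exact ⟨not_le.2 (show 0 < ⟪y, ν⟫ by linarith [this.1]), this.2⟩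

/-- The deviation of the blow-up of `E` at `x` at scale `r` from the half-plane normal to `ν`. -/
def excess (E : Set E2) (x ν : E2) (r : ℝ) : ℝ≥0∞ :=
  volume ((blow E x r ∆ halfPlane ν) ∩ Metric.ball (0 : E2) 1)

lemma volume_blow_le_of_subset {E A : Set E2} {q q' : E2} {κ : ℝ} (hκ : 0 < κ)
    (h : ∀ y ∈ Metric.ball (0 : E2) 1, q' + (κ * dist q q') • y ∈ E →
      (2 * dist q q')⁻¹ • (q' - q) + (κ / 2) • y ∈ A) :
    volume (blow E q' (κ * dist q q') ∩ Metric.ball (0 : E2) 1) ≤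
      ENNReal.ofReal (((κ / 2) ^ 2)⁻¹) * volume A := by
  rw [← volume_blowup ((2 * dist q q')⁻¹ • (q' - q)) (half_pos hκ) A]
  exact measure_mono fun y hy => h y hy.2 hy.1

lemma abs_inner_le_of_excess_le {κ : ℝ} (hκ : 0 < κ) (hκ1 : κ ≤ 1) {ε : ℝ≥0∞}
    (hε : ε + ENNReal.ofReal (((κ / 2) ^ 2)⁻¹) * ε < volume (Metric.ball (0 : E2) (1 / 2)))
    {E : Set E2} {q q' ν ν' : E2} (hν : ‖ν‖ = 1) (hν' : ‖ν'‖ = 1) (hd : 0 < dist q q')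
    (h : excess E q ν (2 * dist q q') ≤ ε) (h' : excess E q' ν' (κ * dist q q') ≤ ε) :
    |⟪q' - q, ν⟫| ≤ κ * dist q q' := by
  set d := dist q q' with hd'
  have hnorm : ‖q' - q‖ = d := by rw [hd', dist_comm, dist_eq_norm]
  by_contra! hcon
  have hball : ∀ y ∈ Metric.ball (0 : E2) 1,
      (2 * d)⁻¹ • (q' - q) + (κ / 2) • y ∈ Metric.ball (0 : E2) 1 := by
    intro y hy
    rw [mem_ball_zero_iff] at hy ⊢
    have h1 : ‖(2 * d)⁻¹ • (q' - q)‖ = 1 / 2 := by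
      rw [norm_smul, hnorm, Real.norm_of_nonneg (by positivity)]; field_simp
    have h2 : ‖(κ / 2) • y‖ < 1 / 2 := by
      rw [norm_smul, Real.norm_of_nonneg (by positivity)]; nlinarith
    linarith [norm_add_le ((2 * d)⁻¹ • (q' - q)) ((κ / 2) • y)]
  have hblow : ∀ y : E2, q + (2 * d) • ((2 * d)⁻¹ • (q' - q) + (κ / 2) • y) =
      q' + (κ * d) • y := by
    intro y
    rw [smul_add, smul_smul, smul_smul, mul_inv_cancel₀ (by positivity), one_smul]
    rw [show 2 * d * (κ / 2) = κ * d by ring]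
    abel
  have hinner : ∀ y : E2, ⟪(2 * d)⁻¹ • (q' - q) + (κ / 2) • y, ν⟫ =
      (2 * d)⁻¹ * (⟪q' - q, ν⟫ + κ * d * ⟪y, ν⟫) := by
    intro y
    rw [inner_add_left, real_inner_smul_left, real_inner_smul_left]
    field_simp
  have hyν : ∀ y ∈ Metric.ball (0 : E2) 1, |κ * d * ⟪y, ν⟫| < κ * d := by
    intro y hy
    rw [mem_ball_zero_iff] at hy
    have h1 := abs_real_inner_le_norm y ν
    rw [hν, mul_one] at h1
    rw [abs_mul, abs_of_pos (by positivity)]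
    exact mul_lt_of_lt_one_right (by positivity) (h1.trans_lt hy)
  rcases lt_abs.1 hcon with hpos | hneg
  · have h1 := volume_blow_le_of_subset (E := E) (q := q) (q' := q') hκ
      (A := (blow E q (2 * d) ∆ halfPlane ν) ∩ Metric.ball (0 : E2) 1) (by
        intro y hy hyE
        refine ⟨Or.inl ⟨?_, ?_⟩, hball y hy⟩
        · change q + (2 * d) • ((2 * d)⁻¹ • (q' - q) + (κ / 2) • y) ∈ E
          rw [hblow]; exact hyE
        · change ¬ ⟪(2 * d)⁻¹ • (q' - q) + (κ / 2) • y, ν⟫ ≤ 0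
          rw [hinner, not_le]
          have := (abs_lt.1 (hyν y hy)).1
          exact mul_pos (by positivity) (by linarith))
    refine hε.not_ge ((volume_half_ball_le hν').1.trans ?_)
    refine le_trans ?_ (add_le_add h' (h1.trans (mul_le_mul_right h _)))
    refine le_trans (measure_mono ?_) (measure_union_le _ _)
    rintro y ⟨y1, y2⟩
    by_cases h3 : y ∈ blow E q' (κ * d)
    · exact Or.inr ⟨h3, y2⟩
    · exact Or.inl ⟨Or.inr ⟨y1, h3⟩, y2⟩
  · have h1 := volume_blow_le_of_subset (E := Eᶜ) (q := q) (q' := q') hκ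
      (A := (blow E q (2 * d) ∆ halfPlane ν) ∩ Metric.ball (0 : E2) 1) (by
        intro y hy hyE
        refine ⟨Or.inr ⟨?_, ?_⟩, hball y hy⟩
        · change ⟪(2 * d)⁻¹ • (q' - q) + (κ / 2) • y, ν⟫ ≤ 0
          rw [hinner]
          have := (abs_lt.1 (hyν y hy)).2
          exact mul_nonpos_of_nonneg_of_nonpos (by positivity) (by linarith)
        · change ¬ q + (2 * d) • ((2 * d)⁻¹ • (q' - q) + (κ / 2) • y) ∈ E
          rw [hblow]; exact hyE)
    refine hε.not_ge ((volume_half_ball_le hν').2.trans ?_)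
    refine le_trans ?_ (add_le_add h' (h1.trans (mul_le_mul_right h _)))
    refine le_trans (measure_mono ?_) (measure_union_le _ _)
    rintro y ⟨y1, y2⟩
    by_cases h3 : y ∈ blow E q' (κ * d)
    · exact Or.inl ⟨Or.inl ⟨h3, y1⟩, y2⟩
    · exact Or.inr ⟨h3, y2⟩

/-- Nearby points of the reduced boundary lie almost tangentially to each other. -/
lemma exists_cone (E : Set E2) {κ : ℝ} (hκ : 0 < κ) (hκ1 : κ ≤ 1) :
    ∃ ρ : E2 → ℝ, (∀ q ∈ redBoundary E, 0 < ρ q) ∧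
      ∀ q ∈ redBoundary E, ∀ q' ∈ redBoundary E, dist q q' < ρ q → dist q q' < ρ q' →
        |⟪q' - q, genNormal E q⟫| ≤ κ * dist q q' := by
  have hη : 0 < volume (Metric.ball (0 : E2) (1 / 2)) :=
    Metric.measure_ball_pos volume _ (by norm_num)
  obtain ⟨ε, hε0, hε⟩ : ∃ ε : ℝ≥0∞, 0 < ε ∧
      ε + ENNReal.ofReal (((κ / 2) ^ 2)⁻¹) * ε < volume (Metric.ball (0 : E2) (1 / 2)) := by
    have hlim : Tendsto (fun ε : ℝ≥0∞ => ε + ENNReal.ofReal (((κ / 2) ^ 2)⁻¹) * ε)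
        (𝓝[>] 0) (𝓝 0) := by
      have : Tendsto (fun ε : ℝ≥0∞ => ε + ENNReal.ofReal (((κ / 2) ^ 2)⁻¹) * ε)
          (𝓝 0) (𝓝 (0 + ENNReal.ofReal (((κ / 2) ^ 2)⁻¹) * 0)) :=
        tendsto_id.add (ENNReal.Tendsto.const_mul tendsto_id (Or.inr ENNReal.ofReal_ne_top))
      rw [mul_zero, add_zero] at this
      exact this.mono_left nhdsWithin_le_nhds
    obtain ⟨ε, h1, h2⟩ := ((hlim.eventually_lt_const hη).and self_mem_nhdsWithin).exists
    exact ⟨ε, h2, h1⟩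
  have hscale : ∀ q ∈ redBoundary E, ∃ ρ : ℝ, 0 < ρ ∧
      ∀ r, 0 < r → r < ρ → excess E q (genNormal E q) r ≤ ε := by
    intro q hq
    have h1 := (isOuterNormalAt_genNormal hq).2.eventually_le_const hε0
    obtain ⟨ρ, hρ, h2⟩ := mem_nhdsGT_iff_exists_Ioo_subset.1 h1
    exact ⟨ρ, hρ, fun r hr hr' => h2 ⟨hr, hr'⟩⟩
  choose! ρ hρ hex using hscale
  refine ⟨fun q => ρ q / 2, fun q hq => half_pos (hρ q hq), fun q hq q' hq' h1 h2 => ?_⟩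
  rcases eq_or_ne q q' with rfl | hne
  · simp
  have hd := dist_pos.2 hne
  refine abs_inner_le_of_excess_le hκ hκ1 hε (isOuterNormalAt_genNormal hq).1
    (isOuterNormalAt_genNormal hq').1 hd (hex q hq _ (by positivity) (by linarith))
    (hex q' hq' _ (by positivity) ?_)
  nlinarith

end Cone

section GraphBoundary

lemma volume_eq_zero_of_coord {P : ℝ → Prop} (hP : ∀ᵐ s, P s) {A : Set E2}
    (hA : ∀ q ∈ A, ¬ P (q 0)) : volume A = 0 :=
  measure_mono_null hA (ae_iff.1 (ae_coord_zero hP))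

variable {I G : Set ℝ} {w : ℝ → ℝ} {a b : ℝ}

lemma notMem_redBoundary_of_le (hG : ∀ᵐ s, s ∈ Ioo a b → s ∈ G) {q : E2} (hq : q 0 ∈ Ioo a b)
    {δ : ℝ} (hδ : 0 < δ) (h : ∀ s ∈ G, |s - q 0| < δ → w s ≤ q 1 - δ) :
    q ∉ redBoundary (subg I w) := by
  obtain ⟨ε, hε, hball⟩ := Metric.isOpen_iff.1 isOpen_Ioo (q 0) hq
  refine notMem_redBoundary_of_null (lt_min hε hδ) (Or.inl ?_)
  refine volume_eq_zero_of_coord hG ?_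
  rintro y ⟨⟨-, hy1⟩, hy2⟩ hyG
  rw [mem_ball_iff_norm] at hy2
  have h0 : |y 0 - q 0| < min ε δ := (abs_coord_le_norm (y - q) 0).trans_lt hy2
  have h1 : |y 1 - q 1| < min ε δ := (abs_coord_le_norm (y - q) 1).trans_lt hy2
  have h2 := h (y 0) (hyG (hball (by rw [Metric.mem_ball, Real.dist_eq]
                                     exact h0.trans_le (min_le_left _ _))))
    (h0.trans_le (min_le_right _ _))
  have h3 := (abs_lt.1 (h1.trans_le (min_le_right _ _))).1
  linarith

lemma notMem_redBoundary_of_ge (hI : Ioo a b ⊆ I) (hG : ∀ᵐ s, s ∈ Ioo a b → s ∈ G) {q : E2}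
    (hq : q 0 ∈ Ioo a b) {δ : ℝ} (hδ : 0 < δ) (h : ∀ s ∈ G, |s - q 0| < δ → q 1 + δ ≤ w s) :
    q ∉ redBoundary (subg I w) := by
  obtain ⟨ε, hε, hball⟩ := Metric.isOpen_iff.1 isOpen_Ioo (q 0) hq
  refine notMem_redBoundary_of_null (lt_min hε hδ) (Or.inr ?_)
  refine volume_eq_zero_of_coord hG ?_
  rintro y ⟨hy1, hy2⟩ hyG
  rw [mem_ball_iff_norm] at hy2
  have h0 : |y 0 - q 0| < min ε δ := (abs_coord_le_norm (y - q) 0).trans_lt hy2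
  have h1 : |y 1 - q 1| < min ε δ := (abs_coord_le_norm (y - q) 1).trans_lt hy2
  have hyI : y 0 ∈ Ioo a b :=
    hball (by rw [Metric.mem_ball, Real.dist_eq]; exact h0.trans_le (min_le_left _ _))
  have h2 := h (y 0) (hyG hyI) (h0.trans_le (min_le_right _ _))
  have h3 := (abs_lt.1 (h1.trans_le (min_le_right _ _))).2
  exact hy1 ⟨hI hyI, by linarith⟩

lemma abs_le_of_mem_redBoundary (hI : Ioo a b ⊆ I) (hG : ∀ᵐ s, s ∈ Ioo a b → s ∈ G) {M : ℝ}
    (hM : ∀ s ∈ G, |w s| ≤ M) {q : E2} (hq : q ∈ redBoundary (subg I w)) (hq0 : q 0 ∈ Ioo a b) :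
    |q 1| ≤ M := by
  rw [abs_le]
  constructor
  · by_contra! hlt
    refine notMem_redBoundary_of_ge hI hG hq0 (δ := -M - q 1) (by linarith) ?_ hq
    intro s hs _
    linarith [(abs_le.1 (hM s hs)).1]
  · by_contra! hlt
    refine notMem_redBoundary_of_le hG hq0 (δ := q 1 - M) (by linarith) ?_ hq
    intro s hs _
    linarith [(abs_le.1 (hM s hs)).2]

lemma eq_of_mem_redBoundary (hI : Ioo a b ⊆ I) (hG : ∀ᵐ s, s ∈ Ioo a b → s ∈ G)
    {q : E2} (hq : q ∈ redBoundary (subg I w)) (hq0 : q 0 ∈ Ioo a b)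
    (hc : ContinuousWithinAt w G (q 0)) : q 1 = w (q 0) := by
  have hnear : ∀ ε > 0, ∃ δ > 0, ∀ s ∈ G, |s - q 0| < δ → |w s - w (q 0)| < ε := by
    intro ε hε
    obtain ⟨δ, hδ, h⟩ := Metric.continuousWithinAt_iff.1 hc ε hε
    refine ⟨δ, hδ, fun s hs hd => ?_⟩
    have := h hs (by rwa [Real.dist_eq])
    rwa [Real.dist_eq] at this
  rcases lt_trichotomy (q 1) (w (q 0)) with hlt | heq | hgt
  · exfalso
    obtain ⟨δ, hδ, h⟩ := hnear ((w (q 0) - q 1) / 2) (by linarith)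
    refine notMem_redBoundary_of_ge hI hG hq0 (δ := min δ ((w (q 0) - q 1) / 2))
      (lt_min hδ (by linarith)) ?_ hq
    intro s hs hd
    have h1 := (abs_lt.1 (h s hs (hd.trans_le (min_le_left _ _)))).1
    linarith [min_le_right δ ((w (q 0) - q 1) / 2)]
  · exact heq
  · exfalso
    obtain ⟨δ, hδ, h⟩ := hnear ((q 1 - w (q 0)) / 2) (by linarith)
    refine notMem_redBoundary_of_le hG hq0 (δ := min δ ((q 1 - w (q 0)) / 2))
      (lt_min hδ (by linarith)) ?_ hq
    intro s hs hd
    have h1 := (abs_lt.1 (h s hs (hd.trans_le (min_le_left _ _)))).2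
    linarith [min_le_right δ ((q 1 - w (q 0)) / 2)]

/-- The upward unit normal to a graph of slope `p`. -/
def graphNormal (p : ℝ) : E2 := (√(1 + p ^ 2))⁻¹ • vec2 (-p) 1

lemma norm_graphNormal (p : ℝ) : ‖graphNormal p‖ = 1 := by
  have h : 0 < √(1 + p ^ 2) := Real.sqrt_pos.2 (by positivity)
  rw [graphNormal, norm_smul, norm_vec2, norm_inv, Real.norm_of_nonneg h.le,
    show (-p) ^ 2 + 1 ^ 2 = 1 + p ^ 2 by ring, inv_mul_cancel₀ h.ne']

lemma mem_halfPlane_graphNormal {p : ℝ} {y : E2} :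
    y ∈ halfPlane (graphNormal p) ↔ y 1 ≤ p * y 0 := by
  have h : 0 < (√(1 + p ^ 2))⁻¹ := inv_pos.2 (Real.sqrt_pos.2 (by positivity))
  change ⟪y, graphNormal p⟫ ≤ 0 ↔ _
  rw [graphNormal, real_inner_smul_right, mul_nonpos_iff_pos_imp_nonpos, inner_coord]
  simp only [vec2_apply_zero, vec2_apply_one]
  constructor
  · intro h1
    linarith [h1.1 h]
  · intro h1
    exact ⟨fun _ => by linarith, fun _ => h.le⟩

lemma volume_slab_le (p : ℝ) {η : ℝ} (hη : 0 ≤ η) :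
    volume {y : E2 | |y 0| ≤ 1 ∧ |y 1 - p * y 0| ≤ η} ≤ ENNReal.ofReal (4 * η) := by
  have hm : MeasurableSet {y : E2 | |y 0| ≤ 1 ∧ |y 1 - p * y 0| ≤ η} := by
    have h0 : Measurable fun y : E2 => |y 0| := by fun_prop
    have h1 : Measurable fun y : E2 => |y 1 - p * y 0| := by fun_prop
    exact (measurableSet_le h0 measurable_const).inter (measurableSet_le h1 measurable_const)
  rw [volume_eq_lintegral_section hm]
  calc ∫⁻ s, volume {t | vec2 s t ∈ {y : E2 | |y 0| ≤ 1 ∧ |y 1 - p * y 0| ≤ η}}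
      ≤ ∫⁻ s, (Icc (-1 : ℝ) 1).indicator (fun _ => ENNReal.ofReal (2 * η)) s := by
        refine lintegral_mono fun s => ?_
        by_cases hs : s ∈ Icc (-1 : ℝ) 1
        · rw [indicator_of_mem hs]
          have : {t | vec2 s t ∈ {y : E2 | |y 0| ≤ 1 ∧ |y 1 - p * y 0| ≤ η}} ⊆
              Icc (p * s - η) (p * s + η) := by
            rintro t ⟨-, ht⟩
            have := abs_le.1 ht
            simp only [vec2_apply_zero, vec2_apply_one] at this
            constructor <;> linarith [this.1, this.2]
          refine (measure_mono this).trans ?_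
          rw [Real.volume_Icc]
          exact ENNReal.ofReal_le_ofReal (by linarith)
        · rw [indicator_of_notMem hs, nonpos_iff_eq_zero]
          refine measure_mono_null (t := ∅) ?_ measure_empty
          rintro t ⟨ht, -⟩
          exact hs (abs_le.1 ht)
    _ = ENNReal.ofReal (4 * η) := by
        rw [lintegral_indicator measurableSet_Icc, setLIntegral_const, Real.volume_Icc,
          ← ENNReal.ofReal_mul (by positivity)]
        congr 1
        ring

lemma isOuterNormalAt_graph (hI : Ioo a b ⊆ I) (hG : ∀ᵐ s, s ∈ Ioo a b → s ∈ G) {s p : ℝ}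
    (hs : s ∈ Ioo a b) (hp : HasDerivWithinAt w p G s) :
    IsOuterNormalAt (subg I w) (vec2 s (w s)) (graphNormal p) := by
  refine ⟨norm_graphNormal p, ?_⟩
  obtain ⟨ε, hε, hball⟩ := Metric.isOpen_iff.1 isOpen_Ioo s hs
  have hsmall : ∀ η > 0, ∀ᶠ r in 𝓝[>] (0 : ℝ),
      volume ((blow (subg I w) (vec2 s (w s)) r ∆ halfPlane (graphNormal p)) ∩
        Metric.ball (0 : E2) 1) ≤ ENNReal.ofReal (4 * η) := by
    intro η hη
    have hlo := (hasDerivWithinAt_iff_isLittleO.1 hp).def hη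
    obtain ⟨δ, hδ, hlo⟩ := Metric.mem_nhdsWithin_iff.1 hlo
    filter_upwards [Ioc_mem_nhdsGT (lt_min hε hδ)] with r hr
    have hr0 := hr.1
    have hae : ∀ᵐ y : E2, s + r * y 0 ∈ Ioo a b → s + r * y 0 ∈ G := by
      have h1 := volume_eq_zero_of_coord (A := {q : E2 | ¬ (q 0 ∈ Ioo a b → q 0 ∈ G)}) hG
        (fun q hq => hq)
      have h2 := volume_blowup (vec2 s (w s)) hr0 {q : E2 | ¬ (q 0 ∈ Ioo a b → q 0 ∈ G)}
      rw [h1, mul_zero] at h2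
      exact h2
    refine le_trans (measure_mono_ae ?_) (volume_slab_le p hη.le)
    filter_upwards [hae] with y hyG hy
    obtain ⟨hy1, hy2⟩ := hy
    rw [mem_ball_zero_iff] at hy2
    have hy0 : |y 0| < 1 := (abs_coord_le_norm y 0).trans_lt hy2
    have hd : |r * y 0| < min ε δ := by
      rw [abs_mul, abs_of_pos hr0]
      exact (mul_lt_of_lt_one_right hr0 hy0).trans_le hr.2
    have hyI : s + r * y 0 ∈ Ioo a b := hball (by
      rw [Metric.mem_ball, Real.dist_eq, add_sub_cancel_left]
      exact hd.trans_le (min_le_left _ _))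
    have hyw : ‖w (s + r * y 0) - w s - (s + r * y 0 - s) • p‖ ≤ η * ‖s + r * y 0 - s‖ :=
      hlo ⟨by rw [Metric.mem_ball, Real.dist_eq, add_sub_cancel_left]
              exact hd.trans_le (min_le_right _ _), hyG hyI⟩
    rw [add_sub_cancel_left, Real.norm_eq_abs, Real.norm_eq_abs, abs_mul, abs_of_pos hr0,
      smul_eq_mul] at hyw
    have hyw' := abs_le.1 (hyw.trans (by nlinarith [mul_pos hr0 hη] : η * (r * |y 0|) ≤ r * η))
    have hmem : y ∈ blow (subg I w) (vec2 s (w s)) r ↔ w s + r * y 1 < w (s + r * y 0) :=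
      ⟨fun h => h.2, fun h => ⟨hI hyI, h⟩⟩
    refine ⟨hy0.le, abs_le.2 ?_⟩
    rcases hy1 with ⟨h1, h2⟩ | ⟨h1, h2⟩
    · rw [hmem] at h1
      rw [mem_halfPlane_graphNormal, not_le] at h2
      refine ⟨by linarith, ?_⟩
      have : r * (y 1 - p * y 0) ≤ r * η := by linarith [hyw'.2]
      exact le_of_mul_le_mul_left this hr0
    · rw [hmem, not_lt] at h2
      rw [mem_halfPlane_graphNormal] at h1
      refine ⟨?_, by linarith⟩
      have : r * (-η) ≤ r * (y 1 - p * y 0) := by linarith [hyw'.1]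
      exact le_of_mul_le_mul_left this hr0
  rw [ENNReal.tendsto_nhds_zero]
  intro ε' hε'
  rcases eq_or_ne ε' ⊤ with rfl | htop
  · exact Eventually.of_forall fun _ => le_top
  have h4 : 0 < ε'.toReal := ENNReal.toReal_pos hε'.ne' htop
  filter_upwards [hsmall (ε'.toReal / 4) (by positivity)] with r hr
  refine hr.trans ?_
  rw [mul_div_cancel₀ _ (by norm_num), ENNReal.ofReal_toReal htop]

end GraphBoundary

section GraphArea

lemma le_of_eventually_le_ofReal_mul {c : ℝ → ℝ} {x y : ℝ≥0∞} (hc : ContinuousAt c 0) (h0 : c 0 = 1)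
    (h : ∀ᶠ ε in 𝓝[>] (0 : ℝ), x ≤ ENNReal.ofReal (c ε) * y) : x ≤ y := by
  have h1 : Tendsto (fun ε => ENNReal.ofReal (c ε)) (𝓝[>] 0) (𝓝 1) := by
    have := ENNReal.tendsto_ofReal hc.tendsto
    rw [h0, ENNReal.ofReal_one] at this
    exact this.mono_left nhdsWithin_le_nhds
  refine ge_of_tendsto ?_ h
  simpa using ENNReal.Tendsto.mul_const h1 (Or.inl one_ne_zero) (b := y)

lemma measure_le_of_partition {μ ν : Measure ℝ} {P : ℕ → Set ℝ} (hPm : ∀ k, MeasurableSet (P k))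
    (hPd : Pairwise (Function.onFun Disjoint P)) (hPU : (⋃ k, P k) = univ)
    (h : ∀ k, ∀ B, MeasurableSet B → B ⊆ P k → μ B ≤ ν B) : μ ≤ ν := by
  have key : ∀ (σ : Measure ℝ) (B : Set ℝ), σ B = ∑' k, σ (P k ∩ B) := fun σ B => by
    rw [← Measure.restrict_apply_univ, ← hPU, measure_iUnion hPd hPm]
    exact tsum_congr fun k => Measure.restrict_apply (hPm k)
  refine Measure.le_iff.2 fun B hB => ?_
  rw [key μ B, key ν B]
  exact ENNReal.tsum_le_tsum fun k => h k _ ((hPm k).inter hB) inter_subset_left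

/-- The arc length element of a graph of slope `p`. -/
def arcLen (p : ℝ) : ℝ := √(1 + p ^ 2)

lemma one_le_arcLen (p : ℝ) : 1 ≤ arcLen p := Real.one_le_sqrt.2 (by nlinarith [sq_nonneg p])

lemma continuous_arcLen : Continuous arcLen := by unfold arcLen; fun_prop

lemma norm_vec2_one (p : ℝ) : ‖vec2 1 p‖ = arcLen p := by rw [norm_vec2, one_pow]; rfl

variable {v p : ℝ → ℝ} {G D : Set ℝ}

lemma measurableSet_graph_image (hv : Measurable v) {A : Set ℝ} (hA : MeasurableSet A) :
    MeasurableSet ((fun s => vec2 s (v s)) '' A) := by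
  have : (fun s => vec2 s (v s)) '' A = {q : E2 | q 0 ∈ A} ∩ {q : E2 | q 1 = v (q 0)} := by
    ext q
    constructor
    · rintro ⟨s, hs, rfl⟩
      exact ⟨hs, rfl⟩
    · rintro ⟨h1, h2⟩
      exact ⟨q 0, h1, E2.ext_coord rfl (Eq.symm h2)⟩
  rw [this]
  have h0 : Measurable fun q : E2 => q 0 := by fun_prop
  have h1 : Measurable fun q : E2 => q 1 := by fun_prop
  exact (h0 hA).inter (measurableSet_eq_fun h1 (hv.comp h0))

lemma exists_graph_bilipschitz (hDG : D ⊆ G) (hp : ∀ s ∈ D, HasDerivWithinAt v (p s) G s) {ε : ℝ}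
    (hε : 0 < ε) :
    ∃ ρ : ℝ → ℝ, (∀ s ∈ D, 0 < ρ s) ∧ ∀ s ∈ D, ∀ s' ∈ D, dist s s' < ρ s →
      dist (vec2 s (v s)) (vec2 s' (v s')) ≤ (arcLen (p s) + ε) * dist s s' ∧
      (arcLen (p s) - ε) * dist s s' ≤ dist (vec2 s (v s)) (vec2 s' (v s')) := by
  have key : ∀ s ∈ D, ∃ ρ > 0, ∀ s' ∈ G, dist s s' < ρ →
      |v s' - v s - (s' - s) * p s| ≤ ε * |s' - s| := by
    intro s hs
    have hlo := (hasDerivWithinAt_iff_isLittleO.1 (hp s hs)).def hε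
    obtain ⟨ρ, hρ, h⟩ := Metric.mem_nhdsWithin_iff.1 hlo
    exact ⟨ρ, hρ, fun s' hs' hd => h ⟨Metric.mem_ball'.2 hd, hs'⟩⟩
  choose! ρ hρ h using key
  refine ⟨ρ, hρ, fun s hs s' hs' hd => ?_⟩
  have h1 := h s hs s' (hDG hs') hd
  have h2 : vec2 s' (v s') - vec2 s (v s) =
      (s' - s) • vec2 1 (p s) + vec2 0 (v s' - v s - (s' - s) * p s) := by
    apply E2.ext_coord <;> simp
  have h3 : ‖vec2 0 (v s' - v s - (s' - s) * p s)‖ ≤ ε * |s' - s| := by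
    refine le_trans (norm_le_abs_add_abs _) ?_
    simpa using h1
  have h4 : ‖(s' - s) • vec2 1 (p s)‖ = arcLen (p s) * |s' - s| := by
    rw [norm_smul, norm_vec2_one, Real.norm_eq_abs, mul_comm]
  rw [dist_comm, dist_comm s, dist_eq_norm, Real.dist_eq, h2]
  constructor
  · have := norm_add_le ((s' - s) • vec2 1 (p s)) (vec2 0 (v s' - v s - (s' - s) * p s))
    linarith
  · have := norm_sub_le ((s' - s) • vec2 1 (p s) + vec2 0 (v s' - v s - (s' - s) * p s))
      (vec2 0 (v s' - v s - (s' - s) * p s))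
    rw [add_sub_cancel_right] at this
    linarith

/-- The length of graphs over subsets of `D`, as a measure on the line. -/
def graphMeasure (v : ℝ → ℝ) (D : Set ℝ) : Measure ℝ :=
  ((μH[1] : Measure E2).restrict ((fun s => vec2 s (v s)) '' D)).map (fun q => q 0)

lemma graphMeasure_apply {B : Set ℝ} (hB : MeasurableSet B) :
    graphMeasure v D B = μH[1] ((fun s => vec2 s (v s)) '' (B ∩ D)) := by
  have h0 : Measurable fun q : E2 => q 0 := by fun_prop
  rw [graphMeasure, Measure.map_apply h0 hB, Measure.restrict_apply (h0 hB)]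
  congr 1
  ext q
  constructor
  · rintro ⟨h1, s, hs, rfl⟩
    exact ⟨s, ⟨h1, hs⟩, rfl⟩
  · rintro ⟨s, ⟨h1, hs⟩, rfl⟩
    exact ⟨h1, s, hs, rfl⟩

lemma graphMeasure_bounds (hDG : D ⊆ G) (hDm : MeasurableSet D) (hpm : Measurable p)
    (hp : ∀ s ∈ D, HasDerivWithinAt v (p s) G s) {ε : ℝ} (hε : 0 < ε) (hε1 : ε < 1) :
    graphMeasure v D ≤ ENNReal.ofReal (1 + 2 * ε) •
      (volume.restrict D).withDensity (fun s => ENNReal.ofReal (arcLen (p s))) ∧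
    (volume.restrict D).withDensity (fun s => ENNReal.ofReal (arcLen (p s))) ≤
      ENNReal.ofReal ((1 + ε) / (1 - ε)) • graphMeasure v D := by
  obtain ⟨ρ, hρ, hbi⟩ := exists_graph_bilipschitz hDG hp hε
  have hJm : Measurable fun s => arcLen (p s) := continuous_arcLen.measurable.comp hpm
  set P : ℕ → Set ℝ := fun k => (fun s => arcLen (p s)) ⁻¹' Ico ((1 + ε) ^ k) ((1 + ε) ^ (k + 1))
    with hP
  have hPm : ∀ k, MeasurableSet (P k) := fun k => hJm measurableSet_Ico
  have hmono : Monotone fun k : ℕ => (1 + ε) ^ k := pow_right_mono₀ (by linarith)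
  have hPd : Pairwise (Function.onFun Disjoint P) := fun i j hij =>
    (hmono.pairwise_disjoint_on_Ico_succ hij).preimage _
  have hPU : (⋃ k, P k) = univ := eq_univ_of_forall fun s => by
    obtain ⟨n, h1, h2⟩ := exists_nat_pow_near (one_le_arcLen (p s)) (by linarith : 1 < 1 + ε)
    exact mem_iUnion.2 ⟨n, h1, h2⟩
  have hdens : ∀ B, MeasurableSet B →
      (volume.restrict D).withDensity (fun s => ENNReal.ofReal (arcLen (p s))) B =
      ∫⁻ s in B ∩ D, ENNReal.ofReal (arcLen (p s)) := fun B hB => by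
    rw [withDensity_apply _ hB, Measure.restrict_restrict hB]
  have hm1 : ∀ k : ℕ, 1 ≤ (1 + ε) ^ k := fun k => one_le_pow₀ (by linarith)
  constructor
  · refine measure_le_of_partition hPm hPd hPU fun k B hB hBP => ?_
    rw [Measure.smul_apply, graphMeasure_apply hB, hdens B hB, smul_eq_mul]
    have hm := hm1 k
    set m := (1 + ε) ^ k
    have hK : 0 ≤ m * (1 + 2 * ε) := by positivity
    have h1 := hausdorffMeasure_image_le_of_local (g := fun s => vec2 s (v s)) (A := B ∩ D)
      (K := (m * (1 + 2 * ε)).toNNReal) (ρ := ρ) (fun s hs => hρ s hs.2)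
      (fun s hs s' hs' hd _ => by
        refine (hbi s hs.2 s' hs'.2 hd).1.trans ?_
        rw [Real.coe_toNNReal _ hK]
        refine mul_le_mul_of_nonneg_right ?_ dist_nonneg
        have h2 : arcLen (p s) < (1 + ε) ^ (k + 1) := (hBP hs.1).2
        rw [pow_succ] at h2
        change arcLen (p s) < m * (1 + ε) at h2
        nlinarith)
    refine h1.trans ?_
    rw [hausdorffMeasure_real]
    change ENNReal.ofReal (m * (1 + 2 * ε)) * _ ≤ _
    rw [mul_comm m, ENNReal.ofReal_mul (by positivity), mul_assoc]
    refine mul_le_mul_right ?_ _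
    rw [← setLIntegral_const]
    exact setLIntegral_mono' (hB.inter hDm) fun s hs => ENNReal.ofReal_le_ofReal (hBP hs.1).1
  · refine measure_le_of_partition hPm hPd hPU fun k B hB hBP => ?_
    rw [Measure.smul_apply, graphMeasure_apply hB, hdens B hB, smul_eq_mul]
    have hm := hm1 k
    have hup : ∀ s ∈ B, arcLen (p s) ≤ (1 + ε) ^ k * (1 + ε) := fun s hs => by
      rw [← pow_succ]; exact (hBP hs).2.le
    have hlow : ∀ s ∈ B, (1 + ε) ^ k ≤ arcLen (p s) := fun s hs => (hBP hs).1
    set m := (1 + ε) ^ k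
    have hK : 0 < m * (1 - ε) := mul_pos (by positivity) (by linarith)
    have h1 := hausdorffMeasure_image_le_of_local (g := fun q : E2 => q 0)
      (A := (fun s => vec2 s (v s)) '' (B ∩ D))
      (K := ((m * (1 - ε))⁻¹).toNNReal) (ρ := fun q => ρ (q 0))
      (by rintro _ ⟨s, hs, rfl⟩; exact hρ s hs.2)
      (by
        rintro _ ⟨s, hs, rfl⟩ _ ⟨s', hs', rfl⟩ hd _
        rw [Real.coe_toNNReal _ (by positivity), inv_mul_eq_div, le_div_iff₀ hK]
        have hd' : dist s s' ≤ dist (vec2 s (v s)) (vec2 s' (v s')) := by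
          rw [dist_eq_norm, dist_eq_norm, Real.norm_eq_abs]
          exact abs_coord_le_norm (vec2 s (v s) - vec2 s' (v s')) 0
        refine le_trans ?_ (hbi s hs.2 s' hs'.2 (hd'.trans_lt hd)).2
        rw [mul_comm]
        refine mul_le_mul_of_nonneg_right ?_ dist_nonneg
        have := hlow s hs.1
        nlinarith)
    have him : (fun q : E2 => q 0) '' ((fun s => vec2 s (v s)) '' (B ∩ D)) = B ∩ D := by
      rw [image_image]; simp
    rw [him, hausdorffMeasure_real] at h1
    calc ∫⁻ s in B ∩ D, ENNReal.ofReal (arcLen (p s))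
        ≤ ∫⁻ s in B ∩ D, ENNReal.ofReal (m * (1 + ε)) :=
          setLIntegral_mono' (hB.inter hDm) fun s hs => ENNReal.ofReal_le_ofReal (hup s hs.1)
      _ = ENNReal.ofReal (m * (1 + ε)) * volume (B ∩ D) := setLIntegral_const _ _
      _ ≤ ENNReal.ofReal (m * (1 + ε)) * (ENNReal.ofReal ((m * (1 - ε))⁻¹) *
          μH[1] ((fun s => vec2 s (v s)) '' (B ∩ D))) := mul_le_mul_right h1 _
      _ = _ := by
          rw [← mul_assoc, ← ENNReal.ofReal_mul (by positivity)]
          congr 2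
          have : 1 - ε ≠ 0 := by linarith
          field_simp

lemma graphMeasure_eq (hDG : D ⊆ G) (hDm : MeasurableSet D) (hpm : Measurable p)
    (hp : ∀ s ∈ D, HasDerivWithinAt v (p s) G s) :
    graphMeasure v D =
      (volume.restrict D).withDensity (fun s => ENNReal.ofReal (arcLen (p s))) := by
  have hev : ∀ᶠ ε in 𝓝[>] (0 : ℝ), 0 < ε ∧ ε < 1 := Ioo_mem_nhdsGT one_pos
  refine le_antisymm (Measure.le_iff'.2 fun B => ?_) (Measure.le_iff'.2 fun B => ?_)
  · refine le_of_eventually_le_ofReal_mul (c := fun ε => 1 + 2 * ε) (by fun_prop) (by norm_num) ?_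
    filter_upwards [hev] with ε hε
    exact Measure.le_iff'.1 (graphMeasure_bounds hDG hDm hpm hp hε.1 hε.2).1 B
  · refine le_of_eventually_le_ofReal_mul (c := fun ε => (1 + ε) / (1 - ε)) ?_ (by norm_num) ?_
    · exact ContinuousAt.div (by fun_prop) (by fun_prop) (by norm_num)
    filter_upwards [hev] with ε hε
    exact Measure.le_iff'.1 (graphMeasure_bounds hDG hDm hpm hp hε.1 hε.2).2 B

/-- The area formula for the graph of a function differentiable along `D`. -/
lemma lintegral_graph_eq (hDG : D ⊆ G) (hDm : MeasurableSet D) (hpm : Measurable p)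
    (hp : ∀ s ∈ D, HasDerivWithinAt v (p s) G s) {k : ℝ → ℝ≥0∞} (hk : Measurable k) :
    ∫⁻ q in (fun s => vec2 s (v s)) '' D, k (q 0) ∂μH[1] =
      ∫⁻ s in D, ENNReal.ofReal (arcLen (p s)) * k s := by
  have h0 : Measurable fun q : E2 => q 0 := by fun_prop
  rw [← lintegral_map hk h0]
  change ∫⁻ s, k s ∂(graphMeasure v D) = _
  rw [graphMeasure_eq hDG hDm hpm hp, lintegral_withDensity_eq_lintegral_mul _ _ hk]
  · rfl
  · exact (continuous_arcLen.measurable.comp hpm).ennreal_ofReal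

end GraphArea

section VerticalPart

lemma excess_le_four_mul {E : Set E2} {x ν : E2} {r R : ℝ} (hr : 0 < r) (hrR : r ≤ R)
    (hR : R ≤ 2 * r) : excess E x ν r ≤ 4 * excess E x ν R := by
  have hR0 : 0 < R := hr.trans_le hrR
  have h1 : excess E x ν r ≤ volume {y : E2 | (0 : E2) + (r / R) • y ∈
      (blow E x R ∆ halfPlane ν) ∩ Metric.ball (0 : E2) 1} := by
    refine measure_mono ?_
    rintro y ⟨hy1, hy2⟩
    have hb : y ∈ blow E x r ↔ (0 : E2) + (r / R) • y ∈ blow E x R := by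
      change x + r • y ∈ E ↔ x + R • ((0 : E2) + (r / R) • y) ∈ E
      rw [zero_add, smul_smul, mul_div_cancel₀ _ hR0.ne']
    have hh : y ∈ halfPlane ν ↔ (0 : E2) + (r / R) • y ∈ halfPlane ν := by
      change ⟪y, ν⟫ ≤ 0 ↔ ⟪(0 : E2) + (r / R) • y, ν⟫ ≤ 0
      rw [zero_add, real_inner_smul_left]
      have : 0 < r / R := by positivity
      constructor
      · intro h; exact mul_nonpos_of_nonneg_of_nonpos this.le h
      · intro h; exact nonpos_of_mul_nonpos_right h this
    refine ⟨?_, ?_⟩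
    · rw [mem_symmDiff, hb, hh] at hy1
      exact hy1
    · rw [mem_ball_zero_iff] at hy2 ⊢
      rw [zero_add, norm_smul, Real.norm_of_nonneg (by positivity)]
      have : r / R ≤ 1 := (div_le_one hR0).2 hrR
      nlinarith [norm_nonneg y]
  refine h1.trans ?_
  rw [volume_blowup _ (by positivity)]
  refine mul_le_mul_left ?_ _
  rw [show (4 : ℝ≥0∞) = ENNReal.ofReal 4 by norm_num]
  refine ENNReal.ofReal_le_ofReal ?_
  rw [← inv_pow, inv_div]
  have : R / r ≤ 2 := (div_le_iff₀ hr).2 hR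
  have h0 : 0 ≤ R / r := by positivity
  nlinarith

lemma tendsto_excess_iff {E : Set E2} {x ν : E2} :
    Tendsto (fun r => excess E x ν r) (𝓝[>] 0) (𝓝 0) ↔
      Tendsto (fun n : ℕ => excess E x ν ((1 / 2) ^ n)) atTop (𝓝 0) := by
  constructor
  · intro h
    refine h.comp (tendsto_nhdsWithin_iff.2 ⟨?_, Eventually.of_forall fun n => ?_⟩)
    · exact tendsto_pow_atTop_nhds_zero_of_lt_one (by norm_num) (by norm_num)
    · exact (show (0 : ℝ) < (1 / 2) ^ n by positivity)
  · intro h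
    rw [ENNReal.tendsto_nhds_zero] at h ⊢
    intro ε hε
    obtain ⟨n0, hn0⟩ := eventually_atTop.1 (h (ε / 4) (ENNReal.div_pos hε.ne' (by norm_num)))
    have hpos : (0 : ℝ) < (1 / 2) ^ n0 := by positivity
    filter_upwards [Ioo_mem_nhdsGT hpos] with r hr
    have hr1 : r ≤ 1 := hr.2.le.trans (pow_le_one₀ (by norm_num) (by norm_num))
    obtain ⟨n, h1, h2⟩ := exists_nat_pow_near_of_lt_one hr.1 hr1 (y := 1 / 2)
      (by norm_num) (by norm_num)
    have hn : n0 ≤ n := by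
      by_contra! hlt
      have : ((1 : ℝ) / 2) ^ n0 ≤ (1 / 2) ^ (n + 1) :=
        pow_le_pow_of_le_one (by norm_num) (by norm_num) hlt
      linarith [hr.2]
    refine (excess_le_four_mul hr.1 h2 (by rw [pow_succ] at h1; linarith)).trans ?_
    refine (mul_le_mul_right (hn0 n hn) 4).trans ?_
    rw [ENNReal.mul_div_cancel (by norm_num) (by norm_num)]

lemma measurable_excess {E : Set E2} (hE : MeasurableSet E) (ν : E2) (r : ℝ) :
    Measurable fun x => excess E x ν r := by
  have hm : MeasurableSet {z : E2 × E2 | z.2 ∈ (blow E z.1 r ∆ halfPlane ν) ∩ Metric.ball 0 1} := by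
    have h1 : MeasurableSet {z : E2 × E2 | z.1 + r • z.2 ∈ E} := by
      have : Measurable fun z : E2 × E2 => z.1 + r • z.2 := by fun_prop
      exact this hE
    have h2 : MeasurableSet {z : E2 × E2 | z.2 ∈ halfPlane ν} :=
      measurable_snd (measurableSet_halfPlane ν)
    have h3 : MeasurableSet {z : E2 × E2 | z.2 ∈ Metric.ball (0 : E2) 1} :=
      measurable_snd Metric.isOpen_ball.measurableSet
    exact (h1.symmDiff h2).inter h3
  exact measurable_measure_prodMk_left hm

lemma measurableSet_isOuterNormalAt {E : Set E2} (hE : MeasurableSet E) (ν : E2) :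
    MeasurableSet {x | IsOuterNormalAt E x ν} := by
  have h1 : MeasurableSet {x | Tendsto (fun n : ℕ => excess E x ν ((1 / 2) ^ n)) atTop (𝓝 0)} :=
    measurableSet_tendsto _ fun n => measurable_excess hE ν _
  have h2 : {x | IsOuterNormalAt E x ν} =
      {x | ‖ν‖ = 1} ∩ {x | Tendsto (fun n : ℕ => excess E x ν ((1 / 2) ^ n)) atTop (𝓝 0)} := by
    ext x
    exact and_congr_right fun _ => tendsto_excess_iff
  rw [h2]
  exact (MeasurableSet.const _).inter h1

/-- The points at which the outer normal of `E` is horizontal. -/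
def verticalBoundary (E : Set E2) : Set E2 :=
  {q | IsOuterNormalAt E q e1 ∨ IsOuterNormalAt E q (-e1)}

lemma measurableSet_verticalBoundary {E : Set E2} (hE : MeasurableSet E) :
    MeasurableSet (verticalBoundary E) :=
  (measurableSet_isOuterNormalAt hE e1).union (measurableSet_isOuterNormalAt hE (-e1))

lemma verticalBoundary_subset (E : Set E2) : verticalBoundary E ⊆ redBoundary E := by
  rintro q (h | h)
  exacts [⟨_, h⟩, ⟨_, h⟩]

lemma genNormal_eq_of_mem_verticalBoundary {E : Set E2} {q : E2} (h : q ∈ verticalBoundary E) :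
    genNormal E q = e1 ∨ genNormal E q = -e1 :=
  h.imp (fun h => h.genNormal_eq) (fun h => h.genNormal_eq)

lemma mem_verticalBoundary {E : Set E2} {q : E2} (h : q ∈ redBoundary E)
    (h0 : genNormal E q 1 = 0) : q ∈ verticalBoundary E := by
  have hn := isOuterNormalAt_genNormal h
  have h1 := norm_sq_coord (genNormal E q)
  rw [hn.1, h0] at h1
  have h2 : (genNormal E q 0 - 1) * (genNormal E q 0 + 1) = 0 := by linarith
  rcases mul_eq_zero.1 h2 with h3 | h3
  · left
    have : genNormal E q = e1 := E2.ext_coord (by simp [e1]; linarith) (by simp [e1, h0])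
    rwa [← this]
  · right
    have : genNormal E q = -e1 := E2.ext_coord (by simp [e1]; linarith) (by simp [e1, h0])
    rwa [← this]

lemma hausdorffMeasure_slanted_eq_zero (E : Set E2) {S : Set ℝ} (hS : volume S = 0) :
    μH[1] {q ∈ redBoundary E | q 0 ∈ S ∧ genNormal E q 1 ≠ 0} = 0 := by
  have hsub : {q ∈ redBoundary E | q 0 ∈ S ∧ genNormal E q 1 ≠ 0} ⊆
      ⋃ n : ℕ, {q ∈ redBoundary E | q 0 ∈ S ∧ 1 / ((n : ℝ) + 1) < |genNormal E q 1|} := by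
    rintro q ⟨h1, h2, h3⟩
    obtain ⟨n, hn⟩ := exists_nat_one_div_lt (abs_pos.2 h3)
    exact mem_iUnion.2 ⟨n, h1, h2, hn⟩
  refine measure_mono_null hsub (measure_iUnion_null fun n => ?_)
  set A := {q ∈ redBoundary E | q 0 ∈ S ∧ 1 / ((n : ℝ) + 1) < |genNormal E q 1|} with hA
  have hn : (0 : ℝ) ≤ n := Nat.cast_nonneg n
  have hκ : 0 < 1 / (2 * ((n : ℝ) + 1)) := by positivity
  obtain ⟨ρ, hρ, hcone⟩ := exists_cone E hκ
    (by rw [div_le_one (by positivity)]; linarith)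
  have := hausdorffMeasure_image_eq_zero_of_local (f := fun q : E2 => q 0) (g := id) (A := A)
    (K := (4 * ((n : ℝ) + 1) + 1).toNNReal) (ρ := ρ) (fun q hq => hρ q hq.1) ?_ ?_
  · rwa [image_id] at this
  · rw [hausdorffMeasure_real]
    refine measure_mono_null ?_ hS
    rintro _ ⟨q, hq, rfl⟩
    exact hq.2.1
  · intro q hq q' hq' h1 h2
    have hc := hcone q hq.1 q' hq'.1 h1 h2
    rw [Real.coe_toNNReal _ (by positivity)]
    have hd : dist q q' ≤ |(q' - q) 0| + |(q' - q) 1| := by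
      rw [dist_comm, dist_eq_norm]; exact norm_le_abs_add_abs _
    have hdx : dist (q 0) (q' 0) = |(q' - q) 0| := by
      rw [dist_comm, Real.dist_eq]; rfl
    have hν0 : |genNormal E q 0| ≤ 1 := by
      rw [← (isOuterNormalAt_genNormal hq.1).1]; exact abs_coord_le_norm _ _
    have hν1 := hq.2.2
    rw [inner_coord] at hc
    rw [id, id, hdx]
    generalize (q' - q) 0 = x at *
    generalize (q' - q) 1 = y at *
    generalize genNormal E q 0 = ν0 at *
    generalize genNormal E q 1 = ν1 at *
    have h3 : |y| * |ν1| ≤ 1 / (2 * ((n : ℝ) + 1)) * dist q q' + |x| := by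
      have h4 : |y * ν1| ≤ |x * ν0 + y * ν1| + |x * ν0| := by
        have := abs_sub (x * ν0 + y * ν1) (x * ν0)
        rwa [add_sub_cancel_left] at this
      rw [abs_mul, abs_mul] at h4
      nlinarith [abs_nonneg x]
    set m : ℝ := (n : ℝ) + 1 with hm
    have hm0 : 0 < m := by positivity
    have h5 : |y| * (1 / m) ≤ 1 / (2 * m) * (|x| + |y|) + |x| := by
      have := mul_le_mul_of_nonneg_left hν1.le (abs_nonneg y)
      have := mul_le_mul_of_nonneg_left hd hκ.le
      linarith
    have h6 : |y| ≤ (1 + 2 * m) * |x| := by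
      have := mul_le_mul_of_nonneg_left h5 (by positivity : 0 ≤ 2 * m)
      field_simp at this
      linarith
    have : 1 ≤ m := by linarith
    nlinarith [abs_nonneg x]

lemma hausdorffMeasure_shear_le (E : Set E2) {ψ : ℝ → ℝ} {L : ℝ} (hL : 0 ≤ L)
    (hψ : ∀ x y, |ψ x - ψ y| ≤ L * |x - y|) {A : Set E2} (hA : A ⊆ verticalBoundary E) :
    μH[1] (shear ψ '' A) ≤ μH[1] A := by
  refine le_of_eventually_le_ofReal_mul (c := fun κ => 1 + L * κ) (by fun_prop) (by norm_num) ?_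
  filter_upwards [Ioo_mem_nhdsGT one_pos] with κ hκ
  obtain ⟨ρ, hρ, hcone⟩ := exists_cone E hκ.1 hκ.2.le
  have hAr := hA.trans (verticalBoundary_subset E)
  have hK : 0 ≤ 1 + L * κ := by have := hκ.1; positivity
  refine hausdorffMeasure_image_le_of_local (K := (1 + L * κ).toNNReal) (ρ := ρ)
    (fun q hq => hρ q (hAr hq)) fun q hq q' hq' h1 h2 => ?_
  have hc := hcone q (hAr hq) q' (hAr hq') h1 h2
  have hx : |q' 0 - q 0| ≤ κ * dist q q' := by
    rcases genNormal_eq_of_mem_verticalBoundary (hA hq) with h | h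
    · rw [h, inner_coord] at hc
      simpa [e1] using hc
    · rw [h, inner_neg_right, abs_neg, inner_coord] at hc
      simpa [e1] using hc
  rw [Real.coe_toNNReal _ hK]
  have h3 : shear ψ q' - shear ψ q = (q' - q) + vec2 0 (ψ (q' 0) - ψ (q 0)) := by
    apply E2.ext_coord
    · simp
    · simp; ring
  have h4 : ‖vec2 0 (ψ (q' 0) - ψ (q 0))‖ ≤ L * |q' 0 - q 0| := by
    refine (norm_le_abs_add_abs _).trans ?_
    simpa using hψ (q' 0) (q 0)
  rw [dist_comm, dist_eq_norm, h3]
  refine (norm_add_le _ _).trans ?_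
  rw [← dist_eq_norm, dist_comm]
  nlinarith

lemma volume_inter_ball_eq_excess {E : Set E2} {q ν : E2} {r R : ℝ} (hR : 0 < R) :
    volume ((blow E q r ∆ halfPlane ν) ∩ Metric.ball (0 : E2) R) =
      ENNReal.ofReal (R ^ 2) * excess E q ν (r * R) := by
  have h1 := volume_blowup (0 : E2) hR ((blow E q r ∆ halfPlane ν) ∩ Metric.ball (0 : E2) R)
  have h2 : {y : E2 | (0 : E2) + R • y ∈ (blow E q r ∆ halfPlane ν) ∩ Metric.ball (0 : E2) R} =
      (blow E q (r * R) ∆ halfPlane ν) ∩ Metric.ball (0 : E2) 1 := by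
    ext y
    have hb : (0 : E2) + R • y ∈ blow E q r ↔ y ∈ blow E q (r * R) := by
      change q + r • ((0 : E2) + R • y) ∈ E ↔ q + (r * R) • y ∈ E
      rw [zero_add, smul_smul]
    have hh : (0 : E2) + R • y ∈ halfPlane ν ↔ y ∈ halfPlane ν := by
      change ⟪(0 : E2) + R • y, ν⟫ ≤ 0 ↔ ⟪y, ν⟫ ≤ 0
      rw [zero_add, real_inner_smul_left]
      constructor
      · intro h; exact nonpos_of_mul_nonpos_right h hR
      · intro h; exact mul_nonpos_of_nonneg_of_nonpos hR.le h
    have hc : (0 : E2) + R • y ∈ Metric.ball (0 : E2) R ↔ y ∈ Metric.ball (0 : E2) 1 := by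
      rw [mem_ball_zero_iff, mem_ball_zero_iff, zero_add, norm_smul, Real.norm_of_nonneg hR.le]
      exact mul_lt_iff_lt_one_right hR
    change (0 : E2) + R • y ∈ (blow E q r ∆ halfPlane ν) ∩ Metric.ball (0 : E2) R ↔
      y ∈ (blow E q (r * R) ∆ halfPlane ν) ∩ Metric.ball (0 : E2) 1
    rw [mem_inter_iff, mem_inter_iff, mem_symmDiff, mem_symmDiff, hb, hh, hc]
  rw [h2] at h1
  rw [excess, h1, ← mul_assoc, ← ENNReal.ofReal_mul (by positivity),
    mul_inv_cancel₀ (by positivity), ENNReal.ofReal_one, one_mul]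

lemma IsOuterNormalAt.shear {E E' : Set E2} (hE : MeasurableSet E) {q ν : E2}
    (h : IsOuterNormalAt E q ν) (hν : ν 1 = 0) {ψ : ℝ → ℝ} {L : ℝ} (hL : 0 ≤ L)
    (hψ : ∀ x y, |ψ x - ψ y| ≤ L * |x - y|) (hψm : Measurable ψ)
    (hE' : ∀ y, y ∈ E' ↔ shear (-ψ) y ∈ E) : IsOuterNormalAt E' (shear ψ q) ν := by
  have hR : 0 < 1 + L := by positivity
  refine ⟨h.1, ?_⟩
  have hle : ∀ᶠ r in 𝓝[>] (0 : ℝ), excess E' (_root_.shear ψ q) ν r ≤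
      ENNReal.ofReal ((1 + L) ^ 2) * excess E q ν (r * (1 + L)) := by
    filter_upwards [self_mem_nhdsWithin] with r (hr : 0 < r)
    set ξ : ℝ → ℝ := fun x => -((ψ (q 0 + r * x) - ψ (q 0)) / r) with hξ
    have hξm : Measurable ξ := by
      refine ((hψm.comp ?_).sub_const _ |>.div_const _).neg
      fun_prop
    have hξL : ∀ x, |ξ x| ≤ L * |x| := fun x => by
      rw [hξ, abs_neg, abs_div, abs_of_pos hr, div_le_iff₀ hr]
      refine (hψ _ _).trans ?_
      rw [add_sub_cancel_left, abs_mul, abs_of_pos hr]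
      exact le_of_eq (by ring)
    rw [← volume_inter_ball_eq_excess hR, ← (measurePreserving_shear hξm).measure_preimage
      (((measurableSet_blow hE q r).symmDiff (measurableSet_halfPlane ν)).inter
        Metric.isOpen_ball.measurableSet).nullMeasurableSet]
    refine measure_mono ?_
    rintro y ⟨hy1, hy2⟩
    have hb : y ∈ blow E' (_root_.shear ψ q) r ↔ _root_.shear ξ y ∈ blow E q r := by
      change _root_.shear ψ q + r • y ∈ E' ↔ q + r • _root_.shear ξ y ∈ E
      rw [hE']
      have : _root_.shear (-ψ) (_root_.shear ψ q + r • y) = q + r • _root_.shear ξ y := by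
        apply E2.ext_coord
        · simp
        · simp [hξ]
          field_simp
          ring
      rw [this]
    have hh : y ∈ halfPlane ν ↔ _root_.shear ξ y ∈ halfPlane ν := by
      change ⟪y, ν⟫ ≤ 0 ↔ ⟪_root_.shear ξ y, ν⟫ ≤ 0
      rw [inner_coord, inner_coord, hν]
      simp
    refine ⟨?_, ?_⟩
    · rw [mem_symmDiff, hb, hh] at hy1
      exact hy1
    · rw [mem_ball_zero_iff] at hy2 ⊢
      have h3 : _root_.shear ξ y = y + vec2 0 (ξ (y 0)) := by
        apply E2.ext_coord <;> simp
      have h4 : ‖vec2 0 (ξ (y 0))‖ ≤ L * |y 0| := by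
        refine (norm_le_abs_add_abs _).trans ?_
        simpa using hξL (y 0)
      rw [h3]
      have h5 := norm_add_le y (vec2 0 (ξ (y 0)))
      have h6 := abs_coord_le_norm y 0
      nlinarith
  have hlim : Tendsto (fun r => ENNReal.ofReal ((1 + L) ^ 2) * excess E q ν (r * (1 + L)))
      (𝓝[>] 0) (𝓝 0) := by
    have h1 : Tendsto (fun r : ℝ => r * (1 + L)) (𝓝[>] 0) (𝓝[>] 0) := by
      refine tendsto_nhdsWithin_iff.2 ⟨?_, ?_⟩
      · have : Tendsto (fun r : ℝ => r * (1 + L)) (𝓝 0) (𝓝 (0 * (1 + L))) :=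
          tendsto_id.mul_const _
        rw [zero_mul] at this
        exact this.mono_left nhdsWithin_le_nhds
      · filter_upwards [self_mem_nhdsWithin] with r (hr : 0 < r)
        exact mul_pos hr hR
    have := ENNReal.Tendsto.const_mul (h.2.comp h1) (Or.inr ENNReal.ofReal_ne_top)
      (a := ENNReal.ofReal ((1 + L) ^ 2))
    rwa [mul_zero] at this
  exact tendsto_of_tendsto_of_tendsto_of_le_of_le' tendsto_const_nhds hlim
    (Eventually.of_forall fun _ => zero_le) hle

end VerticalPart

section PerimeterOfSubgraph

lemma aniPer_congr {φ : E2 → ℝ} {E F Ω : Set E2} (h : volume (E ∆ F) = 0) :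
    aniPer φ E Ω = aniPer φ F Ω := by
  have h1 : genNormal E = genNormal F := by
    funext q
    by_cases hq : q ∈ redBoundary E
    · exact (((isOuterNormalAt_genNormal hq).congr h).genNormal_eq).symm
    · have hq' : q ∉ redBoundary F := by rwa [← redBoundary_congr h]
      rw [genNormal, genNormal, dif_neg (show ¬ ∃ ν, IsOuterNormalAt E q ν from hq),
        dif_neg (show ¬ ∃ ν, IsOuterNormalAt F q ν from hq')]
  rw [aniPer, aniPer, redBoundary_congr h, h1]

variable {φ : E2 → ℝ} {I J G D : Set ℝ} {w v p : ℝ → ℝ} {a b M R : ℝ}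

lemma measurableSet_strip {S : Set ℝ} (hS : MeasurableSet S) : MeasurableSet (strip S) := by
  have h0 : Measurable fun q : E2 => q 0 := by fun_prop
  exact h0 hS

lemma aniPer_subg_eq (hφ : IsAnisotropy φ) (hI : Ioo a b ⊆ I) (hG : ∀ᵐ s, s ∈ Ioo a b → s ∈ G)
    (hE : MeasurableSet (subg I w)) (hM : ∀ s ∈ G, |w s| ≤ M) (hMR : M < R)
    (hJm : MeasurableSet J) (hJ : J ⊆ Ioo a b) (hDG : D ⊆ G) (hDJ : D ⊆ J) (hDm : MeasurableSet D)
    (hS : volume (J \ D) = 0) (hpm : Measurable p) (hp : ∀ s ∈ D, HasDerivWithinAt w (p s) G s)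
    (hv : Measurable v) (hwv : EqOn w v D) :
    aniPer φ (subg I w) (box J (Ioo (-R) R)) = (∫⁻ s in D, ENNReal.ofReal (areaInt φ (p s))) +
      ENNReal.ofReal (dualA φ e1) * μH[1] (verticalBoundary (subg I w) ∩ strip (J \ D)) := by
  set E := subg I w with hEdef
  set Γ : Set E2 := (fun s => vec2 s (w s)) '' D with hΓ
  set V : Set E2 := verticalBoundary E ∩ strip (J \ D) with hV
  have hΓm : MeasurableSet Γ := by
    have : Γ = (fun s => vec2 s (v s)) '' D :=
      image_congr fun s hs => by rw [hwv hs]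
    rw [this]
    exact measurableSet_graph_image hv hDm
  have hVm : MeasurableSet V :=
    (measurableSet_verticalBoundary hE).inter (measurableSet_strip (hJm.diff hDm))
  have hdisj : Disjoint Γ V := by
    rw [Set.disjoint_left]
    rintro _ ⟨s, hs, rfl⟩ ⟨-, h⟩
    exact h.2 hs
  have hnormal : ∀ s ∈ D, IsOuterNormalAt E (vec2 s (w s)) (graphNormal (p s)) :=
    fun s hs => isOuterNormalAt_graph hI hG (hJ (hDJ hs)) (hp s hs)
  have hbd : ∀ q ∈ redBoundary E, q 0 ∈ J → q 1 ∈ Ioo (-R) R := fun q hq hq0 => by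
    have := abs_le_of_mem_redBoundary hI hG hM hq (hJ hq0)
    exact abs_lt.1 (this.trans_lt hMR)
  have hsub1 : Γ ∪ V ⊆ box J (Ioo (-R) R) ∩ redBoundary E := by
    rintro q (⟨s, hs, rfl⟩ | ⟨hq, hq0⟩)
    · have h1 : vec2 s (w s) ∈ redBoundary E := ⟨_, hnormal s hs⟩
      exact ⟨⟨hDJ hs, hbd _ h1 (hDJ hs)⟩, h1⟩
    · have h1 := verticalBoundary_subset _ hq
      exact ⟨⟨hq0.1, hbd _ h1 hq0.1⟩, h1⟩
  have hsub2 : (box J (Ioo (-R) R) ∩ redBoundary E) \ (Γ ∪ V) ⊆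
      {q ∈ redBoundary E | q 0 ∈ J \ D ∧ genNormal E q 1 ≠ 0} := by
    rintro q ⟨⟨hq, hqE⟩, hq'⟩
    have hqD : q 0 ∉ D := fun h => hq' (Or.inl ⟨q 0, h, E2.ext_coord rfl
      (eq_of_mem_redBoundary hI hG hqE (hJ hq.1) (hp _ h).continuousWithinAt).symm⟩)
    refine ⟨hqE, ⟨hq.1, hqD⟩, fun h => hq' (Or.inr ⟨mem_verticalBoundary hqE h, hq.1, hqD⟩)⟩
  have hae : (box J (Ioo (-R) R) ∩ redBoundary E : Set E2) =ᵐ[μH[1]] (Γ ∪ V : Set E2) := by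
    rw [ae_eq_set]
    refine ⟨measure_mono_null hsub2 (hausdorffMeasure_slanted_eq_zero E hS), ?_⟩
    rw [sdiff_eq_bot_iff.2 hsub1]
    exact measure_empty
  rw [aniPer, setLIntegral_congr hae, lintegral_union hVm hdisj]
  congr 1
  · have hk : Measurable fun s => ENNReal.ofReal (dualA φ (graphNormal (p s))) := by
      refine ENNReal.measurable_ofReal.comp (hφ.continuous_dual.measurable.comp ?_)
      have : Continuous graphNormal := by
        have h1 : Continuous fun x : ℝ => (arcLen x)⁻¹ :=
          continuous_arcLen.inv₀ fun x => (one_pos.trans_le (one_le_arcLen x)).ne'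
        have h2 : Continuous fun x : ℝ => vec2 (-x) 1 :=
          continuous_vec2.comp (continuous_neg.prodMk continuous_const)
        exact h1.smul h2
      exact this.measurable.comp hpm
    have h1 : ∫⁻ q in Γ, ENNReal.ofReal (dualA φ (genNormal E q)) ∂μH[1] =
        ∫⁻ q in Γ, ENNReal.ofReal (dualA φ (graphNormal (p (q 0)))) ∂μH[1] := by
      refine setLIntegral_congr_fun hΓm ?_
      rintro _ ⟨s, hs, rfl⟩
      have := (hnormal s hs).genNormal_eq
      simp only [this, vec2_apply_zero]
    rw [h1, lintegral_graph_eq hDG hDm hpm hp hk]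
    refine setLIntegral_congr_fun hDm fun s _ => ?_
    have h0 : 0 < arcLen (p s) := one_pos.trans_le (one_le_arcLen _)
    have h2 : graphNormal (p s) = (arcLen (p s))⁻¹ • vec2 (-(p s)) 1 := rfl
    change ENNReal.ofReal _ * ENNReal.ofReal _ = _
    rw [← ENNReal.ofReal_mul h0.le, h2, hφ.dual_smul (inv_pos.2 h0), mul_inv_cancel_left₀ h0.ne']
    rfl
  · rw [← setLIntegral_const]
    refine setLIntegral_congr_fun hVm ?_
    rintro q ⟨hq, -⟩
    rcases genNormal_eq_of_mem_verticalBoundary hq with h | h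
    · simp only [h]
    · simp only [h, hφ.dual_neg]

lemma verticalBoundary_shear_subset {E E' : Set E2} (hE' : MeasurableSet E') {ψ : ℝ → ℝ} {L : ℝ}
    (hL : 0 ≤ L) (hψ : ∀ x y, |ψ x - ψ y| ≤ L * |x - y|) (hψm : Measurable ψ)
    (h : ∀ y, y ∈ E' ↔ shear (-ψ) y ∈ E) (S : Set ℝ) :
    verticalBoundary E' ∩ strip S ⊆ shear ψ '' (verticalBoundary E ∩ strip S) := by
  have hE : ∀ y, y ∈ E ↔ shear (- -ψ) y ∈ E' := fun y => by
    rw [h, neg_neg, shear_neg_shear]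
  have hψ' : ∀ x y, |(-ψ) x - (-ψ) y| ≤ L * |x - y| := fun x y => by
    have := hψ y x
    rw [abs_sub_comm y x] at this
    simpa [neg_add_eq_sub] using this
  rintro q ⟨hq, hqS⟩
  refine ⟨shear (-ψ) q, ⟨?_, ?_⟩, shear_shear_neg _ _⟩
  · rcases hq with hq | hq
    · exact Or.inl (hq.shear hE' (by simp [e1]) hL hψ' hψm.neg hE)
    · exact Or.inr (hq.shear hE' (by simp [e1]) hL hψ' hψm.neg hE)
  · exact hqS

lemma hausdorffMeasure_verticalBoundary_shear_le {E E' : Set E2} (hE' : MeasurableSet E') {ψ : ℝ → ℝ}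
    {L : ℝ} (hL : 0 ≤ L) (hψ : ∀ x y, |ψ x - ψ y| ≤ L * |x - y|) (hψm : Measurable ψ)
    (h : ∀ y, y ∈ E' ↔ shear (-ψ) y ∈ E) (S : Set ℝ) :
    μH[1] (verticalBoundary E' ∩ strip S) ≤ μH[1] (verticalBoundary E ∩ strip S) :=
  (measure_mono (verticalBoundary_shear_subset hE' hL hψ hψm h S)).trans
    (hausdorffMeasure_shear_le E hL hψ inter_subset_left)

end PerimeterOfSubgraph

section FiniteLength

variable {I G : Set ℝ} {w : ℝ → ℝ} {a b M : ℝ}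

/-- Jordan decomposition with both parts monotone on the whole line. -/
lemma exists_monotone_sub_monotone (hw : BoundedVariationOn w G) (hM : ∀ s ∈ G, |w s| ≤ M) :
    ∃ P Q : ℝ → ℝ, Monotone P ∧ Monotone Q ∧ ∀ s ∈ G, w s = P s - Q s := by
  have hfin : ∀ x, eVariationOn w (G ∩ Iic x) ≠ ⊤ := fun x =>
    ne_top_of_le_ne_top hw (eVariationOn.mono w inter_subset_left)
  set P : ℝ → ℝ := fun x => (eVariationOn w (G ∩ Iic x)).toReal with hP
  have hPm : Monotone P := fun x y hxy => ENNReal.toReal_mono (hfin y)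
    (eVariationOn.mono w (inter_subset_inter_right _ (Iic_subset_Iic.2 hxy)))
  have hPle : ∀ x, P x ≤ (eVariationOn w G).toReal := fun x =>
    ENNReal.toReal_mono hw (eVariationOn.mono w inter_subset_left)
  have hkey : ∀ x ∈ G, ∀ y ∈ G, x ≤ y → |w x - w y| ≤ P y - P x := by
    intro x hx y hy hxy
    have h1 := eVariationOn.add_le_union w (s := G ∩ Iic x) (t := G ∩ Icc x y)
      fun s hs t ht => hs.2.trans ht.2.1
    have h2 : G ∩ Iic x ∪ G ∩ Icc x y ⊆ G ∩ Iic y := by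
      rintro z (hz | hz)
      · exact ⟨hz.1, hz.2.trans hxy⟩
      · exact ⟨hz.1, hz.2.2⟩
    have h3 : edist (w x) (w y) ≤ eVariationOn w (G ∩ Icc x y) :=
      eVariationOn.edist_le w ⟨hx, left_mem_Icc.2 hxy⟩ ⟨hy, right_mem_Icc.2 hxy⟩
    have h4 : eVariationOn w (G ∩ Iic x) + edist (w x) (w y) ≤ eVariationOn w (G ∩ Iic y) :=
      (add_le_add le_rfl h3).trans (h1.trans (eVariationOn.mono w h2))
    have h5 := ENNReal.toReal_mono (hfin y) h4
    rw [ENNReal.toReal_add (hfin x) (edist_ne_top _ _), ← dist_edist, Real.dist_eq] at h5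
    linarith
  have hQ : MonotoneOn (fun s => P s - w s) G := fun x hx y hy hxy => by
    have := le_abs_self (w y - w x)
    have h := hkey x hx y hy hxy
    rw [abs_sub_comm] at h
    change P x - w x ≤ P y - w y
    linarith
  obtain ⟨Q, hQm, hQe⟩ := hQ.exists_monotone_extension
    ⟨-M, by
      rintro _ ⟨s, hs, rfl⟩
      have h1 := (abs_le.1 (hM s hs)).2
      have h2 : 0 ≤ P s := ENNReal.toReal_nonneg
      change -M ≤ P s - w s
      linarith⟩
    ⟨(eVariationOn w G).toReal + M, by
      rintro _ ⟨s, hs, rfl⟩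
      have h1 := (abs_le.1 (hM s hs)).1
      have h2 := hPle s
      change P s - w s ≤ _
      linarith⟩
  refine ⟨P, Q, hPm, hQm, fun s hs => ?_⟩
  rw [← hQe hs]
  ring

lemma le_of_mem_redBoundary_of_tendsto (hG : ∀ᵐ s, s ∈ Ioo a b → s ∈ G)
    {v : ℝ → ℝ} (hv : EqOn w v G) {q : E2} (hq : q ∈ redBoundary (subg I w)) (hq0 : q 0 ∈ Ioo a b)
    {l r : ℝ} (hl : Tendsto v (𝓝[<] (q 0)) (𝓝 l)) (hr : Tendsto v (𝓝[>] (q 0)) (𝓝 r)) :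
    q 1 ≤ max l r := by
  by_contra! hlt
  obtain ⟨η, h1, h2⟩ := exists_between hlt
  have hev : ∀ᶠ x in 𝓝[≠] (q 0), v x < η := by
    rw [← nhdsLT_sup_nhdsGT]
    exact eventually_sup.2 ⟨hl.eventually_lt_const ((le_max_left _ _).trans_lt h1),
      hr.eventually_lt_const ((le_max_right _ _).trans_lt h1)⟩
  obtain ⟨δ, hδ, hball⟩ := Metric.mem_nhdsWithin_iff.1 hev
  have hG' : ∀ᵐ s, s ∈ Ioo a b → s ∈ G \ {q 0} := by
    filter_upwards [hG, Measure.ae_ne volume (q 0)] with s hs hne h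
    exact ⟨hs h, hne⟩
  refine notMem_redBoundary_of_le hG' hq0 (δ := min δ (q 1 - η)) (lt_min hδ (by linarith)) ?_ hq
  intro s hs hd
  have h3 : v s < η := hball ⟨by
    rw [Metric.mem_ball, Real.dist_eq]; exact hd.trans_le (min_le_left _ _), hs.2⟩
  rw [hv hs.1]
  have := min_le_right δ (q 1 - η)
  linarith

lemma ge_of_mem_redBoundary_of_tendsto (hI : Ioo a b ⊆ I) (hG : ∀ᵐ s, s ∈ Ioo a b → s ∈ G)
    {v : ℝ → ℝ} (hv : EqOn w v G) {q : E2} (hq : q ∈ redBoundary (subg I w)) (hq0 : q 0 ∈ Ioo a b)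
    {l r : ℝ} (hl : Tendsto v (𝓝[<] (q 0)) (𝓝 l)) (hr : Tendsto v (𝓝[>] (q 0)) (𝓝 r)) :
    min l r ≤ q 1 := by
  by_contra! hlt
  obtain ⟨η, h1, h2⟩ := exists_between hlt
  have hev : ∀ᶠ x in 𝓝[≠] (q 0), η < v x := by
    rw [← nhdsLT_sup_nhdsGT]
    exact eventually_sup.2 ⟨hl.eventually_const_lt (h2.trans_le (min_le_left _ _)),
      hr.eventually_const_lt (h2.trans_le (min_le_right _ _))⟩
  obtain ⟨δ, hδ, hball⟩ := Metric.mem_nhdsWithin_iff.1 hev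
  have hG' : ∀ᵐ s, s ∈ Ioo a b → s ∈ G \ {q 0} := by
    filter_upwards [hG, Measure.ae_ne volume (q 0)] with s hs hne h
    exact ⟨hs h, hne⟩
  refine notMem_redBoundary_of_ge hI hG' hq0 (δ := min δ (η - q 1)) (lt_min hδ (by linarith)) ?_ hq
  intro s hs hd
  have h3 : η < v s := hball ⟨by
    rw [Metric.mem_ball, Real.dist_eq]; exact hd.trans_le (min_le_left _ _), hs.2⟩
  rw [hv hs.1]
  have := min_le_right δ (η - q 1)
  linarith

/-- The reduced boundary of the subgraph of a function of bounded variation has finite length. -/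
lemma hausdorffMeasure_redBoundary_lt_top (hI : Ioo a b ⊆ I) (hG : ∀ᵐ s, s ∈ Ioo a b → s ∈ G)
    (hw : BoundedVariationOn w G) (hM : ∀ s ∈ G, |w s| ≤ M) :
    μH[1] (redBoundary (subg I w) ∩ strip (Ioo a b)) < ⊤ := by
  obtain ⟨P, Q, hP, hQ, hPQ⟩ := exists_monotone_sub_monotone hw hM
  set A := redBoundary (subg I w) ∩ strip (Ioo a b) with hA
  set l : ℝ → ℝ := fun s => Function.leftLim P s - Function.leftLim Q s with hl
  set r : ℝ → ℝ := fun s => Function.rightLim P s - Function.rightLim Q s with hr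
  set σ : E2 → ℝ := fun q => Function.leftLim P (q 0) + Function.leftLim Q (q 0) + q 0 +
    |q 1 - l (q 0)| with hσ
  have hbd : ∀ q ∈ A, min (l (q 0)) (r (q 0)) ≤ q 1 ∧ q 1 ≤ max (l (q 0)) (r (q 0)) := by
    rintro q ⟨hq, hq0⟩
    have h1 : Tendsto (fun s => P s - Q s) (𝓝[<] (q 0)) (𝓝 (l (q 0))) :=
      (hP.tendsto_leftLim _).sub (hQ.tendsto_leftLim _)
    have h2 : Tendsto (fun s => P s - Q s) (𝓝[>] (q 0)) (𝓝 (r (q 0))) :=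
      (hP.tendsto_rightLim _).sub (hQ.tendsto_rightLim _)
    exact ⟨ge_of_mem_redBoundary_of_tendsto hI hG (fun s hs => hPQ s hs) hq hq0 h1 h2,
      le_of_mem_redBoundary_of_tendsto hG (fun s hs => hPQ s hs) hq hq0 h1 h2⟩
  have hlt : ∀ q ∈ A, ∀ q' ∈ A, q 0 < q' 0 →
      |q 0 - q' 0| + |q 1 - q' 1| ≤ σ q' - σ q := by
    intro q hq q' _ h
    have h1 := hP.leftLim_le_rightLim (le_refl (q 0))
    have h2 := hQ.leftLim_le_rightLim (le_refl (q 0))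
    have h3 := hP.rightLim_le_leftLim h
    have h4 := hQ.rightLim_le_leftLim h
    have h5 := hbd q hq
    have h6 : |q 1 - l (q 0)| + |r (q 0) - q 1| = |r (q 0) - l (q 0)| := by
      rcases le_total (l (q 0)) (r (q 0)) with h | h
      · rw [min_eq_left h, max_eq_right h] at h5
        rw [abs_of_nonneg (by linarith), abs_of_nonneg (by linarith), abs_of_nonneg (by linarith)]
        ring
      · rw [min_eq_right h, max_eq_left h] at h5
        rw [abs_of_nonpos (by linarith), abs_of_nonpos (by linarith), abs_of_nonpos (by linarith)]
        ring
    have h7 : |r (q 0) - l (q 0)| ≤ Function.rightLim P (q 0) - Function.leftLim P (q 0) +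
        (Function.rightLim Q (q 0) - Function.leftLim Q (q 0)) := by
      rw [abs_le]
      constructor <;> simp only [hl, hr] <;> linarith
    have h8 : |l (q' 0) - r (q 0)| ≤ Function.leftLim P (q' 0) - Function.rightLim P (q 0) +
        (Function.leftLim Q (q' 0) - Function.rightLim Q (q 0)) := by
      rw [abs_le]
      constructor <;> simp only [hl, hr] <;> linarith
    have h9 : |q 1 - q' 1| ≤ |r (q 0) - q 1| + |l (q' 0) - r (q 0)| + |q' 1 - l (q' 0)| := by
      rw [abs_sub_comm]
      have : q' 1 - q 1 = (r (q 0) - q 1) + (l (q' 0) - r (q 0)) + (q' 1 - l (q' 0)) := by ring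
      rw [this]
      exact abs_add_three _ _ _
    have h10 : |q 0 - q' 0| = q' 0 - q 0 := by rw [abs_of_neg (by linarith)]; ring
    simp only [hσ]
    linarith
  have hdist : ∀ q ∈ A, ∀ q' ∈ A, dist (id q) (id q') ≤ ((1 : ℝ≥0) : ℝ) * dist (σ q) (σ q') := by
    intro q hq q' hq'
    have h1 : dist q q' ≤ |q 0 - q' 0| + |q 1 - q' 1| := by
      rw [dist_eq_norm]; exact norm_le_abs_add_abs _
    rw [NNReal.coe_one, one_mul, Real.dist_eq]
    refine h1.trans ?_
    rcases lt_trichotomy (q 0) (q' 0) with h | h | h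
    · have := hlt q hq q' hq' h
      rw [abs_sub_comm (σ q)]
      exact this.trans (le_abs_self _)
    · have hb := hbd q hq
      have hb' := hbd q' hq'
      rw [← h] at hb'
      simp only [hσ, ← h, sub_self, abs_zero, zero_add, add_sub_add_left_eq_sub]
      rcases le_total (l (q 0)) (r (q 0)) with h | h
      · rw [min_eq_left h, max_eq_right h] at hb hb'
        rw [abs_of_nonneg (by linarith : 0 ≤ q 1 - l (q 0)), abs_of_nonneg (by linarith : 0 ≤ q' 1 - l (q 0)),
          sub_sub_sub_cancel_right]
      · rw [min_eq_right h, max_eq_left h] at hb hb'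
        rw [abs_of_nonpos (by linarith : q 1 - l (q 0) ≤ 0), abs_of_nonpos (by linarith : q' 1 - l (q 0) ≤ 0),
          neg_sub_neg, sub_sub_sub_cancel_right, abs_sub_comm]
    · have := hlt q' hq' q hq h
      rw [abs_sub_comm (q 0), abs_sub_comm (q 1)]
      exact this.trans (le_abs_self _)
  have hle := hausdorffMeasure_image_le_image hdist
  rw [image_id, ENNReal.coe_one, one_mul, hausdorffMeasure_real] at hle
  refine hle.trans_lt ((measure_mono (t := Icc (P a + Q a + a)
    (P b + Q b + b + (M + (P b - P a + Q b - Q a + |P a| + |Q b|)) + |P b| + |Q a|)) ?_).trans_lt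
      measure_Icc_lt_top)
  rintro _ ⟨q, hq, rfl⟩
  have hq0 := hq.2
  have h1 := hP.le_leftLim hq0.1
  have h2 := hQ.le_leftLim hq0.1
  have h3 := hP.leftLim_le hq0.2.le
  have h4 := hQ.leftLim_le hq0.2.le
  have h5 := abs_le_of_mem_redBoundary hI hG hM hq.1 hq0
  have h6 := abs_nonneg (q 1 - l (q 0))
  have h7 : |q 1 - l (q 0)| ≤ |q 1| + |l (q 0)| := abs_sub _ _
  have h8 : |l (q 0)| ≤ P b - P a + Q b - Q a + |P a| + |Q b| := by
    have := neg_abs_le (P a)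
    have := le_abs_self (P a)
    have := neg_abs_le (Q b)
    have := le_abs_self (Q b)
    rw [abs_le]
    constructor <;> simp only [hl] <;> linarith
  have h9 := abs_nonneg (P b)
  have h10 := abs_nonneg (Q a)
  have hab : a < q 0 ∧ q 0 < b := hq0
  constructor <;> simp only [hσ] <;> linarith [hab.1, hab.2]

end FiniteLength

section ShearPerimeter

lemma vec2_eq_smul (x y : ℝ) : vec2 x y = x • e1 + y • e2 := by
  apply E2.ext_coord <;> simp [e1, e2]

lemma single_zero_eq : (EuclideanSpace.single 0 1 : E2) = e1 := by
  apply E2.ext_coord <;> simp [e1]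

lemma single_one_eq : (EuclideanSpace.single 1 1 : E2) = e2 := by
  apply E2.ext_coord <;> simp [e2]

lemma hasFDerivAt_coord (i : Fin 2) (q : E2) :
    HasFDerivAt (fun q : E2 => q i) (EuclideanSpace.proj i : E2 →L[ℝ] ℝ) q :=
  (EuclideanSpace.proj i : E2 →L[ℝ] ℝ).hasFDerivAt

lemma contDiff_coord (i : Fin 2) : ContDiff ℝ 1 fun q : E2 => q i :=
  (EuclideanSpace.proj i : E2 →L[ℝ] ℝ).contDiff

lemma div2_eq {X : E2 → E2} (hX : ContDiff ℝ 1 X) (q : E2) :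
    div2 X q = fderiv ℝ (fun q => X q 0) q e1 + fderiv ℝ (fun q => X q 1) q e2 := by
  have h : ∀ (i : Fin 2) (v : E2), fderiv ℝ X q v i = fderiv ℝ (fun q => X q i) q v := by
    intro i v
    have h1 := (hasFDerivAt_coord i (X q)).comp q
      ((hX.differentiable one_ne_zero) q).hasFDerivAt
    have h2 : HasFDerivAt (fun q => X q i)
      ((EuclideanSpace.proj i : E2 →L[ℝ] ℝ).comp (fderiv ℝ X q)) q := h1
    rw [h2.fderiv]
    rfl
  rw [div2, Fin.sum_univ_two, single_zero_eq, single_one_eq, h, h]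

lemma div2_smul_e1 {Z : E2 → ℝ} (hZ : ContDiff ℝ 1 Z) (q : E2) :
    div2 (fun q => Z q • e1) q = fderiv ℝ Z q e1 := by
  have hd : ContDiff ℝ 1 fun q => Z q • e1 := hZ.smul contDiff_const
  have h0 : (fun q => (Z q • e1 : E2) 0) = Z := by funext q; simp [e1]
  have h1 : (fun q => (Z q • e1 : E2) 1) = fun _ => 0 := by funext q; simp [e1]
  rw [div2_eq hd, h0, h1]
  simp

lemma contDiff_shear {ψ : ℝ → ℝ} (hψ : ContDiff ℝ 1 ψ) : ContDiff ℝ 1 (shear ψ) := by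
  have h : shear ψ = fun q : E2 => q + ψ (q 0) • e2 := by
    funext q
    apply E2.ext_coord <;> simp [e2]
  rw [h]
  exact contDiff_id.add ((hψ.comp (contDiff_coord 0)).smul contDiff_const)

lemma fderiv_shear {ψ : ℝ → ℝ} (hψ : ContDiff ℝ 1 ψ) (q v : E2) :
    fderiv ℝ (shear ψ) q v = v + (deriv ψ (q 0) * v 0) • e2 := by
  have h : shear ψ = fun q : E2 => q + ψ (q 0) • e2 := by
    funext q
    apply E2.ext_coord <;> simp [e2]
  have h1 : HasFDerivAt (fun q : E2 => ψ (q 0))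
      (deriv ψ (q 0) • (EuclideanSpace.proj 0 : E2 →L[ℝ] ℝ)) q :=
    ((hψ.differentiable one_ne_zero) (q 0)).hasDerivAt.comp_hasFDerivAt q (hasFDerivAt_coord 0 q)
  have h2 := (hasFDerivAt_id q).add (h1.smul_const e2)
  rw [h, HasFDerivAt.fderiv (f := fun q : E2 => q + ψ (q 0) • e2) h2]
  rfl

/-- The shear map of a `C¹` function as a homeomorphism. -/
def shearHomeo {ψ : ℝ → ℝ} (hψ : Continuous ψ) : E2 ≃ₜ E2 where
  toFun := shear ψ
  invFun := shear (-ψ)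
  left_inv := shear_neg_shear ψ
  right_inv := shear_shear_neg ψ
  continuous_toFun := continuous_vec2.comp
    ((continuous_coord 0).prodMk ((continuous_coord 1).add (hψ.comp (continuous_coord 0))))
  continuous_invFun := continuous_vec2.comp
    ((continuous_coord 0).prodMk ((continuous_coord 1).add (hψ.neg.comp (continuous_coord 0))))

lemma isometry_vec2 (s : ℝ) : Isometry (vec2 s) := by
  refine Isometry.of_dist_eq fun t t' => ?_
  have : vec2 s t - vec2 s t' = vec2 0 (t - t') := by apply E2.ext_coord <;> simp
  rw [dist_eq_norm, this, norm_vec2, Real.dist_eq, zero_pow two_ne_zero, zero_add, Real.sqrt_sq_eq_abs]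

lemma hasDerivAt_vec2 (s t : ℝ) : HasDerivAt (vec2 s) e2 t := by
  have h : vec2 s = fun t => s • e1 + t • e2 := funext fun t => vec2_eq_smul s t
  rw [h]
  simpa using ((hasDerivAt_id t).smul_const e2).const_add (s • e1)

lemma contDiff_vec2 (s : ℝ) : ContDiff ℝ 1 (vec2 s) := by
  have h : vec2 s = fun t => s • e1 + t • e2 := funext fun t => vec2_eq_smul s t
  rw [h]
  fun_prop

variable {I : Set ℝ} {w : ℝ → ℝ}

/-- Vertical derivatives integrate over a subgraph to a boundary term. -/
lemma setIntegral_subg_vertical_le (hE : MeasurableSet (subg I w)) {Z : E2 → ℝ} (hZ : ContDiff ℝ 1 Z)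
    (hZc : HasCompactSupport Z) (hZ1 : ∀ q, |Z q| ≤ 1) {K : ℝ} (hK : 0 ≤ K)
    (hZK : ∀ q, Z q ≠ 0 → |q 0| ≤ K) {c : ℝ → ℝ} (hc : Continuous c) {C : ℝ} (hC : ∀ s, |c s| ≤ C) :
    Integrable (fun q => c (q 0) * fderiv ℝ Z q e2) ∧
      ∫ q in subg I w, c (q 0) * fderiv ℝ Z q e2 ≤ C * (2 * K) := by
  have hcont : Continuous fun q : E2 => c (q 0) * fderiv ℝ Z q e2 :=
    (hc.comp (continuous_coord 0)).mul ((hZ.continuous_fderiv one_ne_zero).clm_apply continuous_const)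
  have h_int : Integrable (fun q => c (q 0) * fderiv ℝ Z q e2) :=
    hcont.integrable_of_hasCompactSupport (hZc.fderiv_apply ℝ e2).mul_left
  refine ⟨h_int, ?_⟩
  have hC0 : 0 ≤ C := (abs_nonneg _).trans (hC 0)
  have hsec : ∀ s, ∫ t, (subg I w).indicator (fun q => c (q 0) * fderiv ℝ Z q e2) (vec2 s t) =
      I.indicator (fun s => c s * Z (vec2 s (w s))) s := by
    intro s
    by_cases hs : s ∈ I
    · have hd : ∀ t, deriv (Z ∘ vec2 s) t = fderiv ℝ Z (vec2 s t) e2 := fun t =>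
        (((hZ.differentiable one_ne_zero) (vec2 s t)).hasFDerivAt.comp_hasDerivAt t
          (hasDerivAt_vec2 s t)).deriv
      have h1 : ∀ t, (subg I w).indicator (fun q => c (q 0) * fderiv ℝ Z q e2) (vec2 s t) =
          (Iio (w s)).indicator (fun t => c s * deriv (Z ∘ vec2 s) t) t := by
        intro t
        by_cases ht : t < w s
        · rw [indicator_of_mem (show vec2 s t ∈ subg I w from ⟨hs, ht⟩),
            indicator_of_mem (show t ∈ Iio (w s) from ht), hd]
          rfl
        · rw [indicator_of_notMem (show vec2 s t ∉ subg I w from fun h => ht h.2),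
            indicator_of_notMem (show t ∉ Iio (w s) from ht)]
      simp_rw [h1]
      rw [integral_indicator measurableSet_Iio, ← integral_Iic_eq_integral_Iio, integral_const_mul,
        HasCompactSupport.integral_Iic_deriv_eq (hZ.comp (contDiff_vec2 s))
          (hZc.comp_isClosedEmbedding (isometry_vec2 s).isClosedEmbedding), indicator_of_mem hs]
      rfl
    · have h1 : ∀ t, (subg I w).indicator (fun q => c (q 0) * fderiv ℝ Z q e2) (vec2 s t) = 0 :=
        fun t => indicator_of_notMem (fun h => hs h.1) _
      simp_rw [h1]
      rw [integral_zero, indicator_of_notMem hs]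
  rw [← integral_indicator hE, integral_eq_integral_section (h_int.indicator hE)]
  simp_rw [hsec]
  refine (le_abs_self _).trans ?_
  have hb : ∀ s, ‖I.indicator (fun s => c s * Z (vec2 s (w s))) s‖ ≤
      (Icc (-K) K).indicator (fun _ => C) s := by
    intro s
    by_cases hs : s ∈ I ∧ Z (vec2 s (w s)) ≠ 0
    · have hsK : s ∈ Icc (-K) K := abs_le.1 (hZK _ hs.2)
      rw [indicator_of_mem hs.1, indicator_of_mem hsK, norm_mul, Real.norm_eq_abs, Real.norm_eq_abs]
      have := hZ1 (vec2 s (w s))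
      have := hC s
      nlinarith [abs_nonneg (c s), abs_nonneg (Z (vec2 s (w s)))]
    · have h0 : I.indicator (fun s => c s * Z (vec2 s (w s))) s = 0 := by
        by_cases hsI : s ∈ I
        · have : Z (vec2 s (w s)) = 0 := by
            by_contra h; exact hs ⟨hsI, h⟩
          rw [indicator_of_mem hsI, this, mul_zero]
        · exact indicator_of_notMem hsI _
      rw [h0, norm_zero]
      exact indicator_nonneg (fun _ _ => hC0) s
  have hgi : Integrable ((Icc (-K) K).indicator fun _ => C) :=
    (integrable_indicator_iff measurableSet_Icc).2 (integrableOn_const (by simp))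
  refine (norm_integral_le_of_norm_le hgi (Eventually.of_forall hb)).trans ?_
  rw [integral_indicator measurableSet_Icc, setIntegral_const, Real.volume_real_Icc]
  rw [max_eq_left (by linarith), smul_eq_mul]
  exact le_of_eq (by ring)

lemma setIntegral_le_perVar {F Ω : Set E2} (hF : perVar F Ω < ⊤) {X : E2 → E2} (hX : ContDiff ℝ 1 X)
    (hXc : HasCompactSupport X) (hXs : tsupport X ⊆ Ω) (hX1 : ∀ x, ‖X x‖ ≤ 1) :
    ∫ x in F, div2 X x ≤ (perVar F Ω).toReal := by
  rw [← ENNReal.ofReal_le_iff_le_toReal hF.ne]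
  exact le_iSup_of_le X (le_iSup_of_le hX (le_iSup_of_le hXc (le_iSup_of_le hXs
    (le_iSup_of_le hX1 le_rfl))))

lemma perVar_shear_lt_top (hE : MeasurableSet (subg I w)) {ψ : ℝ → ℝ} (hψ : ContDiff ℝ 1 ψ)
    {L : ℝ} (hL : ∀ s, |deriv ψ s| ≤ L) {E' : Set E2}
    (hE' : ∀ q, q ∈ E' ↔ shear (-ψ) q ∈ subg I w) {Ω Ω' : Set E2} (hΩ : IsCompact (closure Ω))
    (hΩ' : ∀ q, shear ψ q ∈ Ω → q ∈ Ω') (hfin : perVar (subg I w) Ω' < ⊤) : perVar E' Ω < ⊤ := by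
  obtain ⟨K, hK, hΩK⟩ := hΩ.isBounded.exists_pos_norm_le
  refine lt_of_le_of_lt (b := ENNReal.ofReal
    ((perVar (subg I w) Ω').toReal + (1 * (2 * K) + L * (2 * K)))) ?_ ENNReal.ofReal_lt_top
  refine iSup_le fun X => iSup_le fun hX => iSup_le fun hXc => iSup_le fun hXs => iSup_le fun hX1 =>
    ENNReal.ofReal_le_ofReal ?_
  set T := shear ψ with hT
  have hTd : ContDiff ℝ 1 T := contDiff_shear hψ
  set H := shearHomeo hψ.continuous with hH
  have hX0 : ∀ i, ContDiff ℝ 1 fun q => X q i := fun i => (contDiff_coord i).comp hX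
  have hXci : ∀ i, HasCompactSupport fun q => X q i := fun i =>
    hXc.comp_left (g := fun q : E2 => q i) rfl
  set Z : Fin 2 → E2 → ℝ := fun i q => X (T q) i with hZ
  have hZd : ∀ i, ContDiff ℝ 1 (Z i) := fun i => (hX0 i).comp hTd
  have hZc : ∀ i, HasCompactSupport (Z i) := fun i => (hXci i).comp_homeomorph H
  have hZ1 : ∀ i q, |Z i q| ≤ 1 := fun i q => (abs_coord_le_norm _ i).trans (hX1 _)
  have hZK : ∀ i q, Z i q ≠ 0 → |q 0| ≤ K := by
    intro i q hq
    have h1 : X (T q) ≠ 0 := fun h => hq (by simp only [hZ, h]; rfl)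
    have h2 : T q ∈ Ω := hXs (subset_tsupport _ h1)
    exact (abs_coord_le_norm (T q) 0).trans (hΩK _ (subset_closure h2))
  have hZf : ∀ i q v, fderiv ℝ (Z i) q v =
      fderiv ℝ (fun q => X q i) (T q) v + deriv ψ (q 0) * v 0 * fderiv ℝ (fun q => X q i) (T q) e2 := by
    intro i q v
    have h1 : HasFDerivAt (Z i) ((fderiv ℝ (fun q => X q i) (T q)).comp (fderiv ℝ T q)) q :=
      (((hX0 i).differentiable one_ne_zero) (T q)).hasFDerivAt.comp q
        ((hTd.differentiable one_ne_zero) q).hasFDerivAt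
    rw [h1.fderiv, ContinuousLinearMap.comp_apply, hT, fderiv_shear hψ, map_add, map_smul, smul_eq_mul]
  have hdiv : ∀ q, div2 X (T q) = div2 (fun q => Z 0 q • e1) q +
      (1 * fderiv ℝ (Z 1) q e2 + -deriv ψ (q 0) * fderiv ℝ (Z 0) q e2) := by
    intro q
    rw [div2_eq hX, div2_smul_e1 (hZd 0), hZf, hZf, hZf]
    simp [e1, e2]
    ring
  have hmp : MeasurePreserving T := measurePreserving_shear hψ.continuous.measurable
  have hpre : T ⁻¹' E' = subg I w := by
    ext q
    change T q ∈ E' ↔ _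
    rw [hE', hT, shear_neg_shear]
  rw [← hmp.setIntegral_preimage_emb H.measurableEmbedding (div2 X) E', hpre]
  simp_rw [hdiv]
  have hA := setIntegral_subg_vertical_le hE (hZd 1) (hZc 1) (hZ1 1) hK.le (hZK 1)
    (c := fun _ => 1) continuous_const (C := 1) (by simp)
  have hB := setIntegral_subg_vertical_le hE (hZd 0) (hZc 0) (hZ1 0) hK.le (hZK 0)
    (c := fun s => -deriv ψ s) (hψ.continuous_deriv le_rfl).neg (C := L)
    (fun s => by rw [abs_neg]; exact hL s)
  have hVd : ContDiff ℝ 1 fun q => Z 0 q • e1 := (hZd 0).smul contDiff_const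
  have hVc : HasCompactSupport fun q => Z 0 q • e1 := (hZc 0).smul_right
  have hVi : Integrable (div2 fun q => Z 0 q • e1) := by
    have : div2 (fun q => Z 0 q • e1) = fun q => fderiv ℝ (Z 0) q e1 :=
      funext (div2_smul_e1 (hZd 0))
    rw [this]
    exact (((hZd 0).continuous_fderiv one_ne_zero).clm_apply
      continuous_const).integrable_of_hasCompactSupport ((hZc 0).fderiv_apply ℝ e1)
  have hAB : Integrable fun q => 1 * fderiv ℝ (Z 1) q e2 + -deriv ψ (q 0) * fderiv ℝ (Z 0) q e2 :=
    hA.1.add hB.1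
  rw [integral_add hVi.integrableOn hAB.integrableOn,
    integral_add hA.1.integrableOn hB.1.integrableOn]
  refine add_le_add (setIntegral_le_perVar hfin hVd hVc ?_ ?_) (add_le_add hA.2 hB.2)
  · intro q hq
    have h1 : q ∈ tsupport (X ∘ T) := by
      refine closure_mono ?_ hq
      intro x hx h
      apply hx
      have h' : X (T x) = 0 := h
      simp only [hZ, h']
      simp
    exact hΩ' q (hXs (tsupport_comp_subset_preimage X hTd.continuous h1))
  · intro q
    have he : ‖e1‖ = 1 := by simp [e1, norm_vec2]
    rw [norm_smul, he, mul_one]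
    exact hZ1 0 q

end ShearPerimeter

section Competitor

variable {I : Set ℝ} {u ψ : ℝ → ℝ}

lemma measurable_indicator_of_measurableSet_subg (hI : MeasurableSet I)
    (hE : MeasurableSet (subg I u)) : Measurable (I.indicator u) := by
  refine measurable_of_Ioi fun c => ?_
  have h1 : MeasurableSet {s : ℝ | vec2 s c ∈ subg I u} :=
    (measurable_vec2.comp (measurable_id.prodMk measurable_const)) hE
  have h2 : I.indicator u ⁻¹' Ioi c = {s : ℝ | vec2 s c ∈ subg I u} ∪ (Iᶜ ∩ {_s : ℝ | c < 0}) := by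
    ext s
    by_cases hs : s ∈ I
    · have : s ∈ I.indicator u ⁻¹' Ioi c ↔ vec2 s c ∈ subg I u := by
        change c < I.indicator u s ↔ s ∈ I ∧ c < u s
        rw [indicator_of_mem hs]
        exact ⟨fun h => ⟨hs, h⟩, fun h => h.2⟩
      rw [this]
      exact ⟨Or.inl, fun h => h.resolve_right fun h => h.1 hs⟩
    · have : s ∈ I.indicator u ⁻¹' Ioi c ↔ c < 0 := by
        change c < I.indicator u s ↔ _
        rw [indicator_of_notMem hs]
      rw [this]
      exact ⟨fun h => Or.inr ⟨hs, h⟩, fun h => (h.resolve_left fun h => hs h.1).2⟩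
  rw [h2]
  exact h1.union (hI.compl.inter (MeasurableSet.const _))

lemma mem_subg_add_iff (q : E2) : q ∈ subg I (fun s => u s + ψ s) ↔ shear (-ψ) q ∈ subg I u := by
  change q 0 ∈ I ∧ q 1 < u (q 0) + ψ (q 0) ↔ q 0 ∈ I ∧ q 1 + -ψ (q 0) < u (q 0)
  exact and_congr_right fun _ => ⟨fun h => by linarith, fun h => by linarith⟩

lemma measurableSet_subg_add (hE : MeasurableSet (subg I u)) (hψ : Measurable ψ) :
    MeasurableSet (subg I fun s => u s + ψ s) := by
  have : (subg I fun s => u s + ψ s) = shear (-ψ) ⁻¹' subg I u :=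
    Set.ext fun q => mem_subg_add_iff q
  rw [this]
  exact measurable_shear hψ.neg hE

lemma volume_subg_symmDiff_le (hE : MeasurableSet (subg I u)) (hψ : Measurable ψ) :
    volume (subg I u ∆ subg I fun s => u s + ψ s) ≤ ∫⁻ s, ENNReal.ofReal |ψ s| := by
  rw [volume_eq_lintegral_section (hE.symmDiff (measurableSet_subg_add hE hψ))]
  refine lintegral_mono fun s => ?_
  have h : {t | vec2 s t ∈ subg I u ∆ subg I fun s => u s + ψ s} ⊆ uIcc (u s) (u s + ψ s) := by
    intro t (ht : vec2 s t ∈ subg I u ∆ subg I fun s => u s + ψ s)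
    rw [mem_uIcc]
    rcases ht with ⟨⟨h1, h2⟩, h3⟩ | ⟨⟨h1, h2⟩, h3⟩
    · right
      exact ⟨not_lt.1 fun h => h3 ⟨h1, h⟩, h2.le⟩
    · left
      exact ⟨not_lt.1 fun h => h3 ⟨h1, h⟩, h2.le⟩
  refine (measure_mono h).trans (le_of_eq ?_)
  rw [Real.volume_interval, add_sub_cancel_left]

lemma isCompact_box {A B : Set ℝ} (hA : IsCompact A) (hB : IsCompact B) : IsCompact (box A B) := by
  have : box A B = (fun p : ℝ × ℝ => vec2 p.1 p.2) '' (A ×ˢ B) := by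
    ext q
    constructor
    · rintro ⟨h0, h1⟩
      exact ⟨(q 0, q 1), ⟨h0, h1⟩, vec2_eta q⟩
    · rintro ⟨p, ⟨h0, h1⟩, rfl⟩
      exact ⟨h0, h1⟩
  rw [this]
  exact (hA.prod hB).image continuous_vec2

lemma isOpen_box {A B : Set ℝ} (hA : IsOpen A) (hB : IsOpen B) : IsOpen (box A B) :=
  (hA.preimage (continuous_coord 0)).inter (hB.preimage (continuous_coord 1))

lemma box_mono {A A' B B' : Set ℝ} (hA : A ⊆ A') (hB : B ⊆ B') : box A B ⊆ box A' B' :=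
  fun _ h => ⟨hA h.1, hB h.2⟩

lemma perVar_congr {E F Ω : Set E2} (h : volume (E ∆ F) = 0) : perVar E Ω = perVar F Ω := by
  have hae : E =ᵐ[volume] F := measure_symmDiff_eq_zero_iff.1 h
  unfold perVar
  simp_rw [setIntegral_congr_set hae]

lemma LocFinPer.of_shear (hE : LocFinPer (subg I u) (strip I)) (cψ : ContDiff ℝ 1 ψ)
    (kψ : HasCompactSupport ψ) {F : Set E2} (hF : MeasurableSet F)
    (hFE : volume (F ∆ subg I fun s => u s + ψ s) = 0) : LocFinPer F (strip I) := by
  refine ⟨hF, fun Ω hΩo hΩc hΩI => ?_⟩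
  rw [perVar_congr hFE]
  obtain ⟨L, hL⟩ := (kψ.deriv).exists_bound_of_continuous (cψ.continuous_deriv le_rfl)
  set H := shearHomeo cψ.continuous with hH
  refine perVar_shear_lt_top hE.1 cψ hL mem_subg_add_iff hΩc (Ω' := H ⁻¹' Ω) (fun _ h => h)
    (hE.2 _ (hΩo.preimage H.continuous) ?_ ?_)
  · rw [← H.preimage_closure]
    exact H.isCompact_preimage.2 hΩc
  · rw [← H.preimage_closure]
    exact fun q (hq : H q ∈ closure Ω) => (hΩI hq : (H q) 0 ∈ I)

end Competitor

section Main

variable {φ : E2 → ℝ} {I J G D : Set ℝ} {u ψ g p : ℝ → ℝ} {a b M Λ : ℝ}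

lemma GoodRep.lintegral_areaInt_le (H : GoodRep φ I J u g p a b M G D) (hφ : IsAnisotropy φ)
    (hJ : IsOpen J) (hJc : IsCompact (closure J)) (hΛ : 0 ≤ Λ)
    (h : IsLambdaLocMinPer φ Λ (strip I) (subg I u))
    (cψ : ContDiff ℝ 1 ψ) (kψ : HasCompactSupport ψ) (sψ : tsupport ψ ⊆ J) :
    ∫⁻ s in D, ENNReal.ofReal (areaInt φ (p s)) ≤
      (∫⁻ s in D, ENNReal.ofReal (areaInt φ (p s + deriv ψ s))) +
        ENNReal.ofReal (Λ * ∫ s in J, |ψ s|) := by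
  have hψm : Measurable ψ := cψ.continuous.measurable
  have hE : MeasurableSet (subg I u) := h.1.1
  have hJab : J ⊆ Ioo a b := subset_closure.trans H.subset_Ioo
  have hIab : Ioo a b ⊆ I := Ioo_subset_Icc_self.trans H.Icc_subset
  obtain ⟨B, hB⟩ := kψ.exists_bound_of_continuous cψ.continuous
  obtain ⟨L, hL, hLip⟩ := exists_lipschitz cψ kψ
  have hB0 : 0 ≤ B := (norm_nonneg _).trans (hB 0)
  set E := subg I u with hEdef
  set E' := subg I (fun s => u s + ψ s) with hE'def
  set F := subg I (fun s => u s + G.indicator ψ s) with hFdef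
  set R := M + B + 1 with hR
  set Ω := box J (Ioo (-R) R) with hΩ
  have hE' : MeasurableSet E' := measurableSet_subg_add hE hψm
  have hψG : Measurable (G.indicator ψ) := hψm.indicator H.measurableSet_G
  have hF : MeasurableSet F := measurableSet_subg_add hE hψG
  have hFE' : volume (F ∆ E') = 0 := by
    refine volume_eq_zero_of_coord H.ae_G fun q hq hqG => ?_
    have h1 : G.indicator ψ (q 0) = ψ (q 0) := by
      by_cases h0 : ψ (q 0) = 0
      · rw [indicator_apply_eq_self.2 fun _ => h0]
      · exact indicator_of_mem (hqG (hJab (sψ (subset_tsupport _ h0)))) _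
    have h2 : q ∈ F ↔ q ∈ E' := by
      change _ ∧ q 1 < u (q 0) + G.indicator ψ (q 0) ↔ _ ∧ q 1 < u (q 0) + ψ (q 0)
      rw [h1]
    rw [mem_symmDiff, h2] at hq
    tauto
  have hFper : LocFinPer F (strip I) := h.1.of_shear cψ kψ hF hFE'
  have hug : EqOn u g G := fun s hs => H.eqOn (H.G_subset hs)
  have huM : ∀ s ∈ G, |u s| ≤ M := fun s hs => by rw [hug hs]; exact H.bound s hs
  have hsub : E ∆ F ⊆ box (tsupport ψ) (Icc (-(M + B)) (M + B)) := by
    intro q hq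
    have h0 : G.indicator ψ (q 0) ≠ 0 := by
      intro h0
      have h2 : q ∈ F ↔ q ∈ E := by
        change _ ∧ q 1 < u (q 0) + G.indicator ψ (q 0) ↔ _ ∧ q 1 < u (q 0)
        rw [h0, add_zero]
      rw [mem_symmDiff, h2] at hq
      tauto
    have hqG : q 0 ∈ G := mem_of_indicator_ne_zero h0
    rw [indicator_of_mem hqG] at h0
    refine ⟨subset_tsupport _ h0, ?_⟩
    have h1 := abs_le.1 (huM _ hqG)
    have h2 := abs_le.1 (hB (q 0))
    have h3 : ∀ x, x ∈ E ↔ x 0 ∈ I ∧ x 1 < u (x 0) := fun x => Iff.rfl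
    have h4 : q ∈ F ↔ q 0 ∈ I ∧ q 1 < u (q 0) + ψ (q 0) := by
      change _ ∧ q 1 < u (q 0) + G.indicator ψ (q 0) ↔ _
      rw [indicator_of_mem hqG]
    rcases hq with ⟨h5, h6⟩ | ⟨h5, h6⟩
    · rw [h3] at h5
      rw [h4] at h6
      have h7 : u (q 0) + ψ (q 0) ≤ q 1 := not_lt.1 fun h => h6 ⟨h5.1, h⟩
      constructor <;> linarith [h5.2]
    · rw [h4] at h5
      rw [h3] at h6
      have h7 : u (q 0) ≤ q 1 := not_lt.1 fun h => h6 ⟨h5.1, h⟩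
      constructor <;> linarith [h5.2]
  have hK : IsCompact (box (tsupport ψ) (Icc (-(M + B)) (M + B))) := isCompact_box kψ isCompact_Icc
  have hcl : closure (E ∆ F) ⊆ box (tsupport ψ) (Icc (-(M + B)) (M + B)) :=
    closure_minimal hsub hK.isClosed
  have hK' : IsCompact (box (closure J) (Icc (-R) R)) := isCompact_box hJc isCompact_Icc
  have hΩcl : closure Ω ⊆ box (closure J) (Icc (-R) R) :=
    closure_minimal (box_mono subset_closure Ioo_subset_Icc_self) hK'.isClosed
  have hmin := h.2 Ω (isOpen_box hJ isOpen_Ioo) (hK'.of_isClosed_subset isClosed_closure hΩcl)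
    (fun q hq => hIab (H.subset_Ioo (hΩcl hq).1)) F hFper
    (hK.of_isClosed_subset isClosed_closure hcl)
    (hcl.trans (box_mono sψ fun x hx => ⟨by linarith [hx.1], by linarith [hx.2]⟩))
  have hS : volume (J \ D) = 0 := by
    refine measure_mono_null ?_ (ae_iff.1 H.ae_D)
    intro s hs hs'
    exact hs.2 (hs' hs.1)
  have hdu : ∀ s ∈ D, HasDerivWithinAt u (p s) G s := fun s hs =>
    (H.hasDeriv s hs).congr hug (hug (H.D_subset_G hs))
  have hdu' : ∀ s ∈ D, HasDerivWithinAt (fun s => u s + ψ s) (p s + deriv ψ s) G s := fun s hs =>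
    (hdu s hs).add ((cψ.differentiable one_ne_zero) s).hasDerivAt.hasDerivWithinAt
  have hPE := aniPer_subg_eq (R := R) hφ hIab H.ae_G hE huM (by linarith) hJ.measurableSet hJab
    H.D_subset_G H.D_subset_J H.measurableSet_D hS H.measurable_deriv hdu H.measurable
    fun s hs => hug (H.D_subset_G hs)
  have hPE' := aniPer_subg_eq (M := M + B) (R := R) hφ hIab H.ae_G hE'
    (fun s hs => (abs_add_le _ _).trans (add_le_add (huM s hs) (hB s))) (by linarith)
    hJ.measurableSet hJab H.D_subset_G H.D_subset_J H.measurableSet_D hS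
    (H.measurable_deriv.add (cψ.continuous_deriv le_rfl).measurable) hdu'
    (H.measurable.add hψm)
    fun s hs => by
      change u s + ψ s = g s + ψ s
      rw [hug (H.D_subset_G hs)]
  have hX := hausdorffMeasure_verticalBoundary_shear_le hE' hL hLip hψm
    (fun q => mem_subg_add_iff q) (J \ D)
  have hXfin : μH[1] (verticalBoundary E ∩ strip (J \ D)) < ⊤ := by
    have hbv : BoundedVariationOn u G := by
      rw [BoundedVariationOn, eVariationOn.eq_of_eqOn hug]
      exact H.boundedVariationOn
    refine (measure_mono ?_).trans_lt (hausdorffMeasure_redBoundary_lt_top hIab H.ae_G hbv huM)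
    exact inter_subset_inter (verticalBoundary_subset E) fun q hq => hJab hq.1
  have hvol : volume (E ∆ F) ≤ ENNReal.ofReal (∫ s in J, |ψ s|) := by
    refine (volume_subg_symmDiff_le hE hψG).trans ?_
    have hi : Integrable fun s => |ψ s| := (cψ.continuous.integrable_of_hasCompactSupport kψ).abs
    rw [ofReal_integral_eq_lintegral_ofReal hi.integrableOn (Eventually.of_forall fun _ => abs_nonneg _),
      ← lintegral_indicator hJ.measurableSet]
    refine lintegral_mono fun s => ?_
    by_cases hs : s ∈ J
    · rw [indicator_of_mem hs]
      refine ENNReal.ofReal_le_ofReal ?_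
      by_cases hsG : s ∈ G
      · rw [indicator_of_mem hsG]
      · rw [indicator_of_notMem hsG, abs_zero]
        exact abs_nonneg _
    · have h0 : ψ s = 0 := by
        by_contra h0
        exact hs (sψ (subset_tsupport _ h0))
      rw [indicator_apply_eq_self.2 fun _ => h0, h0, abs_zero, ENNReal.ofReal_zero]
      exact zero_le
  rw [aniPer_congr hFE', hPE, hPE'] at hmin
  have hc : ENNReal.ofReal (dualA φ e1) * μH[1] (verticalBoundary E ∩ strip (J \ D)) ≠ ⊤ :=
    ENNReal.mul_ne_top ENNReal.ofReal_ne_top hXfin.ne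
  rw [← ENNReal.add_le_add_iff_right hc]
  refine hmin.trans ?_
  rw [ENNReal.ofReal_mul hΛ, add_right_comm]
  exact add_le_add (add_le_add le_rfl (mul_le_mul_right hvol _)) (mul_le_mul_right hX _)

lemma GoodRep.integral_areaInt_sub_le (H : GoodRep φ I J u g p a b M G D) (hφ : IsAnisotropy φ)
    (hJ : IsOpen J) (hJc : IsCompact (closure J)) (hΛ : 0 ≤ Λ)
    (h : IsLambdaLocMinPer φ Λ (strip I) (subg I u))
    (cψ : ContDiff ℝ 1 ψ) (kψ : HasCompactSupport ψ) (sψ : tsupport ψ ⊆ J) :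
    ∫ s in J, (areaInt φ (p s) - areaInt φ (p s + deriv ψ s)) ≤ Λ * ∫ s in J, |ψ s| := by
  have hle := H.lintegral_areaInt_le hφ hJ hJc hΛ h cψ kψ sψ
  have hDJ : D =ᵐ[volume] J := by
    filter_upwards [H.ae_D] with s hs
    exact propext ⟨fun h => H.D_subset_J h, hs⟩
  rw [setLIntegral_congr hDJ, setLIntegral_congr hDJ] at hle
  have hcd : Continuous (deriv ψ) := cψ.continuous_deriv le_rfl
  have hm : ∀ q : ℝ → ℝ, Measurable q → Measurable fun s => areaInt φ (q s) := fun q hq =>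
    hφ.continuous_areaInt.measurable.comp hq
  have hnn : ∀ q : ℝ → ℝ, 0 ≤ᵐ[volume.restrict J] fun s => areaInt φ (q s) := fun q =>
    Eventually.of_forall fun s => hφ.areaInt_nonneg _
  have hi1 : IntegrableOn (fun s => areaInt φ (p s)) J :=
    (lintegral_ofReal_ne_top_iff_integrable (hm p H.measurable_deriv).aestronglyMeasurable (hnn p)).1
      H.lintegral_lt_top.ne
  obtain ⟨C, -, hC⟩ := hφ.areaInt_lipschitz
  have hi2 : IntegrableOn (fun s => areaInt φ (p s + deriv ψ s)) J := by
    have hd : IntegrableOn (fun s => C * |deriv ψ s|) J :=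
      ((hcd.integrable_of_hasCompactSupport kψ.deriv).abs.const_mul C).integrableOn
    refine Integrable.mono' (hi1.add hd)
      (hm _ (H.measurable_deriv.add hcd.measurable)).aestronglyMeasurable
      (Eventually.of_forall fun s => ?_)
    rw [Real.norm_of_nonneg (hφ.areaInt_nonneg _)]
    have h1 := (abs_le.1 (hC (p s + deriv ψ s) (p s))).2
    rw [add_sub_cancel_left] at h1
    change _ ≤ areaInt φ (p s) + C * |deriv ψ s|
    linarith
  have h0 : 0 ≤ Λ * ∫ s in J, |ψ s| := mul_nonneg hΛ (integral_nonneg fun _ => abs_nonneg _)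
  have h2 : 0 ≤ ∫ s in J, areaInt φ (p s + deriv ψ s) :=
    integral_nonneg fun _ => hφ.areaInt_nonneg _
  rw [← ofReal_integral_eq_lintegral_ofReal hi1 (hnn p),
    ← ofReal_integral_eq_lintegral_ofReal hi2 (hnn _), ← ENNReal.ofReal_add h2 h0,
    ENNReal.ofReal_le_ofReal_iff (add_nonneg h2 h0)] at hle
  rw [integral_sub hi1 hi2]
  linarith

end Main

/-- if the subgraph is a `Λ`-local perimeter minimizer, then `u`
is a `Λ`-local minimizer of the anisotropic area. -/
theorem stmt14
    (φ : E2 → ℝ) (hφ : IsAnisotropy φ)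
    (I : Set ℝ) (hIo : IsOpen I) (hIc : I.OrdConnected)
    (Λ : ℝ) (hΛ : 0 ≤ Λ)
    (u : ℝ → ℝ) (huBV : BVLocOn u I)
    (h : IsLambdaLocMinPer φ Λ (strip I) (subg I u)) :
    IsLambdaLocMin φ Λ I u := by
  intro J hJ hJc hJI ψ cψ kψ sψ
  rcases J.eq_empty_or_nonempty with rfl | hne
  · simp [aniArea]
  obtain ⟨g, p, a, b, M, G, D, H⟩ := exists_goodRep hφ hIo hIc huBV
    (measurable_indicator_of_measurableSet_subg hIo.measurableSet h.1.1) hne hJ hJc hJI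
  have hJab : J ⊆ Ioo a b := subset_closure.trans H.subset_Ioo
  refine (aniArea_le_add hφ hJ (hJab.trans Ioo_subset_Ioc_self) H.integrable H.measurable
    (H.eqOn.mono hJab) cψ kψ sψ (G := G) (p := p) ?_ ?_).trans ?_
  · filter_upwards [H.ae_G] with s hs hsJ
    exact hs (hJab hsJ)
  · filter_upwards [H.ae_D] with s hs hsJ
    exact H.hasDeriv s (hs hsJ)
  · exact add_le_add le_rfl
      (ENNReal.ofReal_le_ofReal (H.integral_areaInt_sub_le hφ hJ hJc hΛ h cψ kψ sψ))

end
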